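/- Let G be a finite group such that exactly two elements of cs(G) are composite numbers. If |cs(G)| = 3 or |cs(G)| = 6, then G is soluble. -/

import Mathlib

/-- The set of conjugacy class sizes of a group `G`. -/
def csSet (G : Type*) [Group G] : Set ℕ :=
  {n | ∃ g : G, n = (Subgroup.centralizer {g} : Subgroup G).index}

/-- A natural number is composite if it is greater than 1 and not prime. -/
def IsCompositeNat (n : ℕ) : Prop := 1 < n ∧ ¬ n.Prime

set_option linter.all false

namespace CS
open Polynomial

lemma avg_roots (s : Multiset ℂ) (N : ℕ) (hN : 0 < N) (hs : ∀ z ∈ s, z ^ N = 1)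
    (hd : 0 < Multiset.card s) (hint : IsIntegral ℤ (s.sum / (Multiset.card s : ℂ))) :
    s.sum = 0 ∨ ∃ c, ∀ z ∈ s, z = c := by
  classical
  by_cases h0 : s.sum = 0
  · exact Or.inl h0
  right
  set d := Multiset.card s with hdd
  have hdc : (d : ℂ) ≠ 0 := by exact_mod_cast hd.ne'
  let S : Set ℂ := {z | z ∈ s}
  let K := IntermediateField.adjoin ℚ S
  have hfin : S.Finite := by
    have : S = ↑s.toFinset := by ext z; simp [S]
    rw [this]; exact Finset.finite_toSet _
  have hintz : ∀ z ∈ S, IsIntegral ℚ z := fun z hz =>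
    ⟨X ^ N - 1, monic_X_pow_sub_C 1 hN.ne', by simp [hs z hz]⟩
  have hfd : FiniteDimensional ℚ K :=
    haveI := hfin.to_subtype
    IntermediateField.finiteDimensional_adjoin hintz
  have : NumberField K := { to_charZero := inferInstance, to_finiteDimensional := hfd }
  let t : Multiset K := s.attach.map (fun z => ⟨z.1, IntermediateField.subset_adjoin ℚ S z.2⟩)
  have htmap : t.map (algebraMap K ℂ) = s := by
    simp only [t, Multiset.map_map, Function.comp_def]
    exact Multiset.attach_map_val s
  have htsum : algebraMap K ℂ t.sum = s.sum := by
    rw [map_multiset_sum, htmap]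
  have htcard : Multiset.card t = d := by simp [t, hdd]
  have htpow : ∀ z ∈ t, z ^ N = 1 := by
    intro z hz
    apply (algebraMap K ℂ).injective
    rw [map_pow, map_one]
    apply hs
    rw [← htmap]
    exact Multiset.mem_map_of_mem _ hz
  let α : K := t.sum / d
  have hα : algebraMap K ℂ α = s.sum / d := by
    simp only [α, map_div₀, htsum, map_natCast]
  have hα0 : α ≠ 0 := by
    intro h
    rw [h, map_zero] at hα
    exact (div_ne_zero h0 hdc) hα.symm
  have hαi : IsIntegral ℤ α := by
    rw [← hα] at hint
    exact (isIntegral_algHom_iff ((algebraMap K ℂ).toIntAlgHom) (algebraMap K ℂ).injective).1 hint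
  have key : ∀ φ : K →+* ℂ, ‖φ α‖ ≤ 1 := by
    intro φ
    simp only [α, map_div₀, map_natCast, map_multiset_sum, norm_div, Complex.norm_natCast]
    rw [div_le_one (by exact_mod_cast hd)]
    refine (norm_multiset_sum_le _).trans ?_
    rw [Multiset.map_map]
    have : t.map ((fun x => ‖x‖) ∘ φ) = t.map (fun _ => (1:ℝ)) := by
      apply Multiset.map_congr rfl
      intro z hz
      have h1 : (φ z) ^ N = 1 := by rw [← map_pow, htpow z hz, map_one]
      exact Complex.norm_eq_one_of_pow_eq_one h1 hN.ne'
    rw [this]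
    simp [htcard]
  obtain ⟨n, hn, hpow⟩ := NumberField.Embeddings.pow_eq_one_of_norm_le_one K ℂ hα0 hαi key
  have hnorm : ‖s.sum / (d:ℂ)‖ = 1 := by
    rw [← hα]
    exact Complex.norm_eq_one_of_pow_eq_one (by rw [← map_pow, hpow, map_one]) hn.ne'
  set a : ℂ := s.sum / d with ha
  refine ⟨a, ?_⟩
  -- real parts
  have hsum : (s.map (fun z => 1 - (z * (starRingEnd ℂ) a).re)).sum = 0 := by
    rw [Multiset.sum_map_sub]
    have h1 : (s.map (fun z => (z * (starRingEnd ℂ) a).re)).sum = (s.sum * (starRingEnd ℂ) a).re := by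
      have h9 : (s.map (fun z => z * (starRingEnd ℂ) a)).sum = s.sum * (starRingEnd ℂ) a := by
        rw [Multiset.sum_map_mul_right]; simp
      rw [← h9]
      exact (Multiset.sum_hom' s Complex.reAddGroupHom (fun z => z * (starRingEnd ℂ) a))
    rw [h1]
    have h2 : s.sum = d * a := by rw [ha]; field_simp
    have h3 : s.sum * (starRingEnd ℂ) a = d := by
      rw [h2, mul_assoc, Complex.mul_conj, Complex.normSq_eq_norm_sq, hnorm]; simp
    rw [h3]; simp [hdd]
  have hnn : ∀ x ∈ s.map (fun z => 1 - (z * (starRingEnd ℂ) a).re), (0:ℝ) ≤ x := by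
    intro x hx
    obtain ⟨z, hz, rfl⟩ := Multiset.mem_map.1 hx
    have h1 := Complex.re_le_norm (z * (starRingEnd ℂ) a)
    have h2 : ‖z * (starRingEnd ℂ) a‖ = 1 := by
      rw [norm_mul, Complex.norm_eq_one_of_pow_eq_one (hs z hz) hN.ne', Complex.norm_conj, hnorm, one_mul]
    linarith
  intro z hz
  have hzero := Multiset.all_zero_of_le_zero_le_of_sum_eq_zero hnn hsum _ (Multiset.mem_map_of_mem _ hz)
  have hre : (z * (starRingEnd ℂ) a).re = 1 := by linarith
  have hnz : ‖z‖ = 1 := Complex.norm_eq_one_of_pow_eq_one (hs z hz) hN.ne'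
  have h5 : Complex.normSq (z - a) = 0 := by
    rw [Complex.normSq_sub, hre, Complex.normSq_eq_norm_sq, Complex.normSq_eq_norm_sq, hnz, hnorm]
    norm_num
  exact sub_eq_zero.1 (Complex.normSq_eq_zero.1 h5)

lemma scalar_of_roots {d : ℕ} (M : Matrix (Fin d) (Fin d) ℂ) (N : ℕ) (hN : 0 < N) (hM : M ^ N = 1)
    (c : ℂ) (hc : ∀ z ∈ M.charpoly.roots, z = c) : M = Matrix.scalar (Fin d) c := by
  rcases Nat.eq_zero_or_pos d with rfl | hd
  · ext i; exact i.elim0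
  have hch : M.charpoly = (X - C c) ^ d := by
    have hs : M.charpoly.Splits := IsAlgClosed.splits _
    have h1 := hs.eq_prod_roots_of_monic (Matrix.charpoly_monic M)
    have hcard : Multiset.card M.charpoly.roots = d := by
      rw [← hs.natDegree_eq_card_roots, Matrix.charpoly_natDegree_eq_dim]; simp
    have : M.charpoly.roots = Multiset.replicate d c := by
      rw [Multiset.eq_replicate]; exact ⟨hcard, hc⟩
    rw [this] at h1
    simpa using h1
  have hCH : aeval M ((X - C c) ^ d : ℂ[X]) = 0 := by rw [← hch]; exact Matrix.aeval_self_charpoly M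
  have hNM : aeval M (X ^ N - C 1 : ℂ[X]) = 0 := by simp [hM]
  have hsq : Squarefree (X ^ N - C 1 : ℂ[X]) :=
    (separable_X_pow_sub_C 1 (by exact_mod_cast hN.ne') one_ne_zero).squarefree
  have hm1 : minpoly ℂ M ∣ (X - C c) ^ d := minpoly.dvd _ _ hCH
  have hm2 : minpoly ℂ M ∣ (X ^ N - C 1 : ℂ[X]) := minpoly.dvd _ _ hNM
  have hm3 : minpoly ℂ M ∣ (X - C c) := ((hsq.squarefree_of_dvd hm2).dvd_pow_iff_dvd hd.ne').1 hm1
  obtain ⟨q, hq⟩ := hm3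
  have : aeval M (X - C c : ℂ[X]) = 0 := by rw [hq, map_mul, minpoly.aeval, zero_mul]
  rw [map_sub, aeval_X, aeval_C] at this
  rw [sub_eq_zero.1 this]; rfl
end CS

namespace CS
open Polynomial

lemma trace_pi {n : ℕ} (d : Fin n → ℕ) (x : (i : Fin n) → Matrix (Fin (d i)) (Fin (d i)) ℂ) :
    LinearMap.trace ℂ ((i : Fin n) → Matrix (Fin (d i)) (Fin (d i)) ℂ) (LinearMap.mulLeft ℂ x)
      = ∑ i, (d i : ℂ) * (x i).trace := by
  classical
  let b := Pi.basis (fun i => Matrix.stdBasis ℂ (Fin (d i)) (Fin (d i)))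
  rw [LinearMap.trace_eq_matrix_trace ℂ b, Matrix.trace, Fintype.sum_sigma]
  refine Finset.sum_congr rfl fun i _ => ?_
  rw [Fintype.sum_prod_type]
  have : ∀ j k : Fin (d i), (LinearMap.toMatrix b b (LinearMap.mulLeft ℂ x)).diag ⟨i, (j, k)⟩ = x i j j := by
    intro j k
    rw [Matrix.diag_apply, LinearMap.toMatrix_apply]
    simp only [b, LinearMap.mulLeft_apply, Pi.basis_repr, Pi.basis_apply, Matrix.stdBasis_eq_single, Pi.mul_apply, Pi.single_eq_same]
    simp [Matrix.stdBasis]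
  simp only [this]
  rw [Matrix.trace, Finset.mul_sum]
  simp

open Classical in
lemma trace_monoidAlgebra {G : Type*} [Group G] [Finite G] (g : G) :
    LinearMap.trace ℂ (MonoidAlgebra ℂ G) (LinearMap.mulLeft ℂ (MonoidAlgebra.of ℂ G g)) =
      (if g = 1 then (Nat.card G : ℂ) else 0) := by
  have := Fintype.ofFinite G
  let b : Module.Basis G ℂ (MonoidAlgebra ℂ G) := MonoidAlgebra.basis G ℂ
  rw [LinearMap.trace_eq_matrix_trace ℂ b, Matrix.trace]
  have : ∀ x : G, (LinearMap.toMatrix b b (LinearMap.mulLeft ℂ (MonoidAlgebra.of ℂ G g))).diag x = if g = 1 then 1 else 0 := by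
    intro x
    rw [Matrix.diag_apply, LinearMap.toMatrix_apply]
    have h : (LinearMap.mulLeft ℂ (MonoidAlgebra.of ℂ G g)) (b x) = b (g * x) := by
      simp [b, MonoidAlgebra.basis_apply, MonoidAlgebra.single_mul_single]
    rw [h, b.repr_self, Finsupp.single_apply]
    simp
  simp only [this]
  split_ifs <;> simp
end CS

namespace CS
open Polynomial

lemma central_scalar {A : Type*} [Ring A] {m : ℕ} (f : A →+* Matrix (Fin m) (Fin m) ℂ)
    (hf : Function.Surjective f) (a : A) (ha : ∀ b, a * b = b * a) :
    ∃ c : ℂ, f a = Matrix.scalar (Fin m) c := by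
  have : f a ∈ Set.range (Matrix.scalar (Fin m)) := by
    apply Matrix.mem_range_scalar_of_commute_single
    intro i j _
    obtain ⟨b, hb⟩ := hf (Matrix.single i j 1)
    rw [← hb]
    show f b * f a = f a * f b
    rw [← map_mul, ← map_mul, ha]
  obtain ⟨c, hc⟩ := this
  exact ⟨c, hc.symm⟩

lemma index_centralizer {G : Type*} [Group G] [Finite G] (g : G) :
    (Subgroup.centralizer {g} : Subgroup G).index = Nat.card {x : G // IsConj g x} := by
  let f : G → {x : G // IsConj g x} := fun c => ⟨c * g * c⁻¹, isConj_iff.2 ⟨c, rfl⟩⟩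
  have hf : ∀ a b : G, f a = f b ↔ QuotientGroup.leftRel (Subgroup.centralizer {g}) a b := by
    intro a b
    rw [QuotientGroup.leftRel_apply, Subgroup.mem_centralizer_singleton_iff, Subtype.mk.injEq]
    constructor
    · intro h
      have : a⁻¹ * (a * g * a⁻¹) * b = a⁻¹ * (b * g * b⁻¹) * b := by rw [h]
      simp only [mul_assoc, inv_mul_cancel, inv_mul_cancel_left, mul_one] at this ⊢
      exact this.symm
    · intro h
      have : a * ((a⁻¹ * b) * g) * b⁻¹ = a * (g * (a⁻¹ * b)) * b⁻¹ := by rw [h]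
      simp only [mul_assoc, mul_inv_cancel, mul_inv_cancel_left, mul_one] at this ⊢
      exact this.symm
  rw [Subgroup.index]
  refine Nat.card_congr (Equiv.ofBijective (Quotient.lift f (fun a b h => (hf a b).2 h)) ⟨?_, ?_⟩)
  · intro a b
    induction a using Quotient.inductionOn
    induction b using Quotient.inductionOn
    intro h
    exact Quotient.sound ((hf _ _).1 h)
  · rintro ⟨x, hx⟩
    obtain ⟨c, rfl⟩ := isConj_iff.1 hx
    exact ⟨Quotient.mk _ c, rfl⟩

theorem burnside_simple (G : Type*) [Group G] [Finite G] [IsSimpleGroup G]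
    (hna : ¬ ∀ a b : G, a * b = b * a) {p n : ℕ} (hp : p.Prime) (g : G) (hg : g ≠ 1)
    (h : (Subgroup.centralizer {g} : Subgroup G).index = p ^ n) : False := by
  classical
  have := Fintype.ofFinite G
  obtain ⟨r, d, hd, ⟨φ⟩⟩ := IsSemisimpleRing.exists_algEquiv_pi_matrix_of_isAlgClosed ℂ (MonoidAlgebra ℂ G)
  let ρ : (i : Fin r) → MonoidAlgebra ℂ G →ₐ[ℂ] Matrix (Fin (d i)) (Fin (d i)) ℂ :=
    fun i => (Pi.evalAlgHom ℂ _ i).comp φ.toAlgHom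
  have hρ : ∀ i, Function.Surjective (ρ i) := by
    intro i M
    refine ⟨φ.symm (Pi.single i M), ?_⟩
    simp [ρ]
  have hreg : ∀ a : MonoidAlgebra ℂ G, LinearMap.trace ℂ _ (LinearMap.mulLeft ℂ a) = ∑ i, (d i : ℂ) * (ρ i a).trace := by
    intro a
    have h1 := trace_pi d (φ a)
    have h2 : LinearMap.mulLeft ℂ (φ a) = φ.toLinearEquiv.conj (LinearMap.mulLeft ℂ a) := by
      apply LinearMap.ext
      intro x
      simp [LinearEquiv.conj_apply]
    rw [h2, LinearMap.trace_conj'] at h1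
    exact h1
  let T : (x : G) → MonoidAlgebra ℂ G := fun x => MonoidAlgebra.of ℂ G x
  have hTmul : ∀ x y, T (x * y) = T x * T y := fun x y => map_mul _ _ _
  have hT1 : T 1 = 1 := map_one _
  have hsp : ∀ (x : MonoidAlgebra ℂ G), (∀ g : G, x * T g = T g * x) → ∀ b, x * b = b * x := by
    intro x hx b
    induction b using MonoidAlgebra.induction_on with
    | of m => exact hx m
    | add f g hf hg => rw [mul_add, add_mul, hf, hg]
    | smul c f hf => rw [mul_smul_comm, smul_mul_assoc, hf]
  -- trivial indices
  let S : Finset (Fin r) := Finset.univ.filter (fun i => ∀ x : G, ρ i (T x) = 1)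
  have hS : (∑ i ∈ S, (d i : ℂ) * (d i : ℂ)) = 1 := by
    let e : MonoidAlgebra ℂ G := ((Nat.card G : ℂ)⁻¹) • ∑ x : G, T x
    have hc0 : (Nat.card G : ℂ) ≠ 0 := by exact_mod_cast Nat.card_pos.ne'
    have he : LinearMap.trace ℂ _ (LinearMap.mulLeft ℂ e) = 1 := by
      have h3 : LinearMap.mulLeft ℂ e = ((Nat.card G : ℂ)⁻¹) • ∑ x : G, LinearMap.mulLeft ℂ (T x) := by
        apply LinearMap.ext
        intro y
        simp [e, Finset.sum_mul]
      rw [h3, map_smul, map_sum]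
      simp only [T, trace_monoidAlgebra]
      simp [hc0]
    have hTe : ∀ x, T x * e = e := by
      intro x
      simp only [e, mul_smul_comm, Finset.mul_sum, ← hTmul]
      congr 1
      exact Fintype.sum_equiv (Equiv.mulLeft x) _ _ (fun y => rfl)
    have heT : ∀ x, e * T x = e := by
      intro x
      simp only [e, smul_mul_assoc, Finset.sum_mul, ← hTmul]
      congr 1
      exact Fintype.sum_equiv (Equiv.mulRight x) _ _ (fun y => rfl)
    have hec := hsp e (fun x => by rw [hTe, heT])
    rw [hreg] at he
    rw [← he]
    rw [Finset.sum_filter]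
    refine Finset.sum_congr rfl fun i _ => ?_
    split_ifs with hi
    · have : ρ i e = 1 := by
        simp only [e, map_smul, map_sum, hi]
        rw [Finset.sum_const, Finset.card_univ, ← Nat.card_eq_fintype_card, ← Nat.cast_smul_eq_nsmul ℂ, smul_smul, inv_mul_cancel₀ hc0, one_smul]
      rw [this, Matrix.trace_one]
      simp
    · obtain ⟨c, hc⟩ := central_scalar (ρ i).toRingHom (hρ i) e hec
      have hc : ρ i e = Matrix.scalar (Fin (d i)) c := hc
      have : c = 0 := by
        by_contra hc'
        apply hi
        intro x
        have h4 : ρ i (T x) * ρ i e = ρ i e := by rw [← map_mul, hTe]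
        rw [hc] at h4
        have h5 : (c • (1 : Matrix (Fin (d i)) (Fin (d i)) ℂ)) = Matrix.scalar (Fin (d i)) c := by
          ext a b; simp [Matrix.one_apply, Matrix.diagonal_apply]
        rw [← h5, mul_smul_comm, mul_one] at h4
        exact smul_right_injective _ hc' h4
      rw [hc, this]
      simp
  have hg0 : (∑ i, (d i : ℂ) * (ρ i (T g)).trace) = 0 := by
    rw [← hreg]; simp only [T, trace_monoidAlgebra]; simp [hg]
  -- integrality of characters
  set N := Nat.card G with hN
  have hNpos : 0 < N := Nat.card_pos
  have hpowN : ∀ i, (ρ i (T g)) ^ N = 1 := by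
    intro i
    have : T g ^ N = 1 := by
      have : T g ^ N = T (g ^ N) := (map_pow (MonoidAlgebra.of ℂ G) g N).symm
      rw [this, hN, pow_card_eq_one', hT1]
    rw [← map_pow, this, map_one]
  have hroots : ∀ i, ∀ z ∈ (ρ i (T g)).charpoly.roots, z ^ N = 1 := by
    intro i z hz
    have hz1 : z ∈ spectrum ℂ (ρ i (T g)) := by
      rw [Matrix.mem_spectrum_iff_isRoot_charpoly]
      exact (Polynomial.mem_roots'.1 hz).2
    have := spectrum.pow_mem_pow (ρ i (T g)) N hz1
    rw [hpowN] at this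
    have hdi : NeZero (d i) := hd i
    rw [spectrum.one_eq] at this
    simpa using this
  have hχint : ∀ i, IsIntegral ℤ (ρ i (T g)).trace := by
    intro i
    rw [Matrix.trace_eq_sum_roots_charpoly]
    apply IsIntegral.multiset_sum
    intro z hz
    exact ⟨X ^ N - 1, monic_X_pow_sub_C 1 hNpos.ne', by simp [hroots i z hz]⟩
  -- class sum
  have hω : ∀ i, ∃ w : ℂ, IsIntegral ℤ w ∧ (d i : ℂ) * w = (p : ℂ) ^ n * (ρ i (T g)).trace := by
    intro i
    let Cl : Finset G := Finset.univ.filter (fun x => IsConj g x)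
    have hCl : Cl.card = p ^ n := by
      rw [← h, index_centralizer]
      simp [Cl, Fintype.card_subtype]
    obtain ⟨w, hw⟩ := central_scalar (ρ i).toRingHom (hρ i) (∑ x ∈ Cl, T x) (hsp _ (by
      intro y
      rw [Finset.sum_mul, Finset.mul_sum]
      refine Finset.sum_bij' (fun x _ => y⁻¹ * x * y) (fun x _ => y * x * y⁻¹) ?_ ?_ ?_ ?_ ?_
      · intro x hx
        simp only [Cl, Finset.mem_filter, Finset.mem_univ, true_and] at hx ⊢
        exact hx.trans (isConj_iff.2 ⟨y⁻¹, by simp⟩)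
      · intro x hx
        simp only [Cl, Finset.mem_filter, Finset.mem_univ, true_and] at hx ⊢
        exact hx.trans (isConj_iff.2 ⟨y, by simp⟩)
      · intro x _; group
      · intro x _; group
      · intro x _
        rw [← hTmul, ← hTmul]; congr 1; group))
    have hw : ρ i (∑ x ∈ Cl, T x) = Matrix.scalar (Fin (d i)) w := hw
    refine ⟨w, ?_, ?_⟩
    · have hdi : NeZero (d i) := hd i
      let ψ : G →* Matrix (Fin (d i)) (Fin (d i)) ℂ := ((ρ i : _ →* _)).comp (MonoidAlgebra.of ℂ G)
      let f := MonoidAlgebra.lift ℤ (Matrix (Fin (d i)) (Fin (d i)) ℂ) G ψ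
      have h1 : f (∑ x ∈ Cl, MonoidAlgebra.of ℤ G x) = Matrix.scalar (Fin (d i)) w := by
        rw [← hw, map_sum, map_sum]
        refine Finset.sum_congr rfl fun x _ => ?_
        rw [MonoidAlgebra.lift_of]; rfl
      have h2 : IsIntegral ℤ (Matrix.scalar (Fin (d i)) w) := by
        rw [← h1]
        exact (Algebra.IsIntegral.isIntegral (R := ℤ) (∑ x ∈ Cl, MonoidAlgebra.of ℤ G x)).map f
      have hinj : Function.Injective (Matrix.scalar (α := ℂ) (Fin (d i))) := by
        intro a b hab
        have := congrFun (congrFun hab 0) 0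
        simpa using this
      exact (isIntegral_algHom_iff (RingHom.toIntAlgHom (Matrix.scalar (α := ℂ) (Fin (d i)))) hinj).1 h2
    · have h1 := congrArg Matrix.trace hw
      rw [map_sum, Matrix.trace_sum] at h1
      have h2 : ∀ x ∈ Cl, (ρ i (T x)).trace = (ρ i (T g)).trace := by
        intro x hx
        simp only [Cl, Finset.mem_filter, Finset.mem_univ, true_and] at hx
        obtain ⟨c, rfl⟩ := isConj_iff.1 hx
        rw [hTmul, map_mul, Matrix.trace_mul_comm, ← map_mul, ← hTmul]
        congr 3; group
      rw [Finset.sum_congr rfl h2, Finset.sum_const, hCl] at h1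
      simp only [Matrix.scalar_apply, Matrix.trace_diagonal, Finset.sum_const, Finset.card_univ, Fintype.card_fin, nsmul_eq_mul] at h1
      rw [← h1]; push_cast; ring
  have hmain : ∀ i, i ∉ S → ∃ w : ℂ, IsIntegral ℤ w ∧ (d i : ℂ) * (ρ i (T g)).trace = p * w := by
    intro i hi
    by_cases hpd : p ∣ d i
    · obtain ⟨m, hm⟩ := hpd
      exact ⟨m * (ρ i (T g)).trace, (isIntegral_algebraMap (x := (m : ℤ))).mul (hχint i), by
        have : (d i : ℂ) = p * m := by exact_mod_cast hm
        rw [this]; ring⟩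
    obtain ⟨w, hw, hdw⟩ := hω i
    have hcop : IsCoprime (d i : ℤ) ((p : ℤ) ^ n) := by
      have := (hp.coprime_iff_not_dvd.2 hpd).symm.pow_right n
      exact_mod_cast Nat.isCoprime_iff_coprime.2 this
    obtain ⟨a, b, hab⟩ := hcop
    have hdi : (d i : ℂ) ≠ 0 := by exact_mod_cast (hd i).out
    have hq : (ρ i (T g)).trace / (d i : ℂ) = a * (ρ i (T g)).trace + b * w := by
      have h1 : (a : ℂ) * d i + b * p ^ n = 1 := by exact_mod_cast hab
      rw [div_eq_iff hdi]
      linear_combination (-(ρ i (T g)).trace) * h1 - b * hdw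
    have hqi : IsIntegral ℤ ((ρ i (T g)).trace / (d i : ℂ)) := by
      rw [hq]
      exact ((isIntegral_algebraMap (x := a)).mul (hχint i)).add ((isIntegral_algebraMap (x := b)).mul hw)
    rw [Matrix.trace_eq_sum_roots_charpoly] at hqi
    have hcard : Multiset.card (ρ i (T g)).charpoly.roots = d i := by
      rw [← (IsAlgClosed.splits _).natDegree_eq_card_roots, Matrix.charpoly_natDegree_eq_dim]; simp
    rcases avg_roots (ρ i (T g)).charpoly.roots N hNpos (hroots i)
      (by rw [hcard]; exact Nat.pos_of_ne_zero (hd i).out) (by rw [hcard]; exact hqi) with h0 | ⟨c, hc⟩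
    · refine ⟨0, isIntegral_zero, ?_⟩
      rw [Matrix.trace_eq_sum_roots_charpoly, h0]; simp
    · exfalso
      have hsc := scalar_of_roots _ N hNpos (hpowN i) c hc
      let ψ : G →* Matrix (Fin (d i)) (Fin (d i)) ℂ := ((ρ i : _ →* _)).comp (MonoidAlgebra.of ℂ G)
      have hψ : ∀ x, ψ x = ρ i (T x) := fun x => rfl
      rcases (inferInstance : ψ.ker.Normal).eq_bot_or_eq_top with hk | hk
      · have hcen : g ∈ Subgroup.center G := by
          rw [Subgroup.mem_center_iff]
          intro x
          have : (x * g) * (g * x)⁻¹ ∈ ψ.ker := by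
            rw [MonoidHom.mem_ker]
            have h1 : ψ (x * g) = ψ (g * x) := by
              rw [map_mul, map_mul, hψ g, hsc]
              exact ((Matrix.scalar_commute c (fun r => mul_comm _ _) _).eq).symm
            rw [map_mul, h1, ← map_mul, mul_inv_cancel, map_one]
          rw [hk, Subgroup.mem_bot, mul_inv_eq_one] at this
          exact this
        rcases (inferInstance : (Subgroup.center G).Normal).eq_bot_or_eq_top with hz | hz
        · rw [hz] at hcen; exact hg hcen
        · apply hna
          intro a b
          have : b ∈ Subgroup.center G := by rw [hz]; trivial
          exact Subgroup.mem_center_iff.1 this a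
      · apply hi
        simp only [S, Finset.mem_filter, Finset.mem_univ, true_and]
        intro x
        have : x ∈ ψ.ker := by rw [hk]; trivial
        exact this
  have hsum : ∃ w : ℂ, IsIntegral ℤ w ∧ (1 : ℂ) = p * w := by
    choose! w hw hw2 using hmain
    refine ⟨-∑ i ∈ Finset.univ.filter (fun i => i ∉ S), w i, (IsIntegral.sum _ (fun i hi => hw i (Finset.mem_filter.1 hi).2)).neg, ?_⟩
    have h1 : (∑ i ∈ Finset.univ.filter (fun i => i ∈ S), (d i : ℂ) * (ρ i (T g)).trace) = 1 := by
      rw [← hS]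
      have : Finset.univ.filter (fun i => i ∈ S) = S := by ext; simp
      rw [this]
      refine Finset.sum_congr rfl fun i hi => ?_
      have := (Finset.mem_filter.1 hi).2 g
      rw [this, Matrix.trace_one]; simp
    rw [← Finset.sum_filter_add_sum_filter_not Finset.univ (fun i => i ∈ S), h1] at hg0
    have h2 : (∑ i ∈ Finset.univ.filter (fun i => i ∉ S), (d i : ℂ) * (ρ i (T g)).trace) = p * ∑ i ∈ Finset.univ.filter (fun i => i ∉ S), w i := by
      rw [Finset.mul_sum]
      exact Finset.sum_congr rfl fun i hi => hw2 i (Finset.mem_filter.1 hi).2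
    rw [h2] at hg0
    linear_combination hg0
  obtain ⟨w, hw, hpw⟩ := hsum
  have hp0 : (p : ℂ) ≠ 0 := by exact_mod_cast hp.ne_zero
  have hwq : w = algebraMap ℚ ℂ ((p : ℚ)⁻¹) := by
    rw [map_inv₀, map_natCast]; field_simp; linear_combination -hpw
  rw [hwq] at hw
  have hw' : IsIntegral ℤ ((p : ℚ)⁻¹) :=
    (isIntegral_algHom_iff ((algebraMap ℚ ℂ).toIntAlgHom) (algebraMap ℚ ℂ).injective).1 hw
  obtain ⟨z, hz⟩ := IsIntegrallyClosed.isIntegral_iff.1 hw'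
  have : (p : ℚ) * z = 1 := by
    have : (z : ℚ) = (p : ℚ)⁻¹ := hz
    rw [this]; exact mul_inv_cancel₀ (by exact_mod_cast hp.ne_zero)
  have h3 : (p : ℤ) * z = 1 := by exact_mod_cast this
  have h4 : (p : ℤ) ∣ 1 := ⟨z, h3.symm⟩
  have : p ∣ 1 := by exact_mod_cast h4
  exact hp.one_lt.ne' (Nat.dvd_one.1 this)
end CS

namespace CS
section basics
variable {G : Type*} [Group G]

abbrev Ce (g : G) : Subgroup G := Subgroup.centralizer {g}
def PE (p : ℕ) (g : G) : Prop := ∃ n : ℕ, g ^ p ^ n = 1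
def PP (p : ℕ) (g : G) : Prop := (orderOf g).Coprime p

lemma mem_Ce {g h : G} : h ∈ Ce g ↔ h * g = g * h := by
  rw [Subgroup.mem_centralizer_singleton_iff]
lemma mem_Ce_comm {g h : G} : h ∈ Ce g ↔ g ∈ Ce h := by
  rw [mem_Ce, mem_Ce, eq_comm]
lemma self_mem_Ce (g : G) : g ∈ Ce g := mem_Ce.2 rfl
lemma pow_mem_Ce (g : G) (n : ℕ) : g ^ n ∈ Ce g := (Ce g).pow_mem (self_mem_Ce g) n
lemma Ce_pow (g : G) (n : ℕ) : Ce g ≤ Ce (g ^ n) := by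
  intro h hh
  rw [mem_Ce_comm] at *
  exact (Ce h).pow_mem hh n
lemma Ce_eq_top {g : G} : Ce g = ⊤ ↔ g ∈ Subgroup.center G := by
  rw [Subgroup.mem_center_iff, Subgroup.eq_top_iff']
  exact forall_congr' fun x => mem_Ce
lemma center_le_Ce (g : G) : Subgroup.center G ≤ Ce g := by
  intro z hz
  rw [mem_Ce]; exact (Subgroup.mem_center_iff.1 hz g).symm
lemma Ce_mul_center (g z : G) (hz : z ∈ Subgroup.center G) : Ce (g * z) = Ce g := by
  ext x
  rw [mem_Ce, mem_Ce]
  have h := Subgroup.mem_center_iff.1 hz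
  rw [← mul_assoc, mul_assoc g z x, ← h x, ← mul_assoc]
  exact mul_left_inj z

lemma PE.pow {p : ℕ} {g : G} (h : PE p g) (n : ℕ) : PE p (g ^ n) := by
  obtain ⟨m, hm⟩ := h
  exact ⟨m, by rw [← pow_mul, mul_comm, pow_mul, hm, one_pow]⟩
lemma PE.inv {p : ℕ} {g : G} (h : PE p g) : PE p g⁻¹ := by
  obtain ⟨m, hm⟩ := h
  exact ⟨m, by rw [inv_pow, hm, inv_one]⟩
lemma PE.map {p : ℕ} {H : Type*} [Group H] {g : G} (h : PE p g) (f : G →* H) : PE p (f g) := by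
  obtain ⟨m, hm⟩ := h
  exact ⟨m, by rw [← map_pow, hm, map_one]⟩
lemma PE.conj {p : ℕ} {g : G} (h : PE p g) (c : G) : PE p (c * g * c⁻¹) :=
  h.map (MulAut.conj c).toMonoidHom
lemma PE.coe {p : ℕ} {H : Subgroup G} {g : H} : PE p (g : G) ↔ PE p g := by
  unfold PE
  simp only [← SubmonoidClass.coe_pow, OneMemClass.coe_eq_one]
lemma PE.one (p : ℕ) : PE p (1 : G) := ⟨0, by simp⟩
lemma PE.mul {p : ℕ} {g h : G} (hg : PE p g) (hh : PE p h) (hc : g * h = h * g) : PE p (g * h) := by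
  obtain ⟨m, hm⟩ := hg
  obtain ⟨n, hn⟩ := hh
  refine ⟨m + n, ?_⟩
  have hc : Commute g h := hc
  rw [hc.mul_pow, pow_add, pow_mul, hm, one_pow, mul_comm, pow_mul, hn, one_pow, one_mul]
lemma PE.ord {p : ℕ} (hp : p.Prime) {g : G} (h : PE p g) : ∃ n, orderOf g = p ^ n := by
  obtain ⟨m, hm⟩ := h
  obtain ⟨n, _, hn⟩ := (Nat.dvd_prime_pow hp).1 (orderOf_dvd_of_pow_eq_one hm)
  exact ⟨n, hn⟩
lemma PE.pp {p q : ℕ} (hp : p.Prime) (hq : q.Prime) (hpq : p ≠ q) {g : G} (h : PE p g) : PP q g := by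
  obtain ⟨n, hn⟩ := h.ord hp
  unfold PP; rw [hn]
  exact ((Nat.coprime_primes hp hq).2 hpq).pow_left n
lemma PE.eq_one {p : ℕ} (hp : p.Prime) {g : G} (h : PE p g) (h' : PP p g) : g = 1 := by
  obtain ⟨n, hn⟩ := h.ord hp
  unfold PP at h'
  rw [hn] at h'
  rcases Nat.eq_zero_or_pos n with rfl | h0
  · simpa using hn
  · rw [Nat.coprime_pow_left_iff h0, Nat.coprime_self] at h'
    exact absurd h' hp.one_lt.ne'
lemma PP.pow {p : ℕ} {g : G} (h : PP p g) (n : ℕ) : PP p (g ^ n) :=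
  Nat.Coprime.coprime_dvd_left (orderOf_pow_dvd n) h
lemma PP.conj {p : ℕ} {g : G} (h : PP p g) (c : G) : PP p (c * g * c⁻¹) := by
  unfold PP at *
  have := orderOf_injective (MulAut.conj c).toMonoidHom (MulAut.conj c).injective g
  rw [show (MulAut.conj c).toMonoidHom g = c * g * c⁻¹ from rfl] at this
  rwa [this]
lemma PP.coe {p : ℕ} {H : Subgroup G} {g : H} : PP p (g : G) ↔ PP p g := by
  unfold PP; rw [Subgroup.orderOf_coe]
lemma PP.mul {p : ℕ} {g h : G} (hg : PP p g) (hh : PP p h) (hc : g * h = h * g) : PP p (g * h) := by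
  have hc : Commute g h := hc
  have h1 : orderOf (g * h) ∣ orderOf g * orderOf h := hc.orderOf_mul_dvd_mul_orderOf
  exact Nat.Coprime.coprime_dvd_left h1 (Nat.Coprime.mul_left hg hh)
lemma PE.coprime {p : ℕ} (hp : p.Prime) {g h : G} (hg : PE p g) (hh : PP p h) :
    (orderOf g).Coprime (orderOf h) := by
  obtain ⟨n, hn⟩ := hg.ord hp
  rw [hn]; exact (Nat.Coprime.pow_right n hh).symm

lemma exists_pow_left {a b : G} (hc : a * b = b * a) (h : (orderOf a).Coprime (orderOf b)) :
    ∃ n, (a * b) ^ n = a := by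
  have hc : Commute a b := hc
  obtain ⟨n, hn1, hn2⟩ := Nat.chineseRemainder h 1 0
  refine ⟨n, ?_⟩
  rw [hc.mul_pow, pow_eq_pow_iff_modEq.2 hn1, pow_eq_pow_iff_modEq.2 hn2]; simp

lemma Ce_mul {a b : G} (hc : a * b = b * a) (h : (orderOf a).Coprime (orderOf b)) :
    Ce (a * b) = Ce a ⊓ Ce b := by
  apply le_antisymm
  · obtain ⟨n, hn⟩ := exists_pow_left hc h
    obtain ⟨m, hm⟩ := exists_pow_left hc.symm h.symm
    rw [← hc] at hm
    refine le_inf ?_ ?_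
    · conv_rhs => rw [← hn]
      exact Ce_pow _ _
    · conv_rhs => rw [← hm]
      exact Ce_pow _ _
  · rintro x ⟨h1, h2⟩
    replace h1 := mem_Ce_comm.1 h1
    replace h2 := mem_Ce_comm.1 h2
    rw [mem_Ce_comm]
    exact (Ce x).mul_mem h1 h2

lemma decomp [Finite G] {p : ℕ} (hp : p.Prime) (g : G) :
    ∃ i j : ℕ, PE p (g ^ i) ∧ PP p (g ^ j) ∧ g = g ^ i * g ^ j := by
  have h0 : orderOf g ≠ 0 := (orderOf_pos g).ne'
  have hcop : (p ^ (orderOf g).factorization p).Coprime (orderOf g / p ^ (orderOf g).factorization p) :=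
    (Nat.coprime_ordCompl hp h0).pow_left _
  obtain ⟨i, hi1, hi2⟩ := Nat.chineseRemainder hcop 1 0
  obtain ⟨j, hj1, hj2⟩ := Nat.chineseRemainder hcop 0 1
  have hmul := Nat.ordProj_mul_ordCompl_eq_self (orderOf g) p
  refine ⟨i, j, ⟨(orderOf g).factorization p, ?_⟩, ?_, ?_⟩
  · rw [← pow_mul, ← orderOf_dvd_iff_pow_eq_one]
    conv_lhs => rw [← hmul]
    rw [mul_comm]
    exact mul_dvd_mul ((Nat.modEq_zero_iff_dvd).1 hi2) dvd_rfl
  · have h1 : orderOf (g ^ j) ∣ orderOf g / p ^ (orderOf g).factorization p := by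
      rw [orderOf_dvd_iff_pow_eq_one, ← pow_mul, ← orderOf_dvd_iff_pow_eq_one]
      conv_lhs => rw [← hmul]
      exact mul_dvd_mul ((Nat.modEq_zero_iff_dvd).1 hj1) dvd_rfl
    exact Nat.Coprime.coprime_dvd_left h1 (Nat.coprime_ordCompl hp h0).symm
  · rw [← pow_add]
    conv_lhs => rw [← pow_one g]
    rw [pow_eq_pow_iff_modEq]
    have h1 : 1 ≡ i + j [MOD p ^ (orderOf g).factorization p] := (hi1.add hj1).symm
    have h2 : 1 ≡ i + j [MOD orderOf g / p ^ (orderOf g).factorization p] := (hi2.add hj2).symm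
    rw [← hmul]
    exact (Nat.modEq_and_modEq_iff_modEq_mul hcop).1 ⟨h1, h2⟩

lemma exists_primary [Finite G] (K : Subgroup G) (g : G) (hg : g ∉ K) :
    ∃ q : ℕ, q.Prime ∧ ∃ i : ℕ, PE q (g ^ i) ∧ g ^ i ∉ K := by
  induction h : orderOf g using Nat.strong_induction_on generalizing g with
  | _ n ih =>
    have hne : orderOf g ≠ 1 := by
      intro h1; rw [orderOf_eq_one_iff] at h1; rw [h1] at hg; exact hg K.one_mem
    obtain ⟨q, hq, hqd⟩ := Nat.exists_prime_and_dvd hne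
    obtain ⟨i, j, hi, hj, hij⟩ := decomp hq g
    by_cases h1 : g ^ i ∈ K
    · have h2 : g ^ j ∉ K := by
        intro h2; apply hg; rw [hij]; exact K.mul_mem h1 h2
      have hlt : orderOf (g ^ j) < n := by
        rw [← h]
        refine lt_of_le_of_ne (Nat.le_of_dvd (orderOf_pos g) (orderOf_pow_dvd j)) ?_
        intro he
        have hj' : (orderOf (g ^ j)).Coprime q := hj
        rw [he] at hj'
        have := Nat.dvd_gcd hqd dvd_rfl
        rw [hj'] at this
        exact hq.one_lt.ne' (Nat.dvd_one.1 this)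
      obtain ⟨q', hq', k, hk1, hk2⟩ := ih _ hlt (g ^ j) h2 rfl
      exact ⟨q', hq', j * k, by rw [pow_mul]; exact hk1, by rw [pow_mul]; exact hk2⟩
    · exact ⟨q, hq, i, hi, h1⟩

lemma exists_primary' [Finite G] {p : ℕ} (hp : p.Prime) (K : Subgroup G) (g : G) (hg : g ∉ K) (hgp : PP p g) :
    ∃ q : ℕ, q.Prime ∧ q ≠ p ∧ ∃ i : ℕ, PE q (g ^ i) ∧ g ^ i ∉ K := by
  obtain ⟨q, hq, i, hi, hi'⟩ := exists_primary K g hg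
  refine ⟨q, hq, ?_, i, hi, hi'⟩
  rintro rfl
  apply hi'
  rw [hi.eq_one hq (hgp.pow i)]
  exact K.one_mem

end basics

section fin
variable {G : Type*} [Group G] [Finite G]

lemma PE_of_mem_pgroup {p : ℕ} {P : Subgroup G} (hP : IsPGroup p P) {g : G} (hg : g ∈ P) : PE p g := by
  obtain ⟨k, hk⟩ := hP ⟨g, hg⟩
  exact ⟨k, by simpa using congrArg Subtype.val hk⟩

lemma PE.pgroup {p : ℕ} {g : G} (h : PE p g) : IsPGroup p (Subgroup.zpowers g) := by
  rintro ⟨x, k, rfl⟩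
  obtain ⟨n, hn⟩ := h
  refine ⟨n, ?_⟩
  ext
  simp only [SubmonoidClass.coe_pow, OneMemClass.coe_one]
  rw [← zpow_natCast, ← zpow_mul, mul_comm, zpow_mul, zpow_natCast, hn, one_zpow]

/-- Sylow subgroups of the whole group inside a subgroup of index prime to p. -/
lemma exists_sylow_le {p : ℕ} [hp : Fact p.Prime] (H Q : Subgroup G) (hQ : IsPGroup p Q) (hQH : Q ≤ H)
    (hH : ¬ p ∣ H.index) : ∃ P : Sylow p G, Q ≤ P ∧ (P : Subgroup G) ≤ H := by
  obtain ⟨P, hP⟩ := (hQ.comap_subtype (K := H)).exists_le_sylow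
  have hPG : IsPGroup p ((P : Subgroup H).map H.subtype) := P.2.map _
  have hidx : ¬ p ∣ ((P : Subgroup H).map H.subtype).index := by
    rw [Subgroup.index_map_subtype]
    intro h
    rcases (Nat.Prime.dvd_mul hp.out).1 h with h | h
    · exact P.not_dvd_index h
    · exact hH h
  refine ⟨hPG.toSylow hidx, ?_, ?_⟩
  · intro x hx
    exact ⟨⟨x, hQH hx⟩, hP (Subgroup.mem_subgroupOf.2 hx), rfl⟩
  · rintro x ⟨y, _, rfl⟩
    exact y.2

lemma PE_exists_sylow {p : ℕ} [hp : Fact p.Prime] {g : G} (h : PE p g) : ∃ P : Sylow p G, g ∈ (P : Subgroup G) := by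
  obtain ⟨P, hP⟩ := h.pgroup.exists_le_sylow
  exact ⟨P, hP (Subgroup.mem_zpowers g)⟩

lemma exists_PE_of_dvd {p : ℕ} (hp : p.Prime) (K H : Subgroup G) (h : p ∣ K.relIndex H) :
    ∃ g ∈ H, PE p g ∧ g ∉ K := by
  haveI := Fact.mk hp
  by_contra hcon
  push Not at hcon
  let P : Sylow p H := default
  apply P.not_dvd_index
  refine h.trans ?_
  apply Subgroup.index_dvd_of_le
  intro x hx
  rw [Subgroup.mem_subgroupOf]
  exact hcon x x.2 (PE.coe.2 (PE_of_mem_pgroup P.2 hx))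

lemma dvd_relIndex_of_PE {p : ℕ} (hp : p.Prime) (K H : Subgroup G) [hK : K.Normal] {g : G} (hgH : g ∈ H)
    (hg : PE p g) (hgK : g ∉ K) : p ∣ K.relIndex H := by
  obtain ⟨n, hn⟩ := hg
  let f : H →* H ⧸ (K.subgroupOf H) := QuotientGroup.mk' _
  have h1 : (f ⟨g, hgH⟩) ^ p ^ n = 1 := by
    rw [← map_pow]
    have : (⟨g, hgH⟩ : H) ^ p ^ n = 1 := by ext; simpa using hn
    rw [this, map_one]
  have h2 : f ⟨g, hgH⟩ ≠ 1 := by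
    intro h
    rw [QuotientGroup.mk'_apply, QuotientGroup.eq_one_iff, Subgroup.mem_subgroupOf] at h
    exact hgK h
  obtain ⟨k, _, hk⟩ := (Nat.dvd_prime_pow hp).1 (orderOf_dvd_of_pow_eq_one h1)
  have hk0 : k ≠ 0 := by
    rintro rfl
    rw [pow_zero, orderOf_eq_one_iff] at hk
    exact h2 hk
  have h3 : p ∣ orderOf (f ⟨g, hgH⟩) := by rw [hk]; exact dvd_pow_self p hk0
  exact h3.trans (orderOf_dvd_natCard _)

lemma Ce_conj (c g : G) : Ce (c * g * c⁻¹) = (Ce g).map (MulAut.conj c).toMonoidHom := by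
  ext x
  rw [Subgroup.mem_map_equiv, mem_Ce, mem_Ce]
  simp only [MulAut.conj_symm_apply]
  constructor
  · intro h
    have : c⁻¹ * (x * (c * g * c⁻¹)) * c = c⁻¹ * ((c * g * c⁻¹) * x) * c := by rw [h]
    simpa [mul_assoc] using this
  · intro h
    have : c * (c⁻¹ * x * c * g) * c⁻¹ = c * (g * (c⁻¹ * x * c)) * c⁻¹ := by rw [h]
    simpa [mul_assoc] using this

lemma index_conj (H : Subgroup G) (c : G) : (H.map (MulAut.conj c).toMonoidHom).index = H.index :=
  Subgroup.index_map_equiv H (MulAut.conj c)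

lemma index_Ce_conj (c g : G) : (Ce (c * g * c⁻¹)).index = (Ce g).index := by
  rw [Ce_conj, index_conj]

lemma mem_conj_map {H : Subgroup G} {c x : G} : x ∈ H.map (MulAut.conj c).toMonoidHom ↔ c⁻¹ * x * c ∈ H := by
  rw [Subgroup.mem_map_equiv]; simp

lemma conj_mem_center {c g : G} : c * g * c⁻¹ ∈ Subgroup.center G ↔ g ∈ Subgroup.center G := by
  constructor
  · intro h
    have := (inferInstance : (Subgroup.center G).Normal).conj_mem _ h c⁻¹
    simpa [mul_assoc] using this
  · intro h
    exact (inferInstance : (Subgroup.center G).Normal).conj_mem _ h c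

lemma Ce_subgroup (H : Subgroup G) (x : H) : Ce x = (Ce (x : G)).subgroupOf H := by
  ext y
  rw [mem_Ce, Subgroup.mem_subgroupOf, mem_Ce]
  constructor
  · intro h; simpa using congrArg Subtype.val h
  · intro h; ext; simpa using h

lemma eq_of_le_index {H K : Subgroup G} (h : H ≤ K) (hi : H.index ≤ K.index) : H = K := by
  have h1 := Subgroup.relIndex_mul_index h
  have h2 : 0 < K.index := Nat.pos_of_ne_zero K.index_ne_zero_of_finite
  have h3 : H.relIndex K = 1 := by
    have h4 : H.relIndex K ≠ 0 := by
      intro h0; rw [h0, zero_mul] at h1; exact H.index_ne_zero_of_finite h1.symm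
    by_contra h5
    have : 2 ≤ H.relIndex K := by omega
    nlinarith
  exact le_antisymm h (Subgroup.relIndex_eq_one.1 h3)

end fin
end CS

namespace CS
section cover
variable {G : Type*} [Group G] [Finite G]

abbrev Nr (H : Subgroup G) : Subgroup G := Subgroup.normalizer (H : Set G)

def Cov (A : Subgroup G) : Set G := {x | x ≠ 1 ∧ ∃ g, g * x * g⁻¹ ∈ A}

lemma card_Cov (A : Subgroup G) : (Cov A).ncard ≤ (Nr A).index * (Nat.card A - 1) := by
  classical
  let f : (G ⧸ Nr A) × G → G := fun y => y.1.out * y.2 * y.1.out⁻¹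
  have hsub : Cov A ⊆ f '' ((Set.univ : Set (G ⧸ Nr A)) ×ˢ ((A : Set G) \ {1})) := by
    rintro x ⟨hx1, g, hg⟩
    let c : G ⧸ Nr A := QuotientGroup.mk g⁻¹
    have hn : c.out⁻¹ * g⁻¹ ∈ Nr A := by
      rw [← QuotientGroup.eq]; exact QuotientGroup.out_eq' c
    refine ⟨(c, c.out⁻¹ * x * c.out), ⟨trivial, ?_, ?_⟩, ?_⟩
    · have := (Subgroup.mem_normalizer_iff.1 hn _).1 hg
      simpa [mul_assoc] using this
    · simp only [Set.mem_singleton_iff]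
      intro h
      apply hx1
      have : c.out * (c.out⁻¹ * x * c.out) * c.out⁻¹ = 1 := by rw [h]; simp
      simpa [mul_assoc] using this
    · simp [f, mul_assoc]
  refine (Set.ncard_le_ncard hsub (Set.toFinite _)).trans ((Set.ncard_image_le (Set.toFinite _)).trans ?_)
  rw [Set.ncard_prod, Set.ncard_univ, Set.ncard_diff_singleton_of_mem A.one_mem]
  exact le_of_eq rfl

lemma two_le_index {A : Subgroup G} (h : A ≠ ⊤) : 2 ≤ A.index := by
  have h0 := A.index_ne_zero_of_finite
  have h1 : A.index ≠ 1 := fun h1 => h (Subgroup.index_eq_one.1 h1)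
  omega

lemma cover_one {A : Subgroup G} (h : ∀ x, ∃ g, g * x * g⁻¹ ∈ A) : A = ⊤ := by
  by_contra hA
  have h1 := card_Cov A
  have h2 : Cov A = Set.univ \ {1} := by
    ext x; simp [Cov, h]
  rw [h2, Set.ncard_diff_singleton_of_mem (Set.mem_univ _), Set.ncard_univ] at h1
  have h3 : (Nr A).index ≤ A.index := Nat.le_of_dvd (Nat.pos_of_ne_zero A.index_ne_zero_of_finite) (Subgroup.index_dvd_of_le Subgroup.le_normalizer)
  have h4 := A.card_mul_index
  have h5 := two_le_index hA
  have h6 : 0 < Nat.card A := Nat.card_pos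
  have h7 : (Nr A).index * (Nat.card A - 1) ≤ A.index * (Nat.card A - 1) := Nat.mul_le_mul_right _ h3
  obtain ⟨a, ha⟩ : ∃ a, Nat.card A = a + 1 := ⟨Nat.card A - 1, by omega⟩
  rw [ha] at h4 h7
  simp only [Nat.add_sub_cancel] at h7
  have : A.index * a + A.index = Nat.card G := by rw [← h4]; ring
  rw [ha] at h1
  simp only [Nat.add_sub_cancel] at h1
  omega

lemma cov_half {A : Subgroup G} (hN : Nr A ≠ A) : 2 * ((Cov A).ncard + 1) ≤ Nat.card G := by
  have h1 := card_Cov A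
  have h3 := Subgroup.relIndex_mul_index (Subgroup.le_normalizer (H := A))
  have h4 := A.card_mul_index
  have h6 : 0 < Nat.card A := Nat.card_pos
  have h7 : 2 ≤ A.relIndex (Nr A) := by
    have h8 : A.relIndex (Nr A) ≠ 1 := by
      intro h; exact hN (le_antisymm (Subgroup.relIndex_eq_one.1 h) Subgroup.le_normalizer)
    have h9 : A.relIndex (Nr A) ≠ 0 := by
      intro h; rw [h, zero_mul] at h3; exact A.index_ne_zero_of_finite h3.symm
    omega
  have h8 : 0 < (Nr A).index := Nat.pos_of_ne_zero (Nr A).index_ne_zero_of_finite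
  obtain ⟨a, ha⟩ : ∃ a, Nat.card A = a + 1 := ⟨Nat.card A - 1, by omega⟩
  rw [ha] at h1 h4
  simp only [Nat.add_sub_cancel] at h1
  have h10 : 2 * (Nr A).index ≤ A.index := by rw [← h3]; exact Nat.mul_le_mul_right _ h7
  have h11 : (a + 1) * (2 * (Nr A).index) ≤ Nat.card G := by rw [← h4]; exact Nat.mul_le_mul_left _ h10
  nlinarith

lemma cover_two {A B : Subgroup G} (h : ∀ x, (∃ g, g * x * g⁻¹ ∈ A) ∨ (∃ g, g * x * g⁻¹ ∈ B)) :
    Nr A = A ∨ Nr B = B := by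
  by_contra hcon
  push Not at hcon
  have h1 := cov_half hcon.1
  have h2 := cov_half hcon.2
  have h3 : Cov A ∪ Cov B = Set.univ \ {1} := by
    ext x
    simp only [Cov, Set.mem_union, Set.mem_ofPred_eq, Set.mem_diff, Set.mem_univ, true_and, Set.mem_singleton_iff]
    have := h x
    tauto
  have h4 := Set.ncard_union_le (Cov A) (Cov B)
  rw [h3, Set.ncard_diff_singleton_of_mem (Set.mem_univ _), Set.ncard_univ] at h4
  omega

lemma sylow_conj {p : ℕ} [Fact p.Prime] (P Q : Sylow p G) : ∃ g : G, ∀ x, x ∈ (Q : Subgroup G) ↔ g * x * g⁻¹ ∈ (P : Subgroup G) := by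
  obtain ⟨g, hg⟩ := MulAction.exists_smul_eq G P Q
  refine ⟨g⁻¹, fun x => ?_⟩
  rw [← hg, Sylow.coe_subgroup_smul, Subgroup.mem_pointwise_smul_iff_inv_smul_mem]
  rw [← map_inv, MulAut.smul_def, MulAut.conj_apply]

/-- If u divides no class size, u-elements are central. -/
lemma central_of_not_dvd {u : ℕ} (hu : u.Prime) (h : ∀ x : G, ¬ u ∣ (Ce x).index) (x : G) (hx : PE u x) :
    x ∈ Subgroup.center G := by
  haveI := Fact.mk hu
  let U : Sylow u G := default
  have h1 : Subgroup.centralizer ((U : Subgroup G) : Set G) = ⊤ := by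
    apply cover_one
    intro y
    obtain ⟨P, -, hP⟩ := exists_sylow_le (p := u) (Ce y) ⊥ IsPGroup.of_bot bot_le (h y)
    obtain ⟨g, hg⟩ := sylow_conj P U
    refine ⟨g⁻¹, ?_⟩
    rw [Subgroup.mem_centralizer_iff]
    intro z hz
    have := mem_Ce.1 (hP ((hg z).1 hz))
    have h2 : g⁻¹ * (g * z * g⁻¹ * y) * g = g⁻¹ * (y * (g * z * g⁻¹)) * g := by rw [this]
    simpa [mul_assoc] using h2
  obtain ⟨P, hP⟩ := PE_exists_sylow hx
  obtain ⟨g, hg⟩ := sylow_conj U P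
  have h2 := (hg x).1 hP
  rw [← conj_mem_center (c := g), Subgroup.mem_center_iff]
  intro y
  have : y ∈ Subgroup.centralizer ((U : Subgroup G) : Set G) := by rw [h1]; trivial
  exact (Subgroup.mem_centralizer_iff.1 this _ h2).symm

/-- If all u'-elements have class size prime to u then u'-elements commute with u-elements. -/
lemma commute_of_pp {u : ℕ} (hu : u.Prime) (h : ∀ x : G, PP u x → ¬ u ∣ (Ce x).index) (x y : G) (hx : PP u x)
    (hy : PE u y) : x * y = y * x := by
  haveI := Fact.mk hu
  let U : Sylow u G := default
  have hnorm : Subgroup.centralizer ((U : Subgroup G) : Set G) ≤ Nr (U : Subgroup G) := Subgroup.centralizer_le_normalizer _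
  have h1 : (U : Subgroup G) ⊔ Subgroup.centralizer ((U : Subgroup G) : Set G) = ⊤ := by
    apply cover_one
    intro z
    obtain ⟨i, j, hi, hj, hij⟩ := decomp hu z
    have hcm : z ^ i ∈ Ce (z ^ j) := mem_Ce.2 (by rw [← pow_add, ← pow_add, add_comm])
    obtain ⟨P, hP1, hP⟩ := exists_sylow_le (p := u) (Ce (z ^ j)) _ hi.pgroup (by rwa [Subgroup.zpowers_le]) (h _ hj)
    obtain ⟨g, hg⟩ := sylow_conj P U
    refine ⟨g⁻¹, ?_⟩
    have : g⁻¹ * z * g⁻¹⁻¹ = (g⁻¹ * z ^ i * g) * (g⁻¹ * z ^ j * g) := by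
      conv_lhs => rw [hij]
      group
    rw [this]
    refine Subgroup.mul_mem_sup ?_ ?_
    · rw [hg]
      have := hP1 (Subgroup.mem_zpowers (z ^ i))
      simpa [mul_assoc] using this
    · rw [Subgroup.mem_centralizer_iff]
      intro w hw
      have := mem_Ce.1 (hP ((hg w).1 hw))
      have h2 : g⁻¹ * (g * w * g⁻¹ * z ^ j) * g = g⁻¹ * (z ^ j * (g * w * g⁻¹)) * g := by rw [this]
      simpa [mul_assoc] using h2
  have hUn : (U : Subgroup G).Normal := by
    rw [← Subgroup.normalizer_eq_top_iff, eq_top_iff, ← h1]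
    exact sup_le Subgroup.le_normalizer hnorm
  have hyU : y ∈ (U : Subgroup G) := by
    obtain ⟨P, hP⟩ := PE_exists_sylow hy
    obtain ⟨g, hg⟩ := sylow_conj U P
    have h2 := (hg y).1 hP
    have := hUn.conj_mem _ h2 g⁻¹
    simpa [mul_assoc] using this
  -- x centralizes U
  have hxC : x ∈ Subgroup.centralizer ((U : Subgroup G) : Set G) := by
    have hCn : (Subgroup.centralizer ((U : Subgroup G) : Set G)).Normal := inferInstance
    let f := QuotientGroup.mk' (Subgroup.centralizer ((U : Subgroup G) : Set G))
    have hx1 : PE u (f x) := by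
      have : x ∈ (U : Subgroup G) ⊔ Subgroup.centralizer ((U : Subgroup G) : Set G) := by rw [h1]; trivial
      obtain ⟨a, ha, c, hc, hac⟩ := Subgroup.mem_sup_of_normal_right.1 this
      have hfc : f c = 1 := (QuotientGroup.eq_one_iff c).2 hc
      rw [← hac, map_mul, hfc, mul_one]
      exact (PE_of_mem_pgroup U.2 ha).map f
    have hx2 : PP u (f x) := Nat.Coprime.coprime_dvd_left (orderOf_map_dvd f x) hx
    exact (QuotientGroup.eq_one_iff x).1 (hx1.eq_one hu hx2)
  exact (Subgroup.mem_centralizer_iff.1 hxC y hyU).symm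
end cover
end CS

namespace CS
section bc

def BCprop (p r : ℕ) (X : Type*) [Group X] : Prop :=
  ∀ x : X, PE r x → ∃ Q : Subgroup X, (∀ a ∈ Q, ∀ b ∈ Q, a * b = b * a) ∧ Q ≤ Ce x ∧
    (∀ t : ℕ, t.Prime → t ∣ Q.index → t = p ∨ t = r) ∧ (∀ t : ℕ, t.Prime → t ∣ (Nr Q).index → t = p)

lemma relIndex_dvd_index_right {X : Type*} [Group X] [Finite X] (A N : Subgroup X) [N.Normal] :
    A.relIndex N ∣ A.index := by
  have h1 : N.relIndex (A ⊔ N) = N.relIndex A := Subgroup.relIndex_sup_right A N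
  have h2 := Subgroup.relIndex_inf_mul_relIndex A N ⊤
  have hA : (A ⊓ N).relIndex A * A.index = (A ⊓ N).index := by
    exact Subgroup.relIndex_mul_index inf_le_left
  have hN : (A ⊓ N).relIndex N * N.index = (A ⊓ N).index := by
    exact Subgroup.relIndex_mul_index inf_le_right
  rw [Subgroup.inf_relIndex_left] at hA
  rw [Subgroup.inf_relIndex_right] at hN
  have h3 := Subgroup.relIndex_mul_index (le_sup_right : N ≤ A ⊔ N)
  rw [h1] at h3
  have h0 : N.relIndex A ≠ 0 := by
    intro h; rw [h, zero_mul] at h3; exact N.index_ne_zero_of_finite h3.symm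
  refine ⟨(A ⊔ N).index, ?_⟩
  apply Nat.eq_of_mul_eq_mul_left (Nat.pos_of_ne_zero h0)
  rw [hA, ← hN, ← h3]; ring

lemma BCprop_normal {p r : ℕ} {X : Type*} [Group X] [Finite X] (h : BCprop p r X) (N : Subgroup X) [N.Normal] :
    BCprop p r N := by
  intro x hx
  obtain ⟨Q, h1, h2, h3, h4⟩ := h x (PE.coe.2 hx)
  refine ⟨Q.subgroupOf N, ?_, ?_, ?_, ?_⟩
  · intro a ha b hb
    ext
    exact h1 _ ha _ hb
  · rw [Ce_subgroup]
    exact Subgroup.comap_mono h2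
  · intro t ht hd
    exact h3 t ht (hd.trans (relIndex_dvd_index_right Q N))
  · intro t ht hd
    apply h4 t ht
    refine hd.trans (dvd_trans ?_ (relIndex_dvd_index_right (Nr Q) N))
    apply Subgroup.index_dvd_of_le
    intro y hy
    rw [Subgroup.mem_subgroupOf] at hy
    rw [Subgroup.mem_normalizer_iff] at *
    intro n
    exact hy n

lemma BCprop_quot {p r : ℕ} (hr : r.Prime) {X : Type*} [Group X] [Finite X] (h : BCprop p r X) (N : Subgroup X) [N.Normal] :
    BCprop p r (X ⧸ N) := by
  intro xb hxb
  let f := QuotientGroup.mk' N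
  have hf : Function.Surjective f := QuotientGroup.mk'_surjective N
  obtain ⟨x0, hx0⟩ := hf xb
  obtain ⟨i, j, hi, hj, hij⟩ := decomp hr x0
  have hx : f (x0 ^ i) = xb := by
    have h1 : f (x0 ^ j) = 1 := by
      apply PE.eq_one hr
      · rw [map_pow, hx0]; exact hxb.pow j
      · exact Nat.Coprime.coprime_dvd_left (orderOf_map_dvd f _) hj
    rw [← hx0]
    conv_rhs => rw [hij, map_mul, h1, mul_one]
  obtain ⟨Q, h1, h2, h3, h4⟩ := h _ hi
  refine ⟨Q.map f, ?_, ?_, ?_, ?_⟩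
  · rintro _ ⟨a, ha, rfl⟩ _ ⟨b, hb, rfl⟩
    rw [← map_mul, h1 a ha b hb, map_mul]
  · rintro _ ⟨a, ha, rfl⟩
    rw [← hx, mem_Ce, ← map_mul, mem_Ce.1 (h2 ha), map_mul]
  · intro t ht hd
    exact h3 t ht (hd.trans (Subgroup.index_map_dvd Q hf))
  · intro t ht hd
    apply h4 t ht
    refine hd.trans (dvd_trans ?_ (Subgroup.index_map_dvd (Nr Q) hf))
    apply Subgroup.index_dvd_of_le
    exact Subgroup.le_normalizer_map f

lemma pgroup_normal_center {p : ℕ} [Fact p.Prime] {R : Type*} [Group R] [Finite R] (hR : IsPGroup p R)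
    (M : Subgroup R) [M.Normal] (hM : M ≠ ⊥) : ∃ y ∈ M, y ∈ Subgroup.center R ∧ y ≠ 1 := by
  have hC : IsPGroup p (ConjAct R) := hR
  have hMp : IsPGroup p M := hR.to_subgroup M
  have hd : p ∣ Nat.card M := by
    obtain ⟨n, hn⟩ := IsPGroup.iff_card.1 hMp
    rw [hn]
    refine dvd_pow_self p ?_
    rintro rfl
    exact hM (Subgroup.card_eq_one.1 (by rw [hn, pow_zero]))
  obtain ⟨b, hb, hne⟩ := hC.exists_fixed_point_of_prime_dvd_card_of_fixed_point M hd (a := 1) (by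
    intro g; ext; simp [ConjAct.Subgroup.val_conj_smul])
  refine ⟨b, b.2, ?_, ?_⟩
  · rw [Subgroup.mem_center_iff]
    intro g
    have := congrArg Subtype.val (hb (ConjAct.toConjAct g))
    rw [ConjAct.Subgroup.val_conj_smul, ConjAct.toConjAct_smul] at this
    conv_rhs => rw [← this]
    group
  · intro h; apply hne; ext; exact h.symm

lemma BC_simple {p r : ℕ} (hp : p.Prime) (hr : r.Prime) {X : Type*} [Group X] [Finite X] [IsSimpleGroup X]
    (h : BCprop p r X) : ∀ a b : X, a * b = b * a := by
  by_contra hna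
  haveI := Fact.mk hr
  have key : ∀ y : X, y ≠ 1 → ¬ (∀ t : ℕ, t.Prime → t ∣ (Ce y).index → t = p) := by
    intro y hy hcon
    have := Nat.eq_prime_pow_of_unique_prime_dvd (Ce y).index_ne_zero_of_finite (fun {d} h1 h2 => hcon d h1 h2)
    exact burnside_simple X hna hp y hy this
  by_cases hex : ∃ x : X, x ≠ 1 ∧ PE r x
  · obtain ⟨x, hx1, hx⟩ := hex
    obtain ⟨Q, h1, h2, h3, h4⟩ := h x hx
    have hQC : Subgroup.centralizer (Q : Set X) ≤ Nr Q := Subgroup.centralizer_le_normalizer _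
    have hxQ : x ∈ Subgroup.centralizer (Q : Set X) := by
      rw [Subgroup.mem_centralizer_iff]; intro y hy; exact mem_Ce.1 (h2 hy)
    obtain ⟨R, hR⟩ := PE_exists_sylow (G := Nr Q) (p := r) (g := ⟨x, hQC hxQ⟩) (PE.coe.1 hx)
    -- normal subgroup of R
    let M : Subgroup (R : Subgroup (Nr Q)) := ((Subgroup.centralizer (Q : Set X)).subgroupOf (Nr Q)).subgroupOf R
    have hQn : ((Subgroup.centralizer (Q : Set X)).subgroupOf (Nr Q)).Normal := by
      constructor
      intro n hn g
      rw [Subgroup.mem_subgroupOf, Subgroup.mem_centralizer_iff] at *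
      intro y hy
      have hy' : (g : X)⁻¹ * y * g ∈ Q := by
        have := (Subgroup.mem_normalizer_iff.1 (g⁻¹).2 y).1 hy
        simpa using this
      have := hn _ hy'
      have h5 : (g : X) * ((g : X)⁻¹ * y * g * n) * (g : X)⁻¹ = g * (n * ((g : X)⁻¹ * y * g)) * (g : X)⁻¹ := by
        rw [this]
      simpa [mul_assoc] using h5
    have hMn : M.Normal := inferInstance
    have hM1 : M ≠ ⊥ := by
      intro hM
      have : (⟨⟨x, hQC hxQ⟩, hR⟩ : (R : Subgroup (Nr Q))) ∈ M := hxQ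
      rw [hM, Subgroup.mem_bot] at this
      apply hx1
      have := congrArg (fun z : (R : Subgroup (Nr Q)) => ((z : Nr Q) : X)) this
      simpa using this
    have hMZ : ∃ y ∈ M, y ∈ Subgroup.center (R : Subgroup (Nr Q)) ∧ y ≠ 1 :=
      pgroup_normal_center R.2 M hM1
    obtain ⟨y, hyM, hyZ, hy1⟩ := hMZ
    apply key (y : Nr Q).1
    · intro h; apply hy1; ext; simpa using h
    · intro t ht hd
      have hQy : Q ≤ Ce ((y : Nr Q) : X) := by
        intro q hq
        have : ((y : Nr Q) : X) ∈ Subgroup.centralizer (Q : Set X) := hyM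
        exact mem_Ce.2 (Subgroup.mem_centralizer_iff.1 this q hq)
      rcases h3 t ht (hd.trans (Subgroup.index_dvd_of_le hQy)) with h | h
      · exact h
      · subst h
        have hRy : (R : Subgroup (Nr Q)).map (Nr Q).subtype ≤ Ce ((y : Nr Q) : X) := by
          rintro _ ⟨z, hz, rfl⟩
          have := Subgroup.mem_center_iff.1 hyZ ⟨z, hz⟩
          have := congrArg (fun z : (R : Subgroup (Nr Q)) => ((z : Nr Q) : X)) this
          exact mem_Ce.2 this
        have hd2 := hd.trans (Subgroup.index_dvd_of_le hRy)
        rw [Subgroup.index_map_subtype] at hd2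
        rcases (Nat.Prime.dvd_mul ht).1 hd2 with h | h
        · exact absurd h R.not_dvd_index
        · exact h4 t ht h
  · push Not at hex
    obtain ⟨Q, h1, h2, h3, h4⟩ := h 1 (PE.one r)
    have hrX : ¬ r ∣ Nat.card X := by
      intro hd
      obtain ⟨x, hx⟩ := exists_prime_orderOf_dvd_card' r hd
      refine hex x ?_ ⟨1, ?_⟩
      · rintro rfl; simp at hx; exact hr.one_lt.ne hx
      · rw [pow_one, ← hx, pow_orderOf_eq_one]
    have h5 : ∀ t : ℕ, t.Prime → t ∣ Q.index → t = p := by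
      intro t ht hd
      rcases h3 t ht hd with h | h
      · exact h
      · subst h; exact absurd (hd.trans Q.index_dvd_card) hrX
    by_cases hQ : Q = ⊥
    · subst hQ
      obtain ⟨y, hy⟩ := exists_ne (1 : X)
      exact key y hy (fun t ht hd => h5 t ht (hd.trans (Subgroup.index_dvd_of_le bot_le)))
    · obtain ⟨⟨y, hyQ⟩, hy⟩ := Subgroup.ne_bot_iff_exists_ne_one.1 hQ
      replace hy : y ≠ 1 := fun h => hy (by ext; exact h)
      refine key y hy (fun t ht hd => h5 t ht (hd.trans (Subgroup.index_dvd_of_le ?_)))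
      intro q hq
      exact mem_Ce.2 (h1 q hq y hyQ)

theorem BC {p r : ℕ} (hp : p.Prime) (hr : r.Prime) (X : Type*) [Group X] [Finite X] (h : BCprop p r X) :
    Group.IsSolvable X := by
  induction hn : Nat.card X using Nat.strong_induction_on generalizing X with
  | _ n ih =>
    by_cases hs : ∃ N : Subgroup X, N.Normal ∧ N ≠ ⊥ ∧ N ≠ ⊤
    · obtain ⟨N, hN, hb, ht⟩ := hs
      have c1 := N.card_mul_index
      have c2 := two_le_index ht
      have c3 : 2 ≤ Nat.card N := by
        have : Nat.card N ≠ 1 := fun h => hb (Subgroup.card_eq_one.1 h)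
        have : 0 < Nat.card N := Nat.card_pos
        omega
      have s1 : Group.IsSolvable N := ih (Nat.card N) (by rw [← hn, ← c1]; nlinarith) N (BCprop_normal h N) rfl
      have s2 : Group.IsSolvable (X ⧸ N) := ih N.index (by rw [← hn, ← c1]; nlinarith) (X ⧸ N) (BCprop_quot hr h N) rfl
      exact Group.isSolvable_of_ker_le_range N.subtype (QuotientGroup.mk' N) (by simp)
    · push Not at hs
      by_cases hne : Nontrivial X
      · have : IsSimpleGroup X := ⟨fun N hN => by
          by_cases h0 : N = ⊥
          · exact Or.inl h0
          · exact Or.inr (hs N hN h0)⟩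
        exact Group.isSolvable_of_comm (BC_simple hp hr h)
      · rw [not_nontrivial_iff_subsingleton] at hne
        exact Group.isSolvable_of_comm (fun a b => Subsingleton.elim _ _)
end bc
end CS

namespace CS
section lemS
variable {D K : Type*} [CommGroup D] [Finite D] [Group K] [Finite K] [MulDistribMulAction K D]

lemma PE.smul {t : ℕ} {d : D} (h : PE t d) (k : K) : PE t (k • d) :=
  h.map (MulDistribMulAction.toMonoidHom D k)

lemma PE.prod {t : ℕ} {ι : Type*} (s : Finset ι) (f : ι → D) (h : ∀ i ∈ s, PE t (f i)) : PE t (∏ i ∈ s, f i) :=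
  Finset.prod_induction f (PE t) (fun a b ha hb => ha.mul hb (mul_comm _ _)) (PE.one t) h

lemma smul_eq_of_pow {s : ℕ} (hs : s.Prime) {n : ℕ} (hn : n.Coprime s) {d : D} (hd : PE s d) (k : K)
    (h : k • (d ^ n) = d ^ n) : k • d = d := by
  have h1 : PE s (k • d * d⁻¹) := (hd.smul k).mul hd.inv (mul_comm _ _)
  have h2 : (k • d * d⁻¹) ^ n = 1 := by
    rw [mul_pow, ← smul_pow', h, inv_pow, mul_inv_cancel]
  have h3 : PP s (k • d * d⁻¹) := Nat.Coprime.coprime_dvd_left (orderOf_dvd_of_pow_eq_one h2) hn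
  exact mul_inv_eq_one.1 (h1.eq_one hs h3)

lemma lemKL {t : ℕ} (ht : t.Prime) (P : Subgroup K) (w : D) (hw : PE t w)
    (h1 : ∀ k : K, k • w = w → k = 1) (h2 : ∀ τ ∈ P, ∀ k : K, k • (τ • w * w⁻¹) = τ • w * w⁻¹)
    (h3 : ∀ d : D, PE t d → (∀ τ ∈ P, τ • d = d) → ∀ k : K, k • d = d)
    (L : Subgroup K) (hL : ¬ t ∣ Nat.card L) (hPL : ∀ τ ∈ P, ∀ l ∈ L, τ * l * τ⁻¹ ∈ L) : L = ⊥ := by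
  classical
  haveI := Fintype.ofFinite L
  set n := Nat.card L with hn
  have hcop : n.Coprime t := ((Nat.Prime.coprime_iff_not_dvd ht).2 hL).symm
  let A : D := ∏ l : L, (l : K) • w
  have hA : ∀ l ∈ L, l • A = A := by
    intro l hl
    simp only [A, Finset.smul_prod', smul_smul]
    exact Fintype.prod_equiv (Equiv.mulLeft (⟨l, hl⟩ : L)) _ _ (fun x => rfl)
  let e : D := A * (w ^ n)⁻¹
  have hAe : PE t A := PE.prod _ _ (fun l _ => hw.smul _)
  have heP : PE t e := hAe.mul (hw.pow n).inv (mul_comm _ _)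
  have heF : ∀ k : K, k • e = e := by
    apply h3 e heP
    intro τ hτ
    obtain ⟨c, hc⟩ : ∃ c, c = τ • w * w⁻¹ := ⟨_, rfl⟩
    have hcw : τ • w = c * w := by rw [hc]; group
    have hcF : ∀ k : K, k • c = c := by rw [hc]; exact h2 τ hτ
    have hτA : τ • A = c ^ n * A := by
      have h5 : τ • A = ∏ l : L, (c * ((τ * (l : K) * τ⁻¹) • w)) := by
        simp only [A, Finset.smul_prod', smul_smul]
        refine Finset.prod_congr rfl fun l _ => ?_
        have h6 : τ * (l : K) = (τ * l * τ⁻¹) * τ := by group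
        calc (τ * (l : K)) • w = ((τ * l * τ⁻¹) * τ) • w := by rw [← h6]
          _ = _ := by rw [← smul_smul, hcw, smul_mul', hcF]
      rw [h5, Finset.prod_mul_distrib, Finset.prod_const, Finset.card_univ, ← Nat.card_eq_fintype_card, ← hn]
      congr 1
      let f : L → L := fun l => ⟨τ * l * τ⁻¹, hPL τ hτ l l.2⟩
      have hf : Function.Injective f := by
        intro a b hab
        have := congrArg Subtype.val hab
        simp only [f, mul_left_inj, mul_right_inj] at this
        exact Subtype.ext this
      exact Fintype.prod_equiv (Equiv.ofBijective f (Finite.injective_iff_bijective.1 hf)) _ _ (fun x => rfl)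
    simp only [e]
    rw [smul_mul', hτA, smul_inv', smul_pow', hcw, mul_pow]
    rw [mul_inv, mul_mul_mul_comm, mul_inv_cancel, one_mul]
  rw [eq_bot_iff]
  intro l hl
  rw [Subgroup.mem_bot]
  apply h1
  apply smul_eq_of_pow ht hcop hw
  have h5 := heF l
  simp only [e] at h5
  rw [smul_mul', hA l hl, smul_inv'] at h5
  exact inv_injective (mul_left_cancel h5)

theorem lemS {t : ℕ} (ht : t.Prime) [Fact t.Prime] (P : Sylow t K) (w : D) (hw : PE t w)
    (h1 : ∀ k : K, k • w = w → k = 1)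
    (h2 : ∀ τ ∈ (P : Subgroup K), ∀ k : K, k • (τ • w * w⁻¹) = τ • w * w⁻¹)
    (h3 : ∀ d : D, PE t d → (∀ τ ∈ (P : Subgroup K), τ • d = d) → ∀ k : K, k • d = d)
    (h4 : ∀ h : K, ∀ v : ℕ, v.Prime → v ≠ t → orderOf h = v → ∃ s : ℕ, s.Prime ∧ s ≠ t ∧
      (∃ m : D, PE s m ∧ ¬ ∀ k : K, k • m = m) ∧ (∀ m : D, PE s m → h • m = m → ∀ k : K, k • m = m) ∧
      (∀ τ ∈ (P : Subgroup K), τ ≠ 1 → ∀ m : D, PE s m → τ • m = m → ∀ k : K, k • m = m)) :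
    IsPGroup t K := by
  classical
  have hab : ∀ σ ∈ (P : Subgroup K), ∀ τ ∈ (P : Subgroup K), σ * τ = τ * σ := by
    intro σ hσ τ hτ
    obtain ⟨c, hc⟩ : ∃ c, c = τ • w * w⁻¹ := ⟨_, rfl⟩
    have hcw : τ • w = c * w := by rw [hc]; group
    have hcF : ∀ k : K, k • c = c := by rw [hc]; exact h2 τ hτ
    obtain ⟨d, hd⟩ : ∃ c, c = σ • w * w⁻¹ := ⟨_, rfl⟩
    have hdw : σ • w = d * w := by rw [hd]; group
    have hdF : ∀ k : K, k • d = d := by rw [hd]; exact h2 σ hσ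
    have h5 : (σ * τ) • w = (τ * σ) • w := by
      rw [← smul_smul, ← smul_smul, hcw, hdw, smul_mul', smul_mul', hcF, hdF, hcw, hdw, mul_left_comm]
    have h6 := h1 ((τ * σ)⁻¹ * (σ * τ)) (by rw [← smul_smul, h5, smul_smul]; simp)
    exact (inv_mul_eq_one.1 h6).symm
  have KL := lemKL ht (P : Subgroup K) w hw h1 h2 h3
  have hN : ∀ v : ℕ, v.Prime → v ≠ t → ¬ v ∣ Nat.card (Nr (P : Subgroup K)) := by
    intro v hv hvt hd
    haveI := Fact.mk hv
    obtain ⟨⟨h, hhN⟩, hord⟩ := exists_prime_orderOf_dvd_card' v hd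
    rw [← Subgroup.orderOf_coe] at hord
    simp only at hord
    have hnP := Subgroup.mem_normalizer_iff.1 hhN
    have hhv : h ^ v = 1 := by rw [← hord, pow_orderOf_eq_one]
    by_cases hc : ∀ x ∈ (P : Subgroup K), h * x = x * h
    · have := KL (Subgroup.zpowers h) (by
        rw [Nat.card_zpowers, hord]
        intro hd; exact hvt ((Nat.prime_dvd_prime_iff_eq ht hv).1 hd).symm) (by
        rintro τ hτ _ ⟨k, rfl⟩
        have hcm : Commute τ h := (hc τ hτ).symm
        have : τ * h ^ k * τ⁻¹ = h ^ k := by rw [(hcm.zpow_right k).eq]; group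
        simp only [this]
        exact ⟨k, rfl⟩)
      rw [Subgroup.zpowers_eq_bot] at this
      rw [this, orderOf_one] at hord
      exact hv.one_lt.ne hord
    · obtain ⟨s, hs, hst, ⟨m, hm, hmF⟩, hfix1, hfix2⟩ := h4 h v hv hvt hord
      apply hmF
      let B : Subgroup K :=
        { carrier := {b | ∃ x ∈ (P : Subgroup K), b = x⁻¹ * (h * x * h⁻¹)}
          one_mem' := ⟨1, one_mem _, by simp⟩
          mul_mem' := by
            rintro _ _ ⟨x, hx, rfl⟩ ⟨y, hy, rfl⟩
            refine ⟨x * y, mul_mem hx hy, ?_⟩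
            have e1 := hab _ ((hnP x).1 hx) _ (inv_mem hy)
            have e2 := hab _ (inv_mem hx) _ (inv_mem hy)
            rw [mul_inv_rev, ← e2]
            calc x⁻¹ * (h * x * h⁻¹) * (y⁻¹ * (h * y * h⁻¹)) = x⁻¹ * ((h * x * h⁻¹) * y⁻¹) * (h * y * h⁻¹) := by group
              _ = x⁻¹ * y⁻¹ * (h * (x * y) * h⁻¹) := by rw [e1]; group
          inv_mem' := by
            rintro _ ⟨x, hx, rfl⟩
            refine ⟨x⁻¹, inv_mem hx, ?_⟩
            have e1 := hab _ ((hnP _).1 (inv_mem hx)) _ hx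
            calc (x⁻¹ * (h * x * h⁻¹))⁻¹ = (h * x⁻¹ * h⁻¹) * x := by group
              _ = x⁻¹⁻¹ * (h * x⁻¹ * h⁻¹) := by rw [e1, inv_inv] }
      have hBP : B ≤ P := by
        rintro _ ⟨x, hx, rfl⟩
        exact mul_mem (inv_mem hx) ((hnP x).1 hx)
      have hBh : ∀ b ∈ B, h * b * h⁻¹ ∈ B := by
        rintro _ ⟨x, hx, rfl⟩
        exact ⟨h * x * h⁻¹, (hnP x).1 hx, by group⟩
      have hBhi : ∀ i : ℕ, ∀ b ∈ B, h ^ i * b * (h ^ i)⁻¹ ∈ B := by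
        intro i
        induction i with
        | zero => intro b hb; simpa using hb
        | succ i ih =>
          intro b hb
          have := hBh _ (ih b hb)
          have e : h * (h ^ i * b * (h ^ i)⁻¹) * h⁻¹ = h ^ (i + 1) * b * (h ^ (i + 1))⁻¹ := by
            rw [pow_succ']; group
          rwa [e] at this
      have hCB : ∀ b ∈ B, h * b = b * h → b = 1 := by
        rintro b ⟨x, hx, hbx⟩ hcb
        have hbP : b ∈ (P : Subgroup K) := hBP ⟨x, hx, hbx⟩
        have e1 : h * x * h⁻¹ = x * b := by rw [hbx]; group
        have e2 : ∀ i : ℕ, h ^ i * x * (h ^ i)⁻¹ = x * b ^ i := by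
          intro i
          induction i with
          | zero => simp
          | succ i ih =>
            have e3 : h ^ (i + 1) * x * (h ^ (i + 1))⁻¹ = h * (h ^ i * x * (h ^ i)⁻¹) * h⁻¹ := by
              rw [pow_succ']; group
            have hcm : Commute h (b ^ i) := Commute.pow_right hcb i
            rw [e3, ih]
            calc h * (x * b ^ i) * h⁻¹ = (h * x * h⁻¹) * (h * b ^ i * h⁻¹) := by group
              _ = x * b ^ (i + 1) := by rw [e1, hcm.eq, mul_inv_cancel_right, pow_succ']; group
        have e4 := e2 v
        rw [hhv] at e4
        have e5 : b ^ v = 1 := by simpa using e4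
        have hbt : PE t b := PE_of_mem_pgroup P.2 hbP
        refine hbt.eq_one ht (Nat.Coprime.coprime_dvd_left (orderOf_dvd_of_pow_eq_one e5) ((Nat.coprime_primes hv ht).2 hvt))
      have hCBi : ∀ i : ℕ, i < v → i ≠ 0 → ∀ b ∈ B, h ^ i * b = b * h ^ i → b = 1 := by
        intro i hi hi0 b hb hcb
        apply hCB b hb
        have hcop : i.Coprime v := ((Nat.Prime.coprime_iff_not_dvd hv).2 (Nat.not_dvd_of_pos_of_lt (Nat.pos_of_ne_zero hi0) hi)).symm
        obtain ⟨k, hk⟩ := exists_pow_eq_self_of_coprime (x := h) (n := i) (by rw [hord]; exact hcop)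
        have hcm : Commute (h ^ i) b := hcb
        have := hcm.pow_left k
        rwa [hk] at this
      haveI := Fintype.ofFinite B
      have hBne : ∃ b ∈ B, b ≠ 1 := by
        push Not at hc
        obtain ⟨x, hx, hxh⟩ := hc
        refine ⟨x⁻¹ * (h * x * h⁻¹), ⟨x, hx, rfl⟩, ?_⟩
        intro e
        apply hxh
        have : h * x * h⁻¹ = x := (inv_mul_eq_one.1 e).symm
        rw [mul_inv_eq_iff_eq_mul] at this
        exact this
      obtain ⟨b0, hb0, hb01⟩ := hBne
      -- double product
      have hpm : ∀ k : K, PE s (k • m) := fun k => hm.smul k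
      have hrow : ∀ x : B, ∀ k : K, k • (∏ i ∈ Finset.range v, ((x : K)⁻¹ * h ^ i * x) • m) = ∏ i ∈ Finset.range v, ((x : K)⁻¹ * h ^ i * x) • m := by
        intro x
        let q : D := ∏ i ∈ Finset.range v, h ^ i • ((x : K) • m)
        have hq1 : (∏ i ∈ Finset.range v, ((x : K)⁻¹ * h ^ i * x) • m) = (x : K)⁻¹ • q := by
          simp only [q, Finset.smul_prod', smul_smul, mul_assoc]
        have hqF : ∀ k : K, k • q = q := by
          apply hfix1 q (PE.prod _ _ fun i _ => (hpm x).smul _)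
          simp only [q, Finset.smul_prod', smul_smul h, ← pow_succ']
          have e1 := Finset.prod_range_succ (fun i => h ^ i • ((x : K) • m)) v
          have e2 := Finset.prod_range_succ' (fun i => h ^ i • ((x : K) • m)) v
          rw [hhv] at e1
          rw [pow_zero] at e2
          exact mul_right_cancel (e2.symm.trans e1)
        rw [hq1, hqF]; exact hqF
      have hcol : ∀ i : ℕ, i < v → i ≠ 0 → ∀ k : K, k • (∏ x : B, ((x : K)⁻¹ * h ^ i * x) • m) = ∏ x : B, ((x : K)⁻¹ * h ^ i * x) • m := by
        intro i hi hi0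
        let β : B → B := fun x => ⟨(x : K)⁻¹ * (h ^ i * x * (h ^ i)⁻¹), mul_mem (inv_mem x.2) (hBhi i x x.2)⟩
        have hβ : Function.Injective β := by
          intro x y hxy
          have hxy := congrArg Subtype.val hxy
          simp only [β] at hxy
          have hz : (x : K) * (y : K)⁻¹ ∈ B := mul_mem x.2 (inv_mem y.2)
          have e1 : (h ^ i * x * (h ^ i)⁻¹) = x * (y : K)⁻¹ * (h ^ i * y * (h ^ i)⁻¹) := by
            rw [mul_assoc (x : K) (y : K)⁻¹, ← hxy]; group
          have e2 : h ^ i * (x * (y : K)⁻¹) = (x * (y : K)⁻¹) * h ^ i := by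
            calc h ^ i * (x * (y : K)⁻¹) = (h ^ i * x * (h ^ i)⁻¹) * (h ^ i * y * (h ^ i)⁻¹)⁻¹ * h ^ i := by group
              _ = _ := by rw [e1]; group
          exact Subtype.ext (mul_inv_eq_one.1 (hCBi i hi hi0 _ hz e2))
        have e1 : (∏ x : B, ((x : K)⁻¹ * h ^ i * x) • m) = ∏ x : B, (x : K) • (h ^ i • m) := by
          refine Fintype.prod_equiv (Equiv.ofBijective β (Finite.injective_iff_bijective.1 hβ)) _ _ (fun x => ?_)
          simp only [Equiv.ofBijective_apply, β, smul_smul]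
          congr 1; group
        rw [e1]
        apply hfix2 b0 (hBP hb0) hb01 _ (PE.prod _ _ fun x _ => (hpm _).smul _)
        simp only [Finset.smul_prod', smul_smul]
        exact Fintype.prod_equiv (Equiv.mulLeft (⟨b0, hb0⟩ : B)) _ _ (fun x => by simp [mul_assoc])
      have hmB : ∀ k : K, k • (m ^ Nat.card B) = m ^ Nat.card B := by
        intro k
        have e1 : (∏ x : B, ∏ i ∈ Finset.range v, ((x : K)⁻¹ * h ^ i * x) • m) = (∏ i ∈ Finset.range (v - 1), ∏ x : B, ((x : K)⁻¹ * h ^ (i + 1) * x) • m) * m ^ Nat.card B := by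
          rw [Finset.prod_comm]
          have : v = (v - 1) + 1 := by have := hv.pos; omega
          conv_lhs => rw [this]
          rw [Finset.prod_range_succ']
          congr 1
          simp [Nat.card_eq_fintype_card]
        have e2 : k • (∏ x : B, ∏ i ∈ Finset.range v, ((x : K)⁻¹ * h ^ i * x) • m) = ∏ x : B, ∏ i ∈ Finset.range v, ((x : K)⁻¹ * h ^ i * x) • m := by
          rw [Finset.smul_prod']
          exact Finset.prod_congr rfl fun x _ => hrow x k
        have e3 : k • (∏ i ∈ Finset.range (v - 1), ∏ x : B, ((x : K)⁻¹ * h ^ (i + 1) * x) • m) = ∏ i ∈ Finset.range (v - 1), ∏ x : B, ((x : K)⁻¹ * h ^ (i + 1) * x) • m := by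
          rw [Finset.smul_prod']
          refine Finset.prod_congr rfl fun i hi => hcol (i + 1) ?_ (by omega) k
          have := Finset.mem_range.1 hi; omega
        rw [e1, smul_mul', e3] at e2
        exact mul_left_cancel e2
      intro k
      refine smul_eq_of_pow hs ?_ hm k (hmB k)
      obtain ⟨j, hj⟩ := IsPGroup.iff_card.1 (P.2.to_le hBP)
      rw [hj]
      exact ((Nat.coprime_primes ht hs).2 (Ne.symm hst)).pow_left j
  have hNP : Nr (P : Subgroup K) ≤ P := by
    have : IsPGroup t (Nr (P : Subgroup K)) := by
      rw [IsPGroup.iff_card]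
      refine ⟨_, Nat.eq_prime_pow_of_unique_prime_dvd Nat.card_pos.ne' (fun {d} hd1 hd2 => ?_)⟩
      by_contra hne
      exact hN d hd1 hne hd2
    exact (P.3 this Subgroup.le_normalizer).le
  have hPC : Subgroup.normalizer (P : Set K) ≤ Subgroup.centralizer (P : Set K) := by
    intro x hx
    have hx := hNP hx
    rw [Subgroup.mem_centralizer_iff]
    intro y hy
    exact hab y hy x hx
  have hker := KL (MonoidHom.transferSylow P hPC).ker (MonoidHom.not_dvd_card_ker_transferSylow P hPC)
    (fun τ _ l hl => (inferInstance : (MonoidHom.transferSylow P hPC).ker.Normal).conj_mem l hl τ)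
  have hcomp := MonoidHom.ker_transferSylow_isComplement' P hPC
  rw [hker, Subgroup.isComplement'_bot_left] at hcomp
  have : IsPGroup t (⊤ : Subgroup K) := hcomp ▸ P.2
  exact this.of_equiv Subgroup.topEquiv
end lemS
end CS

namespace CS
section SG
variable {G : Type*} [Group G] [Finite G]

lemma conj_mem_Ce {c h g : G} : c * h * c⁻¹ ∈ Ce (c * g * c⁻¹) ↔ h ∈ Ce g := by
  rw [Ce_conj, mem_conj_map]; simp [mul_assoc]

lemma mem_Nr_Ce {x w : G} (h : Ce (x * w * x⁻¹) = Ce w) : x ∈ Nr (Ce w) := by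
  rw [Subgroup.mem_normalizer_iff]
  intro y
  conv_rhs => rw [← h]
  exact conj_mem_Ce.symm

lemma centralizer_Ce_le (w : G) : Subgroup.centralizer ((Ce w : Subgroup G) : Set G) ≤ Ce w := by
  intro x hx
  rw [mem_Ce]
  exact (Subgroup.mem_centralizer_iff.1 hx w (self_mem_Ce w)).symm

/-- all elements of the center of a Sylow t-subgroup are central in G -/
def SylZ (t : ℕ) (G : Type*) [Group G] : Prop :=
  ∀ T : Sylow t G, ∀ x ∈ (T : Subgroup G), (∀ y ∈ (T : Subgroup G), x * y = y * x) → x ∈ Subgroup.center G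

def Wt (t : ℕ) (w : G) : Prop :=
  ∃ T : Sylow t G, w ∈ (T : Subgroup G) ∧ ∀ y ∈ (T : Subgroup G), y * w * y⁻¹ * w⁻¹ ∈ Subgroup.center G

lemma Wt.pe {t : ℕ} {w : G} (h : Wt t w) : PE t w := by
  obtain ⟨T, hT, -⟩ := h
  exact PE_of_mem_pgroup T.2 hT

lemma mem_Nr_of_comm {y w : G} (h : y * w * y⁻¹ * w⁻¹ ∈ Subgroup.center G) : y ∈ Nr (Ce w) := by
  apply mem_Nr_Ce
  have : y * w * y⁻¹ = w * (y * w * y⁻¹ * w⁻¹) := by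
    rw [Subgroup.mem_center_iff.1 h w]; group
  rw [this, Ce_mul_center _ _ h]

lemma mem_sylow_of_comm {t : ℕ} {T : Sylow t G} {d : G} (hd : PE t d) (h : ∀ y ∈ (T : Subgroup G), d * y = y * d) :
    d ∈ (T : Subgroup G) := by
  have h1 : IsPGroup t ((T : Subgroup G) ⊔ Subgroup.zpowers d : Subgroup G) := by
    apply T.2.to_sup_of_normal_left' hd.pgroup
    rw [Subgroup.zpowers_le, Subgroup.mem_normalizer_iff]
    intro y
    constructor
    · intro hy; rw [h y hy]; simpa using hy
    · intro hy
      have e := h _ hy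
      have : y = d * y * d⁻¹ := by
        have e2 : d⁻¹ * (d * (d * y * d⁻¹)) * d = d⁻¹ * (d * y * d⁻¹ * d) * d := by rw [e]
        have e3 : d⁻¹ * (d * (d * y * d⁻¹)) * d = d * y := by group
        have e4 : d⁻¹ * (d * y * d⁻¹ * d) * d = y * d := by group
        rw [e3, e4] at e2
        rw [e2]; group
      rw [this]; exact hy
  have := T.3 h1 le_sup_left
  rw [← this]
  exact Subgroup.mem_sup_right (Subgroup.mem_zpowers d)


theorem SG {t : ℕ} (ht : t.Prime) (hZ : SylZ t G) {w : G} (hw : Wt t w)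
    (h4 : ∀ v : ℕ, v.Prime → v ≠ t → v ∣ (Ce w).relIndex (Nr (Ce w)) → ∃ s : ℕ, s.Prime ∧ s ≠ t ∧
      (∃ m ∈ Subgroup.centralizer ((Ce w : Subgroup G) : Set G), PE s m ∧ m ∉ Subgroup.center G) ∧
      (∀ m ∈ Subgroup.centralizer ((Ce w : Subgroup G) : Set G), PE s m → m ∉ Subgroup.center G →
        ¬ v ∣ (Ce w).relIndex (Nr (Ce w) ⊓ Ce m) ∧ ¬ t ∣ (Ce w).relIndex (Nr (Ce w) ⊓ Ce m))) :
    ∃ j, (Ce w).relIndex (Nr (Ce w)) = t ^ j := by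
  classical
  haveI := Fact.mk ht
  obtain ⟨T, hwT, hT⟩ := hw
  have hwP : PE t w := PE_of_mem_pgroup T.2 hwT
  set E := Ce w with hE
  set D := Subgroup.centralizer (E : Set G) with hD
  have hDE : D ≤ E := centralizer_Ce_le w
  have hwD : w ∈ D := by
    rw [hD, Subgroup.mem_centralizer_iff]; intro y hy; exact mem_Ce.1 hy
  letI : CommGroup D := { (inferInstance : Group D) with
    mul_comm := fun a b => by
      ext
      exact (Subgroup.mem_centralizer_iff.1 a.2 b (hDE b.2)).symm }
  have hND : Nr E ≤ Nr D := by
    intro x hx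
    rw [Subgroup.mem_normalizer_iff] at *
    intro d
    rw [hD, Subgroup.mem_centralizer_iff, Subgroup.mem_centralizer_iff]
    constructor
    · intro h y hy
      have hy' : x⁻¹ * y * x ∈ E := (hx _).2 (by simpa [mul_assoc] using hy)
      have := congrArg (fun z => x * z * x⁻¹) (h _ hy')
      simpa [mul_assoc] using this
    · intro h y hy
      have := congrArg (fun z => x⁻¹ * z * x) (h _ ((hx y).1 hy))
      simpa [mul_assoc] using this
  let φ : Nr E →* MulAut D := (D.normalizerMonoidHom).comp (Subgroup.inclusion hND)
  have hφ : ∀ (n : Nr E) (d : D), ((φ n d : D) : G) = n * d * (n : G)⁻¹ := by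
    intro n d
    exact Subgroup.normalizerMonoidHom_apply_apply_coe D _ d
  have hφ1 : ∀ n : Nr E, (n : G) ∈ E → φ n = 1 := by
    intro n hn
    ext d
    rw [hφ, MulAut.one_apply, Subgroup.mem_centralizer_iff.1 d.2 _ hn, mul_inv_cancel_right]
  have hfix : ∀ (n : Nr E) (d : D), φ n d = d ↔ (n : G) ∈ Ce (d : G) := by
    intro n d
    rw [mem_Ce, Subtype.ext_iff, hφ, mul_inv_eq_iff_eq_mul]
  have hker : φ.ker = E.subgroupOf (Nr E) := by
    ext n
    rw [MonoidHom.mem_ker, Subgroup.mem_subgroupOf]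
    refine ⟨fun h => ?_, hφ1 n⟩
    have := (hfix n ⟨w, hwD⟩).1 (by rw [h]; rfl)
    exact this
  have hcardK : Nat.card φ.range = E.relIndex (Nr E) := by
    rw [← Subgroup.index_ker, hker]; rfl
  let ψ : Nr E →* φ.range := φ.rangeRestrict
  have hψ : Function.Surjective ψ := φ.rangeRestrict_surjective
  have hsm : ∀ (n : Nr E) (d : D), ψ n • d = φ n d := fun _ _ => rfl
  have hTN : (T : Subgroup G) ≤ Nr E := fun y hy => mem_Nr_of_comm (hT y hy)
  let T' : Sylow t (Nr E) := T.subtype hTN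
  let P : Sylow t φ.range := T'.mapSurjective hψ
  have hPmem : ∀ τ : φ.range, τ ∈ (P : Subgroup φ.range) ↔ ∃ y : Nr E, (y : G) ∈ (T : Subgroup G) ∧ ψ y = τ := by
    intro τ
    exact Iff.rfl
  have hcen : ∀ d : D, (d : G) ∈ Subgroup.center G → ∀ k : φ.range, k • d = d := by
    intro d hd k
    obtain ⟨n, rfl⟩ := hψ k
    rw [hsm, hfix]
    have : Ce (d : G) = ⊤ := Ce_eq_top.2 hd
    rw [this]; trivial
  have hst : ∀ (k : φ.range) (d : D), k • d = d → orderOf k ∣ E.relIndex (Nr E ⊓ Ce (d : G)) := by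
    intro k d hkd
    have e1 : E.relIndex (Nr E ⊓ Ce (d : G)) = Nat.card (((Nr E ⊓ Ce (d : G)).subgroupOf (Nr E)).map φ) := by
      rw [← Subgroup.relIndex_ker, hker, Subgroup.relIndex_subgroupOf inf_le_left]
    rw [e1, ← Subgroup.orderOf_coe]
    obtain ⟨n, rfl⟩ := hψ k
    apply Subgroup.orderOf_dvd_natCard
    refine ⟨n, ?_, rfl⟩
    refine ⟨n.2, ?_⟩
    exact (hfix n d).1 hkd
  have hlift : ∀ v : ℕ, v.Prime → ∀ d : D, (∃ k : φ.range, v ∣ orderOf k ∧ k • d = d) → ¬ (v ∣ E.relIndex (Nr E ⊓ Ce (d : G))) → False := by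
    rintro v hv d ⟨k, hk, hkd⟩ h
    exact h (hk.trans (hst k d hkd))
  have key : IsPGroup t φ.range := by
    refine lemS (D := D) ht P (⟨w, hwD⟩ : D) (PE.coe.1 hwP) ?_ ?_ ?_ ?_
    · intro k hk
      obtain ⟨n, rfl⟩ := hψ k
      have := hφ1 n ((hfix n _).1 hk)
      exact Subtype.ext this
    · intro τ hτ
      obtain ⟨y, hy, rfl⟩ := (hPmem τ).1 hτ
      apply hcen
      have := hT y hy
      convert this using 1
      simp [hsm, hφ]
    · intro d hd hdP
      apply hcen
      have hc : ∀ y ∈ (T : Subgroup G), (d : G) * y = y * d := by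
        intro y hy
        have := hdP (ψ ⟨y, hTN hy⟩) ((hPmem _).2 ⟨_, hy, rfl⟩)
        exact (mem_Ce.1 ((hfix _ d).1 this)).symm
      exact hZ T d (mem_sylow_of_comm (PE.coe.2 hd) hc) hc
    · intro h v hv hvt hord
      obtain ⟨s, hs, hst', ⟨m, hmD, hm, hmZ⟩, hall⟩ := h4 v hv hvt (by
        rw [← hcardK, ← hord]; exact orderOf_dvd_natCard h)
      refine ⟨s, hs, hst', ⟨⟨m, hmD⟩, PE.coe.1 hm, ?_⟩, ?_, ?_⟩
      · intro hf
        exact hlift v hv ⟨m, hmD⟩ ⟨h, hord ▸ dvd_rfl, hf h⟩ (hall m hmD hm hmZ).1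
      · intro d hd hhd
        by_cases hdZ : (d : G) ∈ Subgroup.center G
        · exact hcen d hdZ
        · exact (hlift v hv d ⟨h, hord ▸ dvd_rfl, hhd⟩ (hall d d.2 (PE.coe.2 hd) hdZ).1).elim
      · intro τ hτ hτ1 d hd hhd
        by_cases hdZ : (d : G) ∈ Subgroup.center G
        · exact hcen d hdZ
        · have hτP : PE t τ := PE_of_mem_pgroup P.2 hτ
          obtain ⟨n, hn⟩ := hτP.ord ht
          have hn0 : n ≠ 0 := by
            rintro rfl
            rw [pow_zero, orderOf_eq_one_iff] at hn
            exact hτ1 hn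
          exact (hlift t ht d ⟨τ, hn ▸ dvd_pow_self t hn0, hhd⟩ (hall d d.2 (PE.coe.2 hd) hdZ).2).elim
  rw [← hcardK]
  exact IsPGroup.iff_card.1 key

lemma mem_of_relIndex_pow {t s : ℕ} (ht : t.Prime) (hs : s.Prime) (hst : s ≠ t) {E : Subgroup G} {j : ℕ}
    (h : E.relIndex (Nr E) = t ^ j) {x : G} (hx : PE s x) (hxN : x ∈ Nr E) : x ∈ E := by
  by_contra hxE
  have h1 : s ∣ (E.subgroupOf (Nr E)).relIndex ⊤ := by
    have : (E.subgroupOf (Nr E)).Normal := Subgroup.normal_in_normalizer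
    exact dvd_relIndex_of_PE hs (E.subgroupOf (Nr E)) ⊤ (g := ⟨x, hxN⟩) trivial (PE.coe.1 hx) (by
      rw [Subgroup.mem_subgroupOf]; exact hxE)
  rw [Subgroup.relIndex_top_right] at h1
  have h2 : s ∣ t ^ j := h ▸ h1
  exact hst ((Nat.prime_dvd_prime_iff_eq hs ht).1 (hs.dvd_of_dvd_pow h2))

lemma exists_normalizing {s : ℕ} [Fact s.Prime] (S : Sylow s G) (E : Subgroup G) (h : ¬ (S : Subgroup G) ≤ E) :
    ∃ x ∈ (S : Subgroup G), x ∉ E ∧ ∀ y ∈ (S : Subgroup G), y ∈ E → x * y * x⁻¹ ∈ E := by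
  haveI : Group.IsNilpotent (S : Subgroup G) := S.2.isNilpotent
  have h1 : E.subgroupOf (S : Subgroup G) < ⊤ := by
    rw [lt_top_iff_ne_top, Ne, Subgroup.subgroupOf_eq_top]; exact h
  have h2 := Group.normalizerCondition_of_isNilpotent (G := (S : Subgroup G)) _ h1
  obtain ⟨x, hx, hxE⟩ := SetLike.exists_of_lt h2
  refine ⟨x, x.2, fun h => hxE (Subgroup.mem_subgroupOf.2 h), fun y hy hyE => ?_⟩
  have := (Subgroup.mem_normalizer_iff.1 hx ⟨y, hy⟩).1 (Subgroup.mem_subgroupOf.2 hyE)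
  exact this

theorem AT {t s : ℕ} (ht : t.Prime) (hs : s.Prime) (hst : s ≠ t) (hZ : SylZ t G) {w : G} (hw : Wt t w)
    (hex : ∃ a ∈ Ce w, PE s a ∧ a ∉ Subgroup.center G)
    (hall : ∀ a ∈ Ce w, PE s a → a ∉ Subgroup.center G → Ce a = Ce w) :
    (∃ j, (Ce w).relIndex (Nr (Ce w)) = t ^ j) ∧ ∃ S : Sylow s G, (S : Subgroup G) ≤ Ce w := by
  haveI := Fact.mk hs
  obtain ⟨a, haE, ha, haZ⟩ := hex
  have h1 : ∃ j, (Ce w).relIndex (Nr (Ce w)) = t ^ j := by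
    apply SG ht hZ hw
    intro v hv hvt _
    refine ⟨s, hs, hst, ⟨a, ?_, ha, haZ⟩, ?_⟩
    · rw [Subgroup.mem_centralizer_iff, ← hall a haE ha haZ]
      intro y hy; exact mem_Ce.1 hy
    · intro m hm hms hmZ
      rw [hall m (centralizer_Ce_le w hm) hms hmZ, inf_eq_right.2 Subgroup.le_normalizer, Subgroup.relIndex_self]
      exact ⟨hv.one_lt.ne' ∘ Nat.dvd_one.1, ht.one_lt.ne' ∘ Nat.dvd_one.1⟩
  refine ⟨h1, ?_⟩
  obtain ⟨j, hj⟩ := h1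
  obtain ⟨S, haS⟩ := PE_exists_sylow ha
  refine ⟨S, ?_⟩
  by_contra hSE
  obtain ⟨x, hxS, hxE, hx⟩ := exists_normalizing S _ hSE
  have e1 := hall _ (hx a haS haE) (ha.conj x) (by rwa [conj_mem_center])
  have e2 := hall a haE ha haZ
  have hxN : x ∈ Nr (Ce w) := by
    rw [← e2]; apply mem_Nr_Ce; rw [e1, e2]
  exact hxE (mem_of_relIndex_pow ht hs hst hj (PE_of_mem_pgroup S.2 hxS) hxN)

theorem AT' {t s : ℕ} (ht : t.Prime) (hs : s.Prime) (hst : s ≠ t) (hZ : SylZ t G) {w : G} (hw : Wt t w)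
    (hex : ∃ a ∈ Ce w, PE s a ∧ a ∉ Subgroup.center G)
    (hall : ∀ a ∈ Ce w, PE s a → a ∉ Subgroup.center G → Ce a = Ce w) (hZs : SylZ s G) : False := by
  obtain ⟨-, S, hS⟩ := AT ht hs hst hZ hw hex hall
  obtain ⟨a, haE, ha, haZ⟩ := hex
  have e := hall a haE ha haZ
  have hc : ∀ y ∈ (S : Subgroup G), a * y = y * a := fun y hy => (mem_Ce.1 (e ▸ hS hy : y ∈ Ce a)).symm
  exact haZ (hZs S a (mem_sylow_of_comm ha hc) hc)

lemma exists_Wt {t : ℕ} (ht : t.Prime) {x : G} (hx : PE t x) (hxZ : x ∉ Subgroup.center G) :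
    ∃ w : G, w ∉ Subgroup.center G ∧ Wt t w := by
  haveI := Fact.mk ht
  obtain ⟨T, hT⟩ := PE_exists_sylow hx
  let Z0 := (Subgroup.center G).subgroupOf (T : Subgroup G)
  have hp : IsPGroup t ((T : Subgroup G) ⧸ Z0) := T.2.to_quotient Z0
  haveI : Nontrivial ((T : Subgroup G) ⧸ Z0) := by
    rw [QuotientGroup.nontrivial_iff]
    intro h
    rw [Subgroup.subgroupOf_eq_top] at h
    exact hxZ (h hT)
  haveI := hp.center_nontrivial
  obtain ⟨⟨c, hc⟩, hc1⟩ := exists_ne (1 : Subgroup.center ((T : Subgroup G) ⧸ Z0))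
  obtain ⟨w, rfl⟩ := QuotientGroup.mk_surjective c
  refine ⟨w, ?_, T, w.2, ?_⟩
  · intro h
    apply hc1
    ext
    exact (QuotientGroup.eq_one_iff w).2 (Subgroup.mem_subgroupOf.2 h)
  · intro y hy
    have := Subgroup.mem_center_iff.1 hc (QuotientGroup.mk ⟨y, hy⟩)
    have h2 : (QuotientGroup.mk ((⟨y, hy⟩ : (T : Subgroup G)) * w * (⟨y, hy⟩ : (T : Subgroup G))⁻¹ * w⁻¹) : (T : Subgroup G) ⧸ Z0) = 1 := by
      simp only [QuotientGroup.mk_mul, QuotientGroup.mk_inv]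
      rw [this]; group
    exact Subgroup.mem_subgroupOf.1 ((QuotientGroup.eq_one_iff _).1 h2)

/-- If Z(T) is not central there is a noncentral w centralised by T. -/
lemma exists_of_not_SylZ {t : ℕ} (h : ¬ SylZ t G) :
    ∃ T : Sylow t G, ∃ w ∈ (T : Subgroup G), w ∉ Subgroup.center G ∧ (T : Subgroup G) ≤ Ce w := by
  unfold SylZ at h
  push Not at h
  obtain ⟨T, x, hx, hc, hxZ⟩ := h
  exact ⟨T, x, hx, hxZ, fun y hy => mem_Ce.2 (hc y hy).symm⟩
end SG
end CS

namespace CS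
section thmL
variable {G : Type*} [Group G] [Finite G]

lemma Ce_conj_inj {g a b : G} (h : Ce (g * a * g⁻¹) = Ce (g * b * g⁻¹)) : Ce a = Ce b := by
  ext x
  rw [← conj_mem_Ce (c := g) (g := a), h, conj_mem_Ce]

lemma Ce_conj_congr {g a b : G} (h : Ce a = Ce b) : Ce (g * a * g⁻¹) = Ce (g * b * g⁻¹) := by
  rw [Ce_conj, Ce_conj, h]

lemma Nr_map_conj (E : Subgroup G) (g : G) : Nr (E.map (MulAut.conj g).toMonoidHom) = (Nr E).map (MulAut.conj g).toMonoidHom :=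
  (Subgroup.map_equiv_normalizer_eq E (MulAut.conj g)).symm

lemma relIndex_Nr_conj (g w : G) : (Ce (g * w * g⁻¹)).relIndex (Nr (Ce (g * w * g⁻¹))) = (Ce w).relIndex (Nr (Ce w)) := by
  rw [Ce_conj, Nr_map_conj]
  exact Subgroup.relIndex_map_map_of_injective _ _ (MulAut.conj g).injective

lemma Wt.conj {t : ℕ} {w : G} (h : Wt t w) (g : G) : Wt t (g * w * g⁻¹) := by
  obtain ⟨T, hw, hT⟩ := h
  have hmem : ∀ x, x ∈ ((g • T : Sylow t G) : Subgroup G) ↔ g⁻¹ * x * g ∈ (T : Subgroup G) := by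
    intro x
    rw [Sylow.coe_subgroup_smul, Subgroup.mem_pointwise_smul_iff_inv_smul_mem, ← map_inv, MulAut.smul_def, MulAut.conj_apply, inv_inv]
  refine ⟨g • T, ?_, ?_⟩
  · rw [hmem]; simpa [mul_assoc] using hw
  · intro y hy
    have := hT _ ((hmem y).1 hy)
    rw [← conj_mem_center (c := g)] at this
    convert this using 1
    group

lemma index_ne_zero' (H : Subgroup G) : H.index ≠ 0 := H.index_ne_zero_of_finite

lemma dvd_center_index_of_dvd {v : ℕ} {x : G} (h : v ∣ (Ce x).index) : v ∣ (Subgroup.center G).index :=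
  h.trans (Subgroup.index_dvd_of_le (center_le_Ce x))

lemma exists_PE_of_dvd_index {v : ℕ} (hv : v.Prime) (h : v ∣ (Subgroup.center G).index) : ∃ x : G, PE v x ∧ x ∉ Subgroup.center G := by
  obtain ⟨x, -, h1, h2⟩ := exists_PE_of_dvd hv (Subgroup.center G) ⊤ (by rwa [Subgroup.relIndex_top_right])
  exact ⟨x, h1, h2⟩

lemma dvd_index_of_PE {v : ℕ} (hv : v.Prime) {x : G} (hx : PE v x) (hxZ : x ∉ Subgroup.center G) : v ∣ (Subgroup.center G).index := by
  rw [← Subgroup.relIndex_top_right]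
  exact dvd_relIndex_of_PE hv _ ⊤ trivial hx hxZ

lemma mul_not_center_left {a b : G} (hc : a * b = b * a) (h : (orderOf a).Coprime (orderOf b)) (ha : a ∉ Subgroup.center G) :
    a * b ∉ Subgroup.center G := by
  intro hab
  obtain ⟨n, hn⟩ := exists_pow_left hc h
  exact ha (hn ▸ Subgroup.pow_mem _ hab n)

lemma mul_not_center_right {a b : G} (hc : a * b = b * a) (h : (orderOf a).Coprime (orderOf b)) (hb : b ∉ Subgroup.center G) :
    a * b ∉ Subgroup.center G := by
  rw [hc]; exact mul_not_center_left hc.symm h.symm hb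

/-- `a`, `b` commuting of coprime orders, if index of `ab` is at most index of `a` then `C(ab) = C(a) ≤ C(b)`. -/
lemma Ce_le_of_index {a b : G} (hc : a * b = b * a) (h : (orderOf a).Coprime (orderOf b))
    (hi : (Ce (a * b)).index ≤ (Ce a).index) : Ce a ≤ Ce b := by
  have h1 := Ce_mul hc h
  have h2 : Ce (a * b) = Ce a := eq_of_le_index (h1 ▸ inf_le_left) hi
  rw [h1] at h2
  exact inf_eq_left.1 h2

lemma Ce_eq_of_index {a b : G} (hc : a * b = b * a) (h : (orderOf a).Coprime (orderOf b))
    (hi : (Ce (a * b)).index ≤ (Ce a).index) (hi2 : (Ce (a * b)).index ≤ (Ce b).index) : Ce a = Ce b :=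
  le_antisymm (Ce_le_of_index hc h hi) (Ce_le_of_index hc.symm h.symm (by rwa [hc] at hi2))

lemma not_dvd_of_sylow_le {s : ℕ} [Fact s.Prime] {S : Sylow s G} {E : Subgroup G} (h : (S : Subgroup G) ≤ E) : ¬ s ∣ E.index :=
  fun h2 => S.not_dvd_index (h2.trans (Subgroup.index_dvd_of_le h))

/-- All p'-elements have class size 1 or k. -/
def LH (p k : ℕ) (G : Type*) [Group G] : Prop := ∀ x : G, PP p x → x ∉ Subgroup.center G → (Ce x).index = k

/-- noncentral p'-element of prime power order -/
def NP (p : ℕ) (x : G) : Prop := x ∉ Subgroup.center G ∧ ∃ q : ℕ, q.Prime ∧ q ≠ p ∧ PE q x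

lemma NP.conj {p : ℕ} {x : G} (h : NP p x) (g : G) : NP p (g * x * g⁻¹) := by
  obtain ⟨h1, q, hq, hqp, h2⟩ := h
  exact ⟨by rwa [conj_mem_center], q, hq, hqp, h2.conj g⟩

lemma LH.eq {p k : ℕ} (hp : p.Prime) (h : LH p k G) {q s : ℕ} (hq : q.Prime) (hs : s.Prime) (hqp : q ≠ p) (hsp : s ≠ p)
    (hqs : q ≠ s) {a b : G} (ha : PE q a) (hb : PE s b) (haZ : a ∉ Subgroup.center G) (hbZ : b ∉ Subgroup.center G)
    (hc : a * b = b * a) : Ce a = Ce b := by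
  have hcop := ha.coprime hq (hb.pp hs hq hqs.symm)
  have happ := ha.pp hq hp hqp
  have hbpp := hb.pp hs hp hsp
  have h1 := h _ (happ.mul hbpp hc) (mul_not_center_left hc hcop haZ)
  exact Ce_eq_of_index hc hcop (by rw [h1, h _ happ haZ]) (by rw [h1, h _ hbpp hbZ])

theorem L_struct {p k : ℕ} (hp : p.Prime) (h : LH p k G) :
    (∃ q : ℕ, q.Prime ∧ q ≠ p ∧ ∀ v : ℕ, v.Prime → v ∣ (Subgroup.center G).index → v = p ∨ v = q) ∨
    (∃ r : ℕ, r.Prime ∧ r ≠ p ∧ ∃ w : G, NP p w ∧ (∀ v : ℕ, v.Prime → v ∣ k → v = p ∨ v = r) ∧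
      (∀ v : ℕ, v.Prime → v ∣ (Nr (Ce w)).index → v = p) ∧ (∀ b : G, NP p b → ∃ g, Ce (g * b * g⁻¹) = Ce w) ∧
      (∀ b ∈ Ce w, NP p b → Ce b = Ce w) ∧ (r ∣ k → ∃ j, (Ce w).relIndex (Nr (Ce w)) = r ^ j)) := by
  by_cases hcase : ∃ q : ℕ, q.Prime ∧ q ≠ p ∧ ∀ v : ℕ, v.Prime → v ∣ (Subgroup.center G).index → v = p ∨ v = q
  · exact Or.inl hcase
  right
  push Not at hcase
  have hidx : ∀ b : G, NP p b → (Ce b).index = k := by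
    rintro b ⟨hbZ, q, hq, hqp, hb⟩
    exact h b (hb.pp hq hp hqp) hbZ
  -- every noncentral primary p'-element commutes with another one of different prime
  have hother : ∀ (q : ℕ), q.Prime → q ≠ p → ∀ w : G, PE q w → w ∉ Subgroup.center G →
      ∃ s : ℕ, s.Prime ∧ s ≠ p ∧ s ≠ q ∧ ∃ a ∈ Ce w, PE s a ∧ a ∉ Subgroup.center G := by
    intro q hq hqp w hw hwZ
    by_contra hcon
    push Not at hcon
    obtain ⟨v, hv, hvd, hvp, hvq⟩ := hcase q hq hqp
    obtain ⟨b, hb, hbZ⟩ := exists_PE_of_dvd_index hv hvd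
    have h1 : v ∣ (Subgroup.center G).relIndex (Ce b) := dvd_relIndex_of_PE hv _ _ (self_mem_Ce b) hb hbZ
    have e1 := Subgroup.relIndex_mul_index (center_le_Ce b)
    have e2 := Subgroup.relIndex_mul_index (center_le_Ce w)
    rw [h b (hb.pp hv hp hvp) hbZ] at e1
    rw [h w (hw.pp hq hp hqp) hwZ, ← e1] at e2
    have hk : 0 < k := by
      rw [← h b (hb.pp hv hp hvp) hbZ]; exact Nat.pos_of_ne_zero (index_ne_zero' _)
    have e3 := Nat.eq_of_mul_eq_mul_right hk e2
    rw [← e3] at h1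
    obtain ⟨a, ha1, ha2, ha3⟩ := exists_PE_of_dvd hv _ _ h1
    exact ha3 (hcon v hv hvp hvq a ha1 ha2)
  -- some q in tau
  obtain ⟨q, hq, hqp, x0, hx0, hx0Z⟩ : ∃ q : ℕ, q.Prime ∧ q ≠ p ∧ ∃ x : G, PE q x ∧ x ∉ Subgroup.center G := by
    obtain ⟨q, hqgt, hq⟩ := Nat.exists_infinite_primes (p + 1)
    obtain ⟨v, hv, hvd, hvp, hvq⟩ := hcase q hq (by omega)
    obtain ⟨b, hb, hbZ⟩ := exists_PE_of_dvd_index hv hvd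
    exact ⟨v, hv, hvp, b, hb, hbZ⟩
  -- sigma
  have hnS : ∀ q : ℕ, q.Prime → q ≠ p → q ∣ k → SylZ q G := by
    intro q hq hqp hqk
    by_contra hS
    haveI := Fact.mk hq
    obtain ⟨T, w, hwT, hwZ, hTw⟩ := exists_of_not_SylZ hS
    have := not_dvd_of_sylow_le hTw
    rw [h w ((PE_of_mem_pgroup T.2 hwT).pp hq hp hqp) hwZ] at this
    exact this hqk
  obtain ⟨σ, hσ, hσp, hσk, a, ha, haZ⟩ : ∃ σ : ℕ, σ.Prime ∧ σ ≠ p ∧ ¬ σ ∣ k ∧ ∃ x : G, PE σ x ∧ x ∉ Subgroup.center G := by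
    by_cases hqk : q ∣ k
    · obtain ⟨w, hwZ, hw⟩ := exists_Wt hq hx0 hx0Z
      obtain ⟨s, hs, hsp, hsq, a, haw, ha, haZ⟩ := hother q hq hqp w hw.pe hwZ
      haveI := Fact.mk hs
      obtain ⟨-, S, hS⟩ := AT hq hs hsq (hnS q hq hqp hqk) hw ⟨a, haw, ha, haZ⟩ (fun b hb hbs hbZ =>
        h.eq hp hs hq hsp hqp hsq hbs hw.pe hbZ hwZ (mem_Ce.1 hb))
      refine ⟨s, hs, hsp, ?_, a, ha, haZ⟩
      have := not_dvd_of_sylow_le hS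
      rwa [h w (hw.pe.pp hq hp hqp) hwZ] at this
    · exact ⟨q, hq, hqp, hqk, x0, hx0, hx0Z⟩
  haveI := Fact.mk hσ
  obtain ⟨β, hβ, hβp, hβσ, b0, hb0a, hb0, hb0Z⟩ := hother σ hσ hσp a ha haZ
  have hAa : Ce a = Ce b0 := h.eq hp hσ hβ hσp hβp hβσ.symm ha hb0 haZ hb0Z (mem_Ce.1 hb0a).symm
  obtain ⟨S0, haS0, hS0⟩ := exists_sylow_le (p := σ) (Ce b0) (Subgroup.zpowers a) ha.pgroup (by
    rw [Subgroup.zpowers_le, ← hAa]; exact self_mem_Ce a) (by rwa [h b0 (hb0.pp hβ hp hβp) hb0Z])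
  have haS0 : a ∈ (S0 : Subgroup G) := haS0 (Subgroup.mem_zpowers a)
  have hS0A : ∀ c ∈ (S0 : Subgroup G), c ∉ Subgroup.center G → Ce c = Ce b0 := by
    intro c hc hcZ
    exact h.eq hp hσ hβ hσp hβp hβσ.symm (PE_of_mem_pgroup S0.2 hc) hb0 hcZ hb0Z (mem_Ce.1 (hS0 hc))
  have hconj0 : ∀ b : G, NP p b → ∃ g, Ce (g * b * g⁻¹) = Ce b0 := by
    rintro b hbN
    have hbk := hidx b hbN
    obtain ⟨hbZ, ρ, hρ, hρp, hb⟩ := hbN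
    by_cases hρσ : ρ = σ
    · subst hρσ
      obtain ⟨P, hP⟩ := PE_exists_sylow hb
      obtain ⟨g, hg⟩ := sylow_conj S0 P
      exact ⟨g, hS0A _ ((hg b).1 hP) (by rwa [conj_mem_center])⟩
    · obtain ⟨P, -, hP⟩ := exists_sylow_le (p := σ) (Ce b) ⊥ IsPGroup.of_bot bot_le (by rwa [hbk])
      obtain ⟨g, hg⟩ := sylow_conj P S0
      refine ⟨g⁻¹, ?_⟩
      have h1 := mem_Ce.1 (hP ((hg a).1 haS0))
      have h2 : Ce (g * a * g⁻¹) = Ce b := h.eq hp hσ hρ hσp hρp (Ne.symm hρσ) (ha.conj g) hb (by rwa [conj_mem_center]) hbZ h1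
      have h3 := Ce_conj_congr (g := g⁻¹) h2
      rw [← h3, ← hAa]
      congr 2
      group
  have hcent0 : ∀ b : G, b ∈ Ce b0 → NP p b → Ce b = Ce b0 := by
    rintro b hb ⟨hbZ, ρ, hρ, hρp, hbρ⟩
    by_cases hρσ : ρ = σ
    · subst hρσ
      exact h.eq hp hρ hβ hρp hβp hβσ.symm hbρ hb0 hbZ hb0Z (mem_Ce.1 hb)
    · rw [← hAa] at hb ⊢
      exact h.eq hp hρ hσ hρp hσp hρσ hbρ ha hbZ haZ (mem_Ce.1 hb)
  have hcent : ∀ w : G, NP p w → ∀ b ∈ Ce w, NP p b → Ce b = Ce w := by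
    intro w hw b hb hbN
    obtain ⟨g, hg⟩ := hconj0 w hw
    apply Ce_conj_inj (g := g)
    rw [hg]
    apply hcent0 _ _ (hbN.conj g)
    rw [← hg, conj_mem_Ce]; exact hb
  have hconj : ∀ w : G, NP p w → ∀ b, NP p b → ∃ g, Ce (g * b * g⁻¹) = Ce w := by
    intro w hw b hb
    obtain ⟨g, hg⟩ := hconj0 w hw
    obtain ⟨g', hg'⟩ := hconj0 b hb
    refine ⟨g⁻¹ * g', Ce_conj_inj (g := g) ?_⟩
    have e : g * (g⁻¹ * g' * b * (g⁻¹ * g')⁻¹) * g⁻¹ = g' * b * g'⁻¹ := by group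
    rw [hg, ← hg', e]
  have hrho : ∀ ρ : ℕ, ρ.Prime → ρ ≠ p → ρ ∣ k → ∀ w : G, w ∉ Subgroup.center G → Wt ρ w → ∃ j, (Ce w).relIndex (Nr (Ce w)) = ρ ^ j := by
    intro ρ hρ hρp hρk w hwZ hw
    obtain ⟨s, hs, hsp, hsq, a, haw, ha, haZ⟩ := hother ρ hρ hρp w hw.pe hwZ
    exact (AT hρ hs hsq (hnS ρ hρ hρp hρk) hw ⟨a, haw, ha, haZ⟩ (fun b hb hbs hbZ =>
        h.eq hp hs hρ hsp hρp hsq hbs hw.pe hbZ hwZ (mem_Ce.1 hb))).1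
  by_cases hρ : ∃ ρ : ℕ, ρ.Prime ∧ ρ ≠ p ∧ ρ ∣ k
  · obtain ⟨ρ, hρ, hρp, hρk⟩ := hρ
    have hdc : ∀ v, v ∣ k → v ∣ (Subgroup.center G).index := by
      intro v hv
      rw [← hidx b0 ⟨hb0Z, β, hβ, hβp, hb0⟩] at hv
      exact dvd_center_index_of_dvd hv
    obtain ⟨x, hx, hxZ⟩ := exists_PE_of_dvd_index hρ (hdc ρ hρk)
    obtain ⟨w, hwZ, hw⟩ := exists_Wt hρ hx hxZ
    have hwN : NP p w := ⟨hwZ, ρ, hρ, hρp, hw.pe⟩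
    obtain ⟨j, hj⟩ := hrho ρ hρ hρp hρk w hwZ hw
    have hNρ : ¬ ρ ∣ (Nr (Ce w)).index := by
      haveI := Fact.mk hρ
      obtain ⟨T, hwT, hT⟩ := hw
      exact not_dvd_of_sylow_le (S := T) (fun y hy => mem_Nr_of_comm (hT y hy))
    have hmul := Subgroup.relIndex_mul_index (Subgroup.le_normalizer (H := Ce w))
    rw [hidx w hwN] at hmul
    have hj0 : j ≠ 0 := by
      rintro rfl
      rw [hj, pow_zero, one_mul] at hmul
      exact hNρ (hmul ▸ hρk)
    have huniq : ∀ v : ℕ, v.Prime → v ∣ k → v = p ∨ v = ρ := by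
      intro v hv hvk
      by_contra hcon
      push Not at hcon
      obtain ⟨x', hx', hxZ'⟩ := exists_PE_of_dvd_index hv (hdc v hvk)
      obtain ⟨w', hwZ', hw'⟩ := exists_Wt hv hx' hxZ'
      obtain ⟨g, hg⟩ := hconj w hwN w' ⟨hwZ', v, hv, hcon.1, hw'.pe⟩
      obtain ⟨i, hi⟩ := hrho v hv hcon.1 hvk w' hwZ' hw'
      rw [← relIndex_Nr_conj g, hg, hj] at hi
      have : ρ ∣ v ^ i := hi ▸ dvd_pow_self ρ hj0
      exact hcon.2 ((Nat.prime_dvd_prime_iff_eq hρ hv).1 (hρ.dvd_of_dvd_pow this)).symm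
    refine ⟨ρ, hρ, hρp, w, hwN, huniq, ?_, hconj w hwN, hcent w hwN, fun _ => ⟨j, hj⟩⟩
    intro v hv hvd
    rcases huniq v hv (hmul ▸ hvd.mul_left _) with h1 | h1
    · exact h1
    · exact (hNρ (h1 ▸ hvd)).elim
  · push Not at hρ
    have hb0N : NP p b0 := ⟨hb0Z, β, hβ, hβp, hb0⟩
    have hall : ∀ v : ℕ, v.Prime → v ∣ k → v = p := fun v hv hvk => by
      by_contra hvp
      exact hρ v hv hvp hvk
    refine ⟨σ, hσ, hσp, b0, hb0N, fun v hv hvk => Or.inl (hall v hv hvk), ?_, hconj b0 hb0N, hcent b0 hb0N, fun hh => (hσk hh).elim⟩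
    intro v hv hvd
    apply hall v hv
    rw [← hidx b0 hb0N]
    exact hvd.trans (Subgroup.index_dvd_of_le Subgroup.le_normalizer)

lemma solvable_of_two_primes {p q : ℕ} (hp : p.Prime) (hq : q.Prime)
    (h : ∀ v : ℕ, v.Prime → v ∣ (Subgroup.center G).index → v = p ∨ v = q) : Group.IsSolvable G := by
  apply BC hp hq
  intro x _
  refine ⟨Subgroup.center G, fun a ha b _ => (Subgroup.mem_center_iff.1 ha b).symm, center_le_Ce x, h, ?_⟩
  intro t ht htd
  have : Nr (Subgroup.center G) = ⊤ := Subgroup.normalizer_eq_top _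
  rw [this, Subgroup.index_top] at htd
  exact (ht.one_lt.ne' (Nat.dvd_one.1 htd)).elim

lemma Nr_le_Nr_centralizer (E : Subgroup G) : Nr E ≤ Nr (Subgroup.centralizer (E : Set G)) := by
  intro x hx
  rw [Subgroup.mem_normalizer_iff] at *
  intro d
  rw [Subgroup.mem_centralizer_iff, Subgroup.mem_centralizer_iff]
  constructor
  · intro h y hy
    have hy' : x⁻¹ * y * x ∈ E := (hx _).2 (by simpa [mul_assoc] using hy)
    have := congrArg (fun z => x * z * x⁻¹) (h _ hy')
    simpa [mul_assoc] using this
  · intro h y hy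
    have := congrArg (fun z => x⁻¹ * z * x) (h _ ((hx y).1 hy))
    simpa [mul_assoc] using this

theorem thmL {p k : ℕ} (hp : p.Prime) (h : LH p k G) : Group.IsSolvable G := by
  rcases L_struct hp h with ⟨q, hq, -, hall⟩ | ⟨r, hr, hrp, w, hwN, hk, hN, hconj, hcent, -⟩
  · exact solvable_of_two_primes hp hq hall
  · apply BC hp hr
    have hwk : (Ce w).index = k := by
      obtain ⟨hbZ, q, hq, hqp, hb⟩ := hwN
      exact h w (hb.pp hq hp hqp) hbZ
    let Q := Subgroup.centralizer ((Ce w : Subgroup G) : Set G)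
    have hQE : Q ≤ Ce w := centralizer_Ce_le w
    have hQab : ∀ a ∈ Q, ∀ b ∈ Q, a * b = b * a := fun a ha b hb => (Subgroup.mem_centralizer_iff.1 ha b (hQE hb)).symm
    have hQi : ∀ t : ℕ, t.Prime → t ∣ Q.index → t = p ∨ t = r := by
      intro t ht htd
      rw [← Subgroup.relIndex_mul_index hQE, ht.dvd_mul] at htd
      rcases htd with htd | htd
      · left
        by_contra htp
        obtain ⟨g, hg, hgt, hgQ⟩ := exists_PE_of_dvd ht _ _ htd
        apply hgQ
        have hgZ : g ∉ Subgroup.center G := fun hgZ => hgQ (Subgroup.center_le_centralizer _ hgZ)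
        rw [Subgroup.mem_centralizer_iff, ← hcent g hg ⟨hgZ, t, ht, htp, hgt⟩]
        intro y hy; exact mem_Ce.1 hy
      · exact hk t ht (hwk ▸ htd)
    have hQN : ∀ t : ℕ, t.Prime → t ∣ (Nr Q).index → t = p := fun t ht htd =>
      hN t ht (htd.trans (Subgroup.index_dvd_of_le (Nr_le_Nr_centralizer _)))
    intro x hx
    by_cases hxZ : x ∈ Subgroup.center G
    · exact ⟨Q, hQab, by rw [Ce_eq_top.2 hxZ]; exact le_top, hQi, hQN⟩
    · obtain ⟨g, hg⟩ := hconj x ⟨hxZ, r, hr, hrp, hx⟩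
      refine ⟨Q.map (MulAut.conj g⁻¹).toMonoidHom, ?_, ?_, ?_, ?_⟩
      · rintro _ ⟨a, ha, rfl⟩ _ ⟨b, hb, rfl⟩
        rw [← map_mul, hQab a ha b hb, map_mul]
      · intro y hy
        rw [mem_conj_map] at hy
        have := hQE hy
        rw [← hg] at this
        rw [← conj_mem_Ce (c := g)]
        simpa using this
      · rw [index_conj]; exact hQi
      · rw [Nr_map_conj, index_conj]; exact hQN

theorem thmL1 {p k : ℕ} (hp : p.Prime) (h : LH p k G) (hne : ∃ x : G, PP p x ∧ x ∉ Subgroup.center G) :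
    ∃ q : ℕ, q.Prime ∧ q ≠ p ∧ ∀ v : ℕ, v.Prime → v ∣ k → v = p ∨ v = q := by
  rcases L_struct hp h with ⟨q, hq, hqp, hall⟩ | ⟨r, hr, hrp, w, hwN, hk, -⟩
  · obtain ⟨x, hx, hxZ⟩ := hne
    refine ⟨q, hq, hqp, fun v hv hvk => hall v hv ?_⟩
    rw [← h x hx hxZ] at hvk
    exact dvd_center_index_of_dvd hvk
  · exact ⟨r, hr, hrp, hk⟩

theorem thmL2 {p k q u : ℕ} (hp : p.Prime) (h : LH p k G) (hq : q.Prime) (hqp : q ≠ p) (hqk : q ∣ k) (hu : u.Prime)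
    (hup : u ≠ p) (huq : u ≠ q) {w : G} (hw : PE u w) (hwZ : w ∉ Subgroup.center G) :
    ∃ j, j ≠ 0 ∧ (Ce w).relIndex (Nr (Ce w)) = q ^ j := by
  have hwk := h w (hw.pp hu hp hup) hwZ
  rcases L_struct hp h with ⟨q', hq', -, hall⟩ | ⟨r, hr, hrp, w0, hwN, hk, hN, hconj, hcent, hrel⟩
  · have h1 : q ∣ (Subgroup.center G).index := by
      rw [← hwk] at hqk
      exact dvd_center_index_of_dvd hqk
    have h2 := dvd_index_of_PE hu hw hwZ
    have e1 := hall q hq h1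
    have e2 := hall u hu h2
    omega
  · obtain rfl : q = r := by have := hk q hq hqk; tauto
    obtain ⟨j, hj⟩ := hrel hqk
    obtain ⟨g, hg⟩ := hconj w ⟨hwZ, u, hu, hup, hw⟩
    rw [← relIndex_Nr_conj g w, hg]
    refine ⟨j, ?_, hj⟩
    rintro rfl
    have hmul := Subgroup.relIndex_mul_index (Subgroup.le_normalizer (H := Ce w0))
    rw [hj, pow_zero, one_mul, ← hg, index_Ce_conj, hwk, hg] at hmul
    exact hqp (hN q hq (hmul ▸ hqk))
end thmL
end CS

namespace CS
section F
variable {G : Type*} [Group G] [Finite G]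

structure IH (m n : ℕ) (G : Type*) [Group G] : Prop where
  two : ∀ x : G, x ∉ Subgroup.center G → (Ce x).index = m ∨ (Ce x).index = n
  ns : ¬ Group.IsSolvable G

lemma IH.symm {m n : ℕ} (h : IH m n G) : IH n m G := ⟨fun x hx => (h.two x hx).symm, h.ns⟩

lemma IH.R2 {m n : ℕ} (h : IH m n G) {p : ℕ} (hp : p.Prime) : ∃ x : G, PP p x ∧ x ∉ Subgroup.center G ∧ (Ce x).index = m := by
  by_contra hcon
  push Not at hcon
  exact h.ns (thmL hp (k := n) (fun x hx hxZ => (h.two x hxZ).resolve_left (hcon x hx hxZ)))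

lemma PE_of_index {p : ℕ} {w x : G} (hp : p.Prime) (hx : PP p x) (hxZ : x ∉ Subgroup.center G)
    (hi : (Ce x).index = (Ce w).index) : ∃ q : ℕ, q.Prime ∧ q ≠ p ∧ ∃ a ∈ Ce w, PE q a ∧ a ∉ Subgroup.center G := by
  obtain ⟨q, hq, hqp, i, hi1, hi2⟩ := exists_primary' hp (Subgroup.center G) x hxZ hx
  have h1 : q ∣ (Subgroup.center G).relIndex (Ce x) := dvd_relIndex_of_PE hq _ _ (pow_mem_Ce x i) hi1 hi2
  have e1 := Subgroup.relIndex_mul_index (center_le_Ce x)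
  have e2 := Subgroup.relIndex_mul_index (center_le_Ce w)
  rw [hi, ← e2] at e1
  rw [Nat.eq_of_mul_eq_mul_right (Nat.pos_of_ne_zero (index_ne_zero' _)) e1] at h1
  obtain ⟨a, h2, h3, h4⟩ := exists_PE_of_dvd hq _ _ h1
  exact ⟨q, hq, hqp, a, h2, h3, h4⟩

lemma IH.R1 {m n : ℕ} (h : IH m n G) {p : ℕ} (hp : p.Prime) {w : G} (hw : w ∉ Subgroup.center G) :
    ∃ q : ℕ, q.Prime ∧ q ≠ p ∧ ∃ a ∈ Ce w, PE q a ∧ a ∉ Subgroup.center G := by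
  rcases h.two w hw with h1 | h1
  · obtain ⟨x, hx, hxZ, hxi⟩ := h.R2 hp
    exact PE_of_index hp hx hxZ (hxi.trans h1.symm)
  · obtain ⟨x, hx, hxZ, hxi⟩ := h.symm.R2 hp
    exact PE_of_index hp hx hxZ (hxi.trans h1.symm)

lemma solvable_of_hom {Q : Type*} [Group Q] [Group.IsSolvable Q] (f : G →* Q) (N : Subgroup G)
    (h : Group.IsSolvable (f.ker ⊓ N : Subgroup G)) : Group.IsSolvable N := by
  have h1 : f.ker ⊓ N ≤ N := inf_le_right
  refine Group.isSolvable_of_ker_le_range (Subgroup.inclusion h1) (f.comp N.subtype) ?_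
  intro x hx
  exact ⟨⟨x, hx, x.2⟩, rfl⟩

lemma solvable_of_abelian {A : Subgroup G} (h : ∀ a ∈ A, ∀ b ∈ A, a * b = b * a) : Group.IsSolvable A :=
  Group.isSolvable_of_comm fun a b => Subtype.ext (h a a.2 b b.2)

lemma solvable_of_le {A B : Subgroup G} (h : A ≤ B) (hB : Group.IsSolvable B) : Group.IsSolvable A :=
  Group.isSolvable_of_isSolvable_injective (Subgroup.inclusion_injective h)

lemma solvable_Nr {A : Subgroup G} (h : ∀ a ∈ A, ∀ b ∈ A, a * b = b * a) {t j : ℕ} (ht : t.Prime) (hj : A.relIndex (Nr A) = t ^ j) :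
    Group.IsSolvable (Nr A) := by
  haveI := Fact.mk ht
  haveI : (A.subgroupOf (Nr A)).Normal := Subgroup.normal_in_normalizer
  have hp : IsPGroup t (Nr A ⧸ A.subgroupOf (Nr A)) := IsPGroup.iff_card.2 ⟨j, hj⟩
  haveI := hp.isNilpotent
  rw [Group.isSolvable_iff_subgroup_quotient (A.subgroupOf (Nr A))]
  refine ⟨?_, inferInstance⟩
  exact Group.isSolvable_of_comm fun a b => Subtype.ext (Subtype.ext (h _ a.2 _ b.2))

lemma exists_residual (hns : ¬ Group.IsSolvable G) : ∃ R : Subgroup G, R.Normal ∧ ¬ Group.IsSolvable R ∧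
    ∀ M : Subgroup G, M.Normal → (∀ N : Subgroup G, Group.IsSolvable (M ⊓ N : Subgroup G) → Group.IsSolvable N) → R ≤ M := by
  have h0 : ∃ R : Subgroup G, R.Normal ∧ ¬ Group.IsSolvable R := by
    refine ⟨⊤, inferInstance, fun h => hns ?_⟩
    exact Group.isSolvable_of_surjective (f := (Subgroup.topEquiv : (⊤ : Subgroup G) ≃* G).toMonoidHom) Subgroup.topEquiv.surjective
  obtain ⟨R, hR⟩ := Set.Finite.exists_minimal (s := {R : Subgroup G | R.Normal ∧ ¬ Group.IsSolvable R}) (Set.toFinite _) h0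
  refine ⟨R, hR.1.1, hR.1.2, fun M hM h => ?_⟩
  by_contra hRM
  haveI := hM
  haveI := hR.1.1
  have h1 : ¬ Group.IsSolvable (M ⊓ R : Subgroup G) := fun h2 => hR.1.2 (h R h2)
  have h2 := hR.2 (y := M ⊓ R) ⟨inferInstance, h1⟩ inf_le_right
  exact hRM (h2.trans inf_le_left)

/-- A normal subgroup of order coprime to the index of A is contained in A -/
lemma le_of_coprime {R A : Subgroup G} [R.Normal] (h : ∀ v : ℕ, v.Prime → v ∣ A.index → ¬ v ∣ Nat.card R) : R ≤ A := by
  rw [← Subgroup.relIndex_eq_one]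
  by_contra hne
  obtain ⟨v, hv, hvd⟩ := Nat.exists_prime_and_dvd hne
  exact h v hv (hvd.trans (relIndex_dvd_index_right A R)) (hvd.trans (Subgroup.relIndex_dvd_card A R))

theorem F_case {m n : ℕ} (h : IH m n G)
    (hF : ∀ x y : G, x ∉ Subgroup.center G → y ∉ Subgroup.center G → Ce x ≤ Ce y → Ce x = Ce y) : False := by
  have F1 : ∀ q s : ℕ, q.Prime → s.Prime → q ≠ s → ∀ a b : G, PE q a → PE s b → a ∉ Subgroup.center G → b ∉ Subgroup.center G →
      a * b = b * a → Ce a = Ce b := by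
    intro q s hq hs hqs a b ha hb haZ hbZ hc
    have hcop := ha.coprime hq (hb.pp hs hq hqs.symm)
    have h1 := Ce_mul hc hcop
    have h2 := mul_not_center_left hc hcop haZ
    rw [← hF _ _ h2 haZ (h1 ▸ inf_le_left), ← hF _ _ h2 hbZ (h1 ▸ inf_le_right)]
  have F0 : ∀ x : G, x ∉ Subgroup.center G → ∃ q : ℕ, q.Prime ∧ ∃ i : ℕ, PE q (x ^ i) ∧ x ^ i ∉ Subgroup.center G ∧ Ce x = Ce (x ^ i) := by
    intro x hx
    obtain ⟨q, hq, i, hi, hiZ⟩ := exists_primary (Subgroup.center G) x hx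
    exact ⟨q, hq, i, hi, hiZ, hF _ _ hx hiZ (Ce_pow x i)⟩
  have F2 : ∀ x d : G, x ∉ Subgroup.center G → d ∉ Subgroup.center G → d ∈ Ce x → Ce d = Ce x := by
    intro x d hx hd hdx
    obtain ⟨t, ht, i, hi, hiZ, hie⟩ := F0 x hx
    obtain ⟨q, hq, j, hj, hjZ, hje⟩ := F0 d hd
    rw [hje, hie]
    have hc : x ^ i * d ^ j = d ^ j * x ^ i := by
      have : Commute d x := mem_Ce.1 hdx
      exact (this.pow_pow j i).symm
    by_cases hqt : q = t
    · obtain ⟨s, hs, hst, a, hae, ha, haZ⟩ := h.R1 ht hiZ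
      have e1 := F1 s t hs ht hst a (x ^ i) ha hi haZ hiZ (mem_Ce.1 hae)
      have e2 : d ^ j ∈ Ce a := by rw [e1, mem_Ce]; exact hc.symm
      rw [← e1]
      exact F1 q s hq hs (by rw [hqt]; exact hst.symm) _ _ hj ha hjZ haZ (mem_Ce.1 e2)
    · exact F1 q t hq ht hqt _ _ hj hi hjZ hiZ hc.symm
  have hab : ∀ x : G, x ∉ Subgroup.center G → ∀ a ∈ Ce x, ∀ b ∈ Ce x, a * b = b * a := by
    intro x hx a ha b hb
    by_cases haZ : a ∈ Subgroup.center G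
    · exact (Subgroup.mem_center_iff.1 haZ b).symm
    · rw [← F2 x a hx haZ ha] at hb
      exact (mem_Ce.1 hb).symm
  -- F3
  have F3 : ∀ t : ℕ, t.Prime → t ∣ (Subgroup.center G).index → ∃ w : G, w ∉ Subgroup.center G ∧
      (∃ T : Sylow t G, (T : Subgroup G) ≤ Nr (Ce w) ∧ ((T : Subgroup G) ≤ Ce w ∨ ∃ j, (Ce w).relIndex (Nr (Ce w)) = t ^ j)) ∧
      ∃ σ : ℕ, σ.Prime ∧ ∃ S : Sylow σ G, (S : Subgroup G) ≤ Ce w ∧ ∃ a ∈ (S : Subgroup G), a ∉ Subgroup.center G := by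
    intro t ht htd
    haveI := Fact.mk ht
    by_cases hZ : SylZ t G
    · obtain ⟨x, hx, hxZ⟩ := exists_PE_of_dvd_index ht htd
      obtain ⟨w, hwZ, hw⟩ := exists_Wt ht hx hxZ
      obtain ⟨s, hs, hst, a, hae, ha, haZ⟩ := h.R1 ht hwZ
      obtain ⟨hj, S, hS⟩ := AT ht hs hst hZ hw ⟨a, hae, ha, haZ⟩ (fun b hb _ hbZ => F2 w b hwZ hbZ hb)
      obtain ⟨T, hwT, hT⟩ := hw
      refine ⟨w, hwZ, ⟨T, fun y hy => mem_Nr_of_comm (hT y hy), Or.inr hj⟩, s, hs, S, hS, a, ?_, haZ⟩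
      exact mem_sylow_of_comm ha fun y hy => hab w hwZ a hae y (hS hy)
    · obtain ⟨T, w, hwT, hwZ, hTw⟩ := exists_of_not_SylZ hZ
      exact ⟨w, hwZ, ⟨T, hTw.trans Subgroup.le_normalizer, Or.inl hTw⟩, t, ht, T, hTw, w, hwT, hwZ⟩
  choose! w hwZ hwT hwS using F3
  have F4 : ∀ t : ℕ, t.Prime → t ∣ (Subgroup.center G).index → ∀ x : G, x ∉ Subgroup.center G → (Ce x).index = (Ce (w t)).index →
      ∃ g, Ce (g * x * g⁻¹) = Ce (w t) := by
    intro t ht htd x hx hi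
    obtain ⟨σ, hσ, S, hS, a, haS, haZ⟩ := hwS t ht htd
    haveI := Fact.mk hσ
    have h1 := not_dvd_of_sylow_le hS
    rw [← hi] at h1
    obtain ⟨P, -, hP⟩ := exists_sylow_le (p := σ) (Ce x) ⊥ IsPGroup.of_bot bot_le h1
    obtain ⟨g, hg⟩ := sylow_conj P S
    refine ⟨g⁻¹, ?_⟩
    have e1 := F2 x _ hx (by rwa [conj_mem_center]) (hP ((hg a).1 haS))
    have e2 := F2 (w t) a (hwZ t ht htd) haZ (hS haS)
    rw [← e2, ← Ce_conj_congr e1]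
    congr 2; group
  obtain ⟨R, hRn, hRs, hR⟩ := exists_residual h.ns
  -- final lemma
  have fin : ∀ t0 : ℕ, t0.Prime → t0 ∣ (Subgroup.center G).index →
      (∀ t : ℕ, t.Prime → t ∣ (Subgroup.center G).index → (Ce (w t)).index ≠ (Ce (w t0)).index → ¬ t ∣ Nat.card R) → False := by
    intro t0 ht0 htd0 hb
    have hN : R ≤ Nr (Ce (w t0)) := by
      apply le_of_coprime
      intro v hv hvd
      have hvZ : v ∣ (Subgroup.center G).index :=
        hvd.trans (Subgroup.index_dvd_of_le ((center_le_Ce _).trans Subgroup.le_normalizer))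
      by_cases hi : (Ce (w v)).index = (Ce (w t0)).index
      · exfalso
        haveI := Fact.mk hv
        obtain ⟨T, hT, -⟩ := hwT v hv hvZ
        obtain ⟨g, hg⟩ := F4 t0 ht0 htd0 (w v) (hwZ v hv hvZ) hi
        rw [← hg, Ce_conj, Nr_map_conj, index_conj] at hvd
        exact not_dvd_of_sylow_le hT hvd
      · exact hb v hv hvZ hi
    by_cases hty : ∃ t : ℕ, t.Prime ∧ t ∣ (Subgroup.center G).index ∧ (Ce (w t)).index = (Ce (w t0)).index ∧ ∃ j, (Ce (w t)).relIndex (Nr (Ce (w t))) = t ^ j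
    · obtain ⟨t, ht, htd, hi, j, hj⟩ := hty
      obtain ⟨g, hg⟩ := F4 t0 ht0 htd0 (w t) (hwZ t ht htd) hi
      rw [← relIndex_Nr_conj g, hg] at hj
      exact hRs (solvable_of_le hN (solvable_Nr (hab _ (hwZ t0 ht0 htd0)) ht hj))
    · have hA : R ≤ Ce (w t0) := by
        apply le_of_coprime
        intro v hv hvd
        have hvZ := dvd_center_index_of_dvd hvd
        apply hb v hv hvZ
        intro hi
        haveI := Fact.mk hv
        obtain ⟨T, -, hT | hT⟩ := hwT v hv hvZ
        · rw [← hi] at hvd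
          exact not_dvd_of_sylow_le hT hvd
        · exact hty ⟨v, hv, hvZ, hi, hT⟩
      exact hRs (solvable_of_le hA (solvable_of_abelian (hab _ (hwZ t0 ht0 htd0))))
  -- self-normalizing case
  have fin2 : ∀ t1 t2 : ℕ, t1.Prime → t1 ∣ (Subgroup.center G).index → t2.Prime → t2 ∣ (Subgroup.center G).index →
      (∀ x : G, x ∉ Subgroup.center G → (Ce x).index = (Ce (w t1)).index ∨ (Ce x).index = (Ce (w t2)).index) →
      Nr (Ce (w t2)) = Ce (w t2) → False := by
    intro t1 t2 ht1 htd1 ht2 htd2 htwo hself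
    apply fin t1 ht1 htd1
    intro t ht htd hi
    haveI := Fact.mk ht
    have hi2 := (htwo (w t) (hwZ t ht htd)).resolve_left hi
    obtain ⟨g, hg⟩ := F4 t2 ht2 htd2 (w t) (hwZ t ht htd) hi2
    have hself2 : Nr (Ce (w t)) ≤ Ce (w t) := by
      have e1 := relIndex_Nr_conj g (w t)
      rw [hg, hself, Subgroup.relIndex_self] at e1
      exact Subgroup.relIndex_eq_one.1 e1.symm
    obtain ⟨T, hT, -⟩ := hwT t ht htd
    have hTE := hT.trans hself2
    obtain ⟨a, haT, haZ⟩ : ∃ a ∈ (T : Subgroup G), a ∉ Subgroup.center G := by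
      obtain ⟨x, hx, hxZ⟩ := exists_PE_of_dvd_index ht htd
      obtain ⟨P, hP⟩ := PE_exists_sylow hx
      obtain ⟨c, hc⟩ := sylow_conj T P
      exact ⟨_, (hc x).1 hP, by rwa [conj_mem_center]⟩
    have hPC : Subgroup.normalizer (T : Set G) ≤ Subgroup.centralizer (T : Set G) := by
      intro x hx
      have hx' := (Subgroup.mem_normalizer_iff.1 hx a).1 haT
      have e1 := F2 _ a (hwZ t ht htd) haZ (hTE haT)
      have e2 := F2 _ _ (hwZ t ht htd) (by rwa [conj_mem_center]) (hTE hx')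
      have hxE : x ∈ Ce (w t) := by
        apply hself2
        rw [← e1]
        apply mem_Nr_Ce
        rw [e2, e1]
      rw [Subgroup.mem_centralizer_iff]
      intro y hy
      exact hab _ (hwZ t ht htd) y (hTE hy) x hxE
    have hRK : R ≤ (MonoidHom.transferSylow T hPC).ker := by
      apply hR _ inferInstance
      intro N hN
      haveI : Group.IsNilpotent (T : Subgroup G) := T.2.isNilpotent
      exact solvable_of_hom _ N hN
    exact fun hd => MonoidHom.not_dvd_card_ker_transferSylow T hPC (hd.trans (Subgroup.card_dvd_of_le hRK))
  -- choose a prime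
  have hZ1 : (Subgroup.center G).index ≠ 1 := by
    intro h1
    rw [Subgroup.index_eq_one] at h1
    apply h.ns
    apply Group.isSolvable_of_comm
    intro a b
    have : a ∈ Subgroup.center G := h1 ▸ Subgroup.mem_top a
    exact (Subgroup.mem_center_iff.1 this b).symm
  obtain ⟨t1, ht1, htd1⟩ := Nat.exists_prime_and_dvd hZ1
  by_cases hall : ∀ t : ℕ, t.Prime → t ∣ (Subgroup.center G).index → (Ce (w t)).index = (Ce (w t1)).index
  · exact fin t1 ht1 htd1 fun t ht htd hne => (hne (hall t ht htd)).elim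
  · push Not at hall
    obtain ⟨t2, ht2, htd2, hne⟩ := hall
    have htwo : ∀ x : G, x ∉ Subgroup.center G → (Ce x).index = (Ce (w t1)).index ∨ (Ce x).index = (Ce (w t2)).index := by
      intro x hx
      have e1 := h.two x hx
      have e2 := h.two _ (hwZ t1 ht1 htd1)
      have e3 := h.two _ (hwZ t2 ht2 htd2)
      omega
    have hcov : Nr (Ce (w t1)) = Ce (w t1) ∨ Nr (Ce (w t2)) = Ce (w t2) := by
      apply cover_two
      intro x
      by_cases hx : x ∈ Subgroup.center G
      · exact Or.inl ⟨1, by simpa using center_le_Ce _ hx⟩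
      · rcases htwo x hx with e | e
        · obtain ⟨g, hg⟩ := F4 t1 ht1 htd1 x hx e
          exact Or.inl ⟨g, hg ▸ self_mem_Ce _⟩
        · obtain ⟨g, hg⟩ := F4 t2 ht2 htd2 x hx e
          exact Or.inr ⟨g, hg ▸ self_mem_Ce _⟩
    rcases hcov with hc | hc
    · exact fin2 t2 t1 ht2 htd2 ht1 htd1 (fun x hx => (htwo x hx).symm) hc
    · exact fin2 t1 t2 ht1 htd1 ht2 htd2 htwo hc
end F
end CS

namespace CS
section I
variable {G : Type*} [Group G] [Finite G]

lemma index_dvd_of_Ce_le {x y : G} (h : Ce x ≤ Ce y) : (Ce y).index ∣ (Ce x).index := Subgroup.index_dvd_of_le h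

lemma IH.pow_index {m n : ℕ} (h : IH m n G) (hmn : m < n) {x : G} (hx : (Ce x).index = m) (i : ℕ) (hi : x ^ i ∉ Subgroup.center G) :
    (Ce (x ^ i)).index = m ∧ Ce x = Ce (x ^ i) := by
  have h1 : (Ce (x ^ i)).index = m := by
    rcases h.two _ hi with h2 | h2
    · exact h2
    · exfalso
      have h3 := index_dvd_of_Ce_le (Ce_pow x i)
      rw [h2, hx] at h3
      have h4 : 0 < m := Nat.pos_of_ne_zero (hx ▸ index_ne_zero' _)
      exact absurd (Nat.le_of_dvd h4 h3) (by omega)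
  exact ⟨h1, eq_of_le_index (Ce_pow x i) (by rw [hx, h1])⟩

theorem caseI {m n : ℕ} (h : IH m n G) (hd : m ∣ n) (hmn : m < n) {x0 y0 : G} (hx0 : x0 ∉ Subgroup.center G) (hxy : Ce x0 ≤ Ce y0)
    (hx0i : (Ce x0).index = n) (hy0 : y0 ∉ Subgroup.center G) (hy0i : (Ce y0).index = m) {p : ℕ} (hp : p.Prime) (hS : ¬ SylZ p G) : False := by
  haveI := Fact.mk hp
  obtain ⟨T, w, hwT, hwZ, hTw⟩ := exists_of_not_SylZ hS
  have hwp : PE p w := PE_of_mem_pgroup T.2 hwT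
  have hpn : p ∣ n := by
    by_contra hpn
    have hpm : ¬ p ∣ m := fun h1 => hpn (h1.trans hd)
    refine hwZ (central_of_not_dvd hp (fun x hx => ?_) w hwp)
    by_cases hxZ : x ∈ Subgroup.center G
    · rw [Ce_eq_top.2 hxZ, Subgroup.index_top] at hx
      exact hp.one_lt.ne' (Nat.dvd_one.1 hx)
    · rcases h.two x hxZ with e | e
      · exact hpm (e ▸ hx)
      · exact hpn (e ▸ hx)
  have hm : ∀ x : G, x ∉ Subgroup.center G → ¬ p ∣ (Ce x).index → (Ce x).index = m := by
    intro x hx h1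
    exact (h.two x hx).resolve_right fun e => h1 (e ▸ hpn)
  have hwi := hm w hwZ (not_dvd_of_sylow_le hTw)
  have hpm : ¬ p ∣ m := hwi ▸ not_dvd_of_sylow_le hTw
  -- Sylow containing an element, with a conjugate of w in its center
  have hP : ∀ P : Sylow p G, ∃ g, (P : Subgroup G) ≤ Ce (g * w * g⁻¹) ∧ g * w * g⁻¹ ∈ (P : Subgroup G) := by
    intro P
    obtain ⟨c, hc⟩ := sylow_conj T P
    refine ⟨c⁻¹, fun x hx => ?_, ?_⟩
    · have h1 := hTw ((hc x).1 hx)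
      have h2 := (conj_mem_Ce (c := c⁻¹)).2 h1
      convert h2 using 1
      group
    · rw [hc]
      convert hwT using 1
      group
  have key : ∀ a b : G, PE p a → PP p b → a * b = b * a → a ∉ Subgroup.center G → b ∉ Subgroup.center G → ∀ P : Sylow p G,
      (P : Subgroup G) ≤ Ce a → (P : Subgroup G) ≤ Ce b → Ce a = Ce b := by
    intro a b ha hb hc haZ hbZ P hPa hPb
    have hcop := ha.coprime hp hb
    have h1 : (P : Subgroup G) ≤ Ce (a * b) := by rw [Ce_mul hc hcop]; exact le_inf hPa hPb
    have h2 := hm _ (mul_not_center_left hc hcop haZ) (not_dvd_of_sylow_le h1)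
    have h3 := hm _ haZ (not_dvd_of_sylow_le hPa)
    have h4 := hm _ hbZ (not_dvd_of_sylow_le hPb)
    exact Ce_eq_of_index hc hcop (by rw [h2, h3]) (by rw [h2, h4])
  have K0 : ∀ y : G, PP p y → y ∉ Subgroup.center G → (Ce y).index = m → ∃ g, Ce (g * w * g⁻¹) = Ce y := by
    intro y hy hyZ hyi
    obtain ⟨P, -, hPy⟩ := exists_sylow_le (p := p) (Ce y) ⊥ IsPGroup.of_bot bot_le (by rwa [hyi])
    obtain ⟨g, hg1, hg2⟩ := hP P
    refine ⟨g, key _ _ (hwp.conj g) hy (mem_Ce.1 (hPy hg2)) (by rwa [conj_mem_center]) hyZ P hg1 hPy⟩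
  have K1 : ∀ y : G, PE p y → y ∉ Subgroup.center G → (Ce y).index = m → ∃ g, Ce (g * w * g⁻¹) = Ce y := by
    intro y hy hyZ hyi
    obtain ⟨y1, hy1, hy1Z, hy1i⟩ := h.R2 hp
    obtain ⟨g, hg⟩ := K0 y1 hy1 hy1Z hy1i
    have e2 := Ce_conj_congr (g := g⁻¹) hg
    have e3 : g⁻¹ * (g * w * g⁻¹) * g⁻¹⁻¹ = w := by group
    rw [e3] at e2
    obtain ⟨P, hyP, hPy⟩ := exists_sylow_le (p := p) (Ce y) (Subgroup.zpowers y) hy.pgroup (by simpa using self_mem_Ce y) (by rwa [hyi])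
    have hyP' : y ∈ (P : Subgroup G) := hyP (Subgroup.mem_zpowers y)
    obtain ⟨c, hc⟩ := sylow_conj T P
    have hy' := (hc y).1 hyP'
    have hTy : (T : Subgroup G) ≤ Ce (c * y * c⁻¹) := by
      intro t ht
      have e4 : t = c * (c⁻¹ * t * c) * c⁻¹ := by group
      rw [e4] at ht ⊢
      exact conj_mem_Ce.2 (hPy ((hc _).2 ht))
    have h5 := key _ _ (hy.conj c) (hy1.conj g⁻¹) (mem_Ce.1 (e2 ▸ hTw hy')) (by rwa [conj_mem_center])
      (by rwa [conj_mem_center]) T hTy (e2 ▸ hTw)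
    refine ⟨c⁻¹, ?_⟩
    rw [← e2] at h5
    rw [← Ce_conj_congr h5]
    congr 2; group
  have K : ∀ y : G, y ∉ Subgroup.center G → (Ce y).index = m → ∃ g, Ce (g * w * g⁻¹) = Ce y := by
    intro y hyZ hyi
    obtain ⟨q, hq, i, hi, hiZ⟩ := exists_primary (Subgroup.center G) y hyZ
    obtain ⟨h1, h2⟩ := h.pow_index hmn hyi i hiZ
    rw [h2]
    by_cases hqp : q = p
    · exact K1 _ (hqp ▸ hi) hiZ h1
    · exact K0 _ (hi.pp hq hp hqp) hiZ h1
  have good : ∀ x v : G, v ∉ Subgroup.center G → (Ce v).index = m → x ∈ Ce v → ∃ g, g * x * g⁻¹ ∈ Ce w := by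
    intro x v hv hvi hx
    obtain ⟨g, hg⟩ := K v hv hvi
    rw [← hg] at hx
    refine ⟨g⁻¹, ?_⟩
    have h2 := (conj_mem_Ce (c := g⁻¹)).2 hx
    convert h2 using 2
    group
  obtain ⟨g0, hg0⟩ := K y0 hy0 hy0i
  have hnu : ∀ x : G, (Ce x).index = n → ∃ u ∈ Ce x, PE p u ∧ u ∉ Subgroup.center G := by
    intro x hx
    have h1 : p ∣ (Subgroup.center G).relIndex (Ce x0) := by
      refine dvd_relIndex_of_PE hp _ _ (g := g0 * w * g0⁻¹) ?_ (hwp.conj g0) (by rwa [conj_mem_center])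
      rw [mem_Ce_comm, hg0]
      exact hxy (self_mem_Ce x0)
    have e1 := Subgroup.relIndex_mul_index (center_le_Ce x)
    have e2 := Subgroup.relIndex_mul_index (center_le_Ce x0)
    rw [hx, ← e2, hx0i] at e1
    rw [← Nat.eq_of_mul_eq_mul_right (Nat.pos_of_ne_zero (hx0i ▸ index_ne_zero' _)) e1] at h1
    exact exists_PE_of_dvd hp _ _ h1
  have hcov : Ce w = ⊤ := by
    apply cover_one
    intro x
    by_cases hxZ : x ∈ Subgroup.center G
    · exact ⟨1, by simpa using center_le_Ce _ hxZ⟩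
    rcases h.two x hxZ with hxi | hxi
    · exact good x x hxZ hxi (self_mem_Ce x)
    obtain ⟨u, hux, hu, huZ⟩ := hnu x hxi
    rcases h.two u huZ with hui | hui
    · exact good x u huZ hui (mem_Ce_comm.1 hux)
    obtain ⟨P, huP⟩ := PE_exists_sylow hu
    obtain ⟨g, hg1, hg2⟩ := hP P
    obtain ⟨i, j, hi, hj, hij⟩ := decomp hp x
    by_cases ha : x ^ j ∈ Subgroup.center G
    · have hb : x ^ i ∉ Subgroup.center G := fun hb => hxZ (hij ▸ mul_mem hb ha)
      obtain ⟨P', hP'⟩ := PE_exists_sylow hi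
      obtain ⟨g', hg1', hg2'⟩ := hP P'
      refine good x (g' * w * g'⁻¹) (by rwa [conj_mem_center]) (by rw [index_Ce_conj, hwi]) ?_
      rw [hij]
      exact mul_mem (hg1' hP') (center_le_Ce _ ha)
    · rcases h.two _ ha with hai | hai
      · exact good x _ ha hai (mem_Ce_comm.1 (pow_mem_Ce x j))
      have hau : u * x ^ j = x ^ j * u := by
        have : Commute u x := mem_Ce.1 hux
        exact this.pow_right j
      have hcop := hu.coprime hp hj
      have h1 : (Ce (u * x ^ j)).index ≤ n := by
        rcases h.two _ (mul_not_center_left hau hcop huZ) with e | e <;> omega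
      have h2 := Ce_eq_of_index hau hcop (by rwa [hui]) (by rwa [hai])
      have h3 : Ce x = Ce (x ^ j) := eq_of_le_index (Ce_pow x j) (by rw [hxi, hai])
      refine good x (g * w * g⁻¹) (by rwa [conj_mem_center]) (by rw [index_Ce_conj, hwi]) ?_
      rw [mem_Ce_comm, h3, ← h2, mem_Ce_comm]
      exact hg1 huP
  exact hwZ (Ce_eq_top.1 hcov)
end I
end CS

namespace CS
section I
variable {G : Type*} [Group G] [Finite G]

def NE (v : ℕ) (x : G) : Prop := ∃ a ∈ Ce x, PE v a ∧ a ∉ Subgroup.center G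

lemma NE_iff {v : ℕ} (hv : v.Prime) {x : G} : NE v x ↔ v ∣ (Subgroup.center G).relIndex (Ce x) := by
  constructor
  · rintro ⟨a, h1, h2, h3⟩
    exact dvd_relIndex_of_PE hv _ _ h1 h2 h3
  · exact exists_PE_of_dvd hv _ _

lemma nu_eq {x y : G} (h : (Ce x).index = (Ce y).index) :
    (Subgroup.center G).relIndex (Ce x) = (Subgroup.center G).relIndex (Ce y) := by
  have e1 := Subgroup.relIndex_mul_index (center_le_Ce x)
  have e2 := Subgroup.relIndex_mul_index (center_le_Ce y)
  rw [h, ← e2] at e1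
  exact Nat.eq_of_mul_eq_mul_right (Nat.pos_of_ne_zero (index_ne_zero' _)) e1

lemma nu_mul {m k : ℕ} {x y : G} (hx : (Ce x).index = m * k) (hy : (Ce y).index = m) :
    (Subgroup.center G).relIndex (Ce y) = k * (Subgroup.center G).relIndex (Ce x) := by
  have e1 := Subgroup.relIndex_mul_index (center_le_Ce x)
  have e2 := Subgroup.relIndex_mul_index (center_le_Ce y)
  have hm : 0 < m := Nat.pos_of_ne_zero (hy ▸ index_ne_zero' _)
  rw [hx, ← e2, hy] at e1
  apply Nat.eq_of_mul_eq_mul_right hm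
  rw [← e1]; ring

structure IK (m k : ℕ) (G : Type*) [Group G] : Prop where
  ih : IH m (m * k) G
  k1 : 1 < k
  sz : ∀ t : ℕ, t.Prime → SylZ t G

variable {m k : ℕ}

lemma IK.lt (h : IK m k G) : m < m * k := by
  obtain ⟨x, -, -, hx⟩ := h.ih.R2 Nat.prime_two
  have : 0 < m := Nat.pos_of_ne_zero (hx ▸ index_ne_zero' _)
  have := h.k1
  nlinarith

/-- product of commuting coprime elements, one of index `m*k` -/
lemma IK.le_of_n (h : IK m k G) {a b : G} (hc : a * b = b * a) (hcop : (orderOf a).Coprime (orderOf b))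
    (haZ : a ∉ Subgroup.center G) (hn : (Ce a).index = m * k) : Ce a ≤ Ce b := by
  apply Ce_le_of_index hc hcop
  have := h.lt
  rcases h.ih.two _ (mul_not_center_left hc hcop haZ) with e | e <;> omega

lemma inf_index (a b : G) : (Ce a ⊓ Ce b).index = (Ce a).relIndex (Ce b) * (Ce b).index := by
  rw [← Subgroup.inf_relIndex_right, Subgroup.relIndex_mul_index inf_le_right]

lemma IK.LHy (h : IK m k G) {v : ℕ} (hv : v.Prime) {y : G} (hy : PE v y) (hyZ : y ∉ Subgroup.center G) (hyi : (Ce y).index = m) :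
    LH v k (Ce y) := by
  intro x hx hxZ
  have hcop := hy.coprime hv (PP.coe.2 hx)
  have hc : y * (x : G) = x * y := (mem_Ce.1 x.2).symm
  have e1 := Ce_mul hc hcop
  rw [Ce_subgroup]
  change (Ce (x : G)).relIndex (Ce y) = k
  have e2 := inf_index (x : G) y
  rw [inf_comm, ← e1, hyi] at e2
  have hm : 0 < m := Nat.pos_of_ne_zero (hyi ▸ index_ne_zero' _)
  rcases h.ih.two _ (mul_not_center_left hc hcop hyZ) with e | e
  · exfalso
    have h1 : Ce y ≤ Ce (x : G) := Ce_le_of_index hc hcop (by rw [e, hyi])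
    apply hxZ
    rw [Subgroup.mem_center_iff]
    intro g
    exact Subtype.ext (mem_Ce.1 (h1 g.2))
  · rw [e, mul_comm] at e2
    exact (Nat.eq_of_mul_eq_mul_right hm e2).symm

def TA (v : ℕ) (y : G) : Prop := ∃ x ∈ Ce y, PP v x ∧ ¬ Ce y ≤ Ce x

lemma not_center_of {y x : G} (hx : x ∈ Ce y) (h : ¬ Ce y ≤ Ce x) : (⟨x, hx⟩ : Ce y) ∉ Subgroup.center (Ce y) := by
  intro h1
  apply h
  intro g hg
  have := Subgroup.mem_center_iff.1 h1 ⟨g, hg⟩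
  exact mem_Ce.2 (congrArg Subtype.val this)

lemma IK.L1 (h : IK m k G) {v : ℕ} (hv : v.Prime) {y : G} (hy : PE v y) (hyZ : y ∉ Subgroup.center G) (hyi : (Ce y).index = m)
    (ht : TA v y) : ∃ q : ℕ, q.Prime ∧ q ≠ v ∧ ∀ r : ℕ, r.Prime → r ∣ k → r = v ∨ r = q := by
  obtain ⟨x, hx, hxp, hxy⟩ := ht
  exact thmL1 hv (h.LHy hv hy hyZ hyi) ⟨⟨x, hx⟩, PP.coe.1 hxp, not_center_of hx hxy⟩

lemma IK.step1 (h : IK m k G) : ∃ v : ℕ, v.Prime ∧ ∃ y : G, PE v y ∧ y ∉ Subgroup.center G ∧ (Ce y).index = m ∧ TA v y := by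
  by_contra hcon
  have hno : ∀ v : ℕ, v.Prime → ∀ y : G, PE v y → y ∉ Subgroup.center G → (Ce y).index = m → ∀ x ∈ Ce y, PP v x → Ce y ≤ Ce x := by
    intro v hv y hy hyZ hyi x hx hxp
    by_contra h1
    exact hcon ⟨v, hv, y, hy, hyZ, hyi, x, hx, hxp, h1⟩
  obtain ⟨x, -, hxZ, -⟩ := h.ih.R2 Nat.prime_two
  obtain ⟨t, ht, i, hi, hiZ⟩ := exists_primary _ x hxZ
  obtain ⟨w, hwZ, hw⟩ := exists_Wt ht hi hiZ
  obtain ⟨s, hs, hst, a, ha⟩ := h.ih.R1 ht hwZ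
  refine AT' ht hs hst (h.sz t ht) hw ⟨a, ha⟩ ?_ (h.sz s hs)
  intro a ha has haZ
  have hcop := hw.pe.coprime ht (has.pp hs ht hst)
  have hc : w * a = a * w := (mem_Ce.1 ha).symm
  rcases h.ih.two w hwZ with hwi | hwi
  · have h1 := hno t ht w hw.pe hwZ hwi a ha (has.pp hs ht hst)
    have h2 := index_dvd_of_Ce_le h1
    rw [hwi] at h2
    have hm : 0 < m := Nat.pos_of_ne_zero (hwi ▸ index_ne_zero' _)
    have h3 := Nat.le_of_dvd hm h2
    have h4 : (Ce a).index = m := by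
      have := h.lt
      rcases h.ih.two a haZ with e | e <;> omega
    exact (eq_of_le_index h1 (by rw [hwi, h4])).symm
  · have h1 := h.le_of_n hc hcop hwZ hwi
    rcases h.ih.two a haZ with e | e
    · exact le_antisymm (hno s hs a has haZ e w (mem_Ce_comm.1 ha) (hw.pe.pp ht hs hst.symm)) h1
    · exact (eq_of_le_index h1 (by rw [hwi, e])).symm

lemma IK.step2a (h : IK m k G) {u u' : ℕ} (hu : u.Prime) (hu' : u'.Prime) (hne : u ≠ u') (huk : ¬ u ∣ k) (huk' : ¬ u' ∣ k) {e a : G}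
    (he : PE u e) (ha : PE u' a) (haZ : a ∉ Subgroup.center G) (hc : e * a = a * e) : Ce a ≤ Ce e := by
  have hcop := ha.coprime hu' (he.pp hu hu' hne)
  rcases h.ih.two a haZ with hai | hai
  · have hL := h.LHy hu' ha haZ hai
    have hnd : ∀ r : ℕ, r.Prime → ¬ r ∣ k → ∀ x : Ce a, PP u' x → ¬ r ∣ (Ce x).index := by
      intro r hr hrk x hx hd
      by_cases hxZ : x ∈ Subgroup.center (Ce a)
      · rw [Ce_eq_top.2 hxZ, Subgroup.index_top] at hd
        exact hr.one_lt.ne' (Nat.dvd_one.1 hd)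
      · exact hrk (hL x hx hxZ ▸ hd)
    have hcom := commute_of_pp hu' (hnd u' hu' huk')
    have hcen : (⟨e, mem_Ce.2 hc⟩ : Ce a) ∈ Subgroup.center (Ce a) := by
      refine central_of_not_dvd hu ?_ _ (PE.coe.1 he)
      intro x hd
      obtain ⟨i, j, hi, hj, hij⟩ := decomp hu' x
      haveI := Fact.mk hu
      obtain ⟨P, -, hP⟩ := exists_sylow_le (p := u) (Ce (x ^ j)) ⊥ IsPGroup.of_bot bot_le (hnd u hu huk _ hj)
      refine not_dvd_of_sylow_le (S := P) (E := Ce x) ?_ hd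
      intro y hy
      have h1 := hcom y (x ^ i) ((PE_of_mem_pgroup P.2 hy).pp hu hu' hne) hi
      rw [mem_Ce_comm, hij]
      exact mul_mem (mem_Ce.2 h1.symm) (mem_Ce_comm.1 (hP hy))
    intro g hg
    exact mem_Ce.2 (congrArg Subtype.val (Subgroup.mem_center_iff.1 hcen ⟨g, hg⟩))
  · exact h.le_of_n hc.symm hcop haZ hai

lemma IK.NE_of_not_dvd (h : IK m k G) {u : ℕ} (hu : u.Prime) (huZ : u ∣ (Subgroup.center G).index) (huk : ¬ u ∣ k) {x : G}
    (hx : x ∉ Subgroup.center G) : NE u x := by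
  obtain ⟨b, hb, hbZ⟩ := exists_PE_of_dvd_index hu huZ
  have h1 : NE u b := ⟨b, self_mem_Ce b, hb, hbZ⟩
  rw [NE_iff hu] at h1 ⊢
  rcases h.ih.two b hbZ with e1 | e1 <;> rcases h.ih.two x hx with e2 | e2
  · rwa [nu_eq (e2.trans e1.symm)]
  · rw [nu_mul e2 e1] at h1
    exact (hu.dvd_mul.1 h1).resolve_left huk
  · rw [nu_mul e1 e2]; exact h1.mul_left k
  · rwa [nu_eq (e2.trans e1.symm)]

lemma IK.step2 (h : IK m k G) {u u' : ℕ} (hu : u.Prime) (hu' : u'.Prime) (hne : u ≠ u') (huk : ¬ u ∣ k) (huk' : ¬ u' ∣ k)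
    (huZ : u ∣ (Subgroup.center G).index) (huZ' : u' ∣ (Subgroup.center G).index) : False := by
  obtain ⟨x, hx, hxZ⟩ := exists_PE_of_dvd_index hu huZ
  obtain ⟨w, hwZ, hw⟩ := exists_Wt hu hx hxZ
  refine AT' hu hu' hne.symm (h.sz u hu) hw (h.NE_of_not_dvd hu' huZ' huk' hwZ) ?_ (h.sz u' hu')
  intro a ha hap haZ
  have hc := mem_Ce.1 ha
  exact le_antisymm (h.step2a hu hu' hne huk huk' hw.pe hap haZ hc.symm) (h.step2a hu' hu hne.symm huk' huk hap hw.pe hwZ hc)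

/-- L2 translated -/
lemma IK.L2 (h : IK m k G) {v v' u : ℕ} (hv : v.Prime) (hv' : v'.Prime) (hvv : v' ≠ v) (hvk : v' ∣ k) (hu : u.Prime) (huv : u ≠ v)
    (huv' : u ≠ v') {w a : G} (hw : PE u w) (ha : PE v a) (haZ : a ∉ Subgroup.center G) (hai : (Ce a).index = m)
    (hle : Ce w ≤ Ce a) (hne : Ce a ≠ Ce w) : ∃ j, j ≠ 0 ∧ (Ce w).relIndex (Nr (Ce w) ⊓ Ce a) = v' ^ j := by
  have hwa : w ∈ Ce a := hle (self_mem_Ce w)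
  obtain ⟨j, hj, hj2⟩ := thmL2 (w := (⟨w, hwa⟩ : Ce a)) hv (h.LHy hv ha haZ hai) hv' hvv hvk hu huv huv' (PE.coe.1 hw)
    (not_center_of hwa fun h1 => hne (le_antisymm h1 hle))
  refine ⟨j, hj, ?_⟩
  rw [← hj2, Ce_subgroup]
  change _ = ((Ce w).subgroupOf (Ce a)).relIndex (Nr ((Ce w).subgroupOf (Ce a)))
  have e1 : Nr ((Ce w).subgroupOf (Ce a)) = (Nr (Ce w) ⊓ Ce a).subgroupOf (Ce a) := by
    rw [Subgroup.inf_subgroupOf_right]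
    exact (Subgroup.subgroupOf_normalizer_eq hle).symm
  rw [e1, Subgroup.relIndex_subgroupOf inf_le_right]

theorem caseII (h : IK m k G) : False := by
  obtain ⟨s, hs, y, hy, hyZ, hyi, hTA⟩ := h.step1
  obtain ⟨q, hq, hqs, hkp⟩ := h.L1 hs hy hyZ hyi hTA
  obtain ⟨u, hu, huZ, hus, huq⟩ : ∃ u : ℕ, u.Prime ∧ u ∣ (Subgroup.center G).index ∧ u ≠ s ∧ u ≠ q := by
    by_contra hcon
    push Not at hcon
    apply h.ih.ns
    apply solvable_of_two_primes hs hq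
    intro v hv hvZ
    by_cases hvs : v = s
    · exact Or.inl hvs
    · exact Or.inr (hcon v hv hvZ hvs)
  have huk : ¬ u ∣ k := fun h1 => (hkp u hu h1).elim hus huq
  have hpi : ∀ v : ℕ, v.Prime → v ∣ (Subgroup.center G).index → v = u ∨ (v ∣ k ∧ (v = s ∨ v = q)) := by
    intro v hv hvZ
    by_cases hvu : v = u
    · exact Or.inl hvu
    · right
      have h1 : v ∣ k := by
        by_contra h1
        exact h.step2 hv hu hvu h1 huk hvZ huZ
      exact ⟨h1, hkp v hv h1⟩
  have hsk : s ∣ k := by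
    by_contra hsk
    apply h.ih.ns
    apply solvable_of_two_primes hu hq
    intro v hv hvZ
    rcases hpi v hv hvZ with h1 | ⟨h1, h2 | h2⟩
    · exact Or.inl h1
    · exact (hsk (h2 ▸ h1)).elim
    · exact Or.inr h2
  have hqk : q ∣ k := by
    by_contra hqk
    apply h.ih.ns
    apply solvable_of_two_primes hu hs
    intro v hv hvZ
    rcases hpi v hv hvZ with h1 | ⟨h1, h2 | h2⟩
    · exact Or.inl h1
    · exact Or.inr h2
    · exact (hqk (h2 ▸ h1)).elim
  obtain ⟨x, hx, hxZ⟩ := exists_PE_of_dvd_index hu huZ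
  obtain ⟨w, hwZ, hw⟩ := exists_Wt hu hx hxZ
  have hcen : ∀ v : ℕ, v.Prime → v ≠ u → ∀ a ∈ Ce w, PE v a → Ce w ≤ Ce a := by
    intro v hv hvu a ha hap
    rcases h.ih.two w hwZ with hwi | hwi
    · by_contra hcon
      obtain ⟨q', hq', hq'u, hk'⟩ := h.L1 hu hw.pe hwZ hwi ⟨a, ha, hap.pp hv hu hvu, hcon⟩
      have e1 := (hk' s hs hsk).resolve_left hus.symm
      have e2 := (hk' q hq hqk).resolve_left huq.symm
      exact hqs (e2.trans e1.symm)
    · exact h.le_of_n (mem_Ce.1 ha).symm (hw.pe.coprime hu (hap.pp hv hu hvu)) hwZ hwi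
  have hlt := h.lt
  -- not all v-elements have the same centralizer
  have hAT : ∀ v : ℕ, v.Prime → v ≠ u → NE v w → ∃ a ∈ Ce w, PE v a ∧ a ∉ Subgroup.center G ∧ Ce a ≠ Ce w := by
    intro v hv hvu hN
    by_contra hcon
    push Not at hcon
    exact AT' hu hv hvu (h.sz u hu) hw hN hcon (h.sz v hv)
  have hmne : ∀ v : ℕ, v.Prime → v ≠ u → ∀ a ∈ Ce w, PE v a → a ∉ Subgroup.center G → Ce a ≠ Ce w →
      (Ce w).index = m * k ∧ (Ce a).index = m := by
    intro v hv hvu a ha hap haZ hne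
    have h1 := hcen v hv hvu a ha hap
    have h2 : (Ce w).index ≠ (Ce a).index := fun e => hne (eq_of_le_index h1 e.le).symm
    have h3 := Nat.le_of_dvd (Nat.pos_of_ne_zero (index_ne_zero' _)) (index_dvd_of_Ce_le h1)
    have h4 := h.ih.two w hwZ
    have h5 := h.ih.two a haZ
    omega
  obtain ⟨v0, hv0, hv0u, hN0⟩ := h.ih.R1 hu hwZ
  obtain ⟨a0, ha0, ha0p, ha0Z, ha0ne⟩ := hAT v0 hv0 hv0u hN0
  obtain ⟨hwi, ha0i⟩ := hmne v0 hv0 hv0u a0 ha0 ha0p ha0Z ha0ne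
  have hv0' := (hpi v0 hv0 (dvd_index_of_PE hv0 ha0p ha0Z)).resolve_left hv0u
  have hNE : ∀ v : ℕ, v.Prime → v ∣ k → NE v w := by
    intro v hv hvk
    by_cases hvv : v = v0
    · exact hvv ▸ hN0
    have h1 : NE v a0 := by
      rw [NE_iff hv, nu_mul hwi ha0i]
      exact hvk.mul_right _
    obtain ⟨b, hb, hbp, hbZ⟩ := h1
    have tr : ∀ x : G, (Ce x).index = m * k → b ∈ Ce x → NE v w := by
      intro x hx hbx
      have : NE v x := ⟨b, hbx, hbp, hbZ⟩
      rw [NE_iff hv] at this ⊢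
      rwa [nu_eq (hwi.trans hx.symm)]
    have hc := mem_Ce.1 hb
    have hcop := hbp.coprime hv (ha0p.pp hv0 hv (Ne.symm hvv))
    rcases h.ih.two b hbZ with e1 | e1
    · rcases h.ih.two _ (mul_not_center_left hc hcop hbZ) with e2 | e2
      · have e3 := Ce_eq_of_index hc hcop (by rw [e1, e2]) (by rw [ha0i, e2])
        refine ⟨b, ?_, hbp, hbZ⟩
        rw [mem_Ce_comm, e3, mem_Ce_comm]
        exact ha0
      · refine tr _ e2 ?_
        rw [mem_Ce_comm]
        exact mul_mem (self_mem_Ce b) (mem_Ce_comm.1 hb)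
    · exact tr b e1 (self_mem_Ce b)
  have hrel : ∀ v v' : ℕ, v.Prime → v'.Prime → v ≠ u → v' ≠ u → v' ≠ v → v' ∣ k → ∀ a ∈ Ce w, PE v a → a ∉ Subgroup.center G →
      ∃ j, (Ce w).relIndex (Nr (Ce w) ⊓ Ce a) = v' ^ j ∧ (Ce a ≠ Ce w → j ≠ 0) := by
    intro v v' hv hv' hvu hv'u hvv hvk a ha hap haZ
    by_cases hne : Ce a = Ce w
    · refine ⟨0, ?_, fun h1 => (h1 hne).elim⟩
      rw [hne, pow_zero, Subgroup.relIndex_eq_one]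
      exact inf_le_right
    · obtain ⟨j, hj, hj2⟩ := h.L2 hv hv' hvv hvk hu hvu.symm hv'u.symm hw.pe hap haZ (hmne v hv hvu a ha hap haZ hne).2
        (hcen v hv hvu a ha hap) hne
      exact ⟨j, hj2, fun _ => hj⟩
  have hSG : ∃ j, (Ce w).relIndex (Nr (Ce w)) = u ^ j := by
    apply SG hu (h.sz u hu) hw
    intro r hr hru hrd
    obtain ⟨v, v', hv, hv', hvu, hv'u, hvv, hvk, hvk', hrv⟩ : ∃ v v' : ℕ, v.Prime ∧ v'.Prime ∧ v ≠ u ∧ v' ≠ u ∧ v' ≠ v ∧ v ∣ k ∧ v' ∣ k ∧ r ≠ v' := by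
      by_cases hrq : r = q
      · exact ⟨q, s, hq, hs, huq.symm, hus.symm, hqs.symm, hqk, hsk, hrq ▸ hqs⟩
      · exact ⟨s, q, hs, hq, hus.symm, huq.symm, hqs, hsk, hqk, hrq⟩
    refine ⟨v, hv, hvu, ?_, ?_⟩
    · obtain ⟨a, ha, hap, haZ⟩ := hNE v hv hvk
      refine ⟨a, ?_, hap, haZ⟩
      rw [Subgroup.mem_centralizer_iff]
      intro g hg
      exact mem_Ce.1 (hcen v hv hvu a ha hap hg)
    · intro a ha hap haZ
      obtain ⟨j, hj, -⟩ := hrel v v' hv hv' hvu hv'u hvv hvk' a (centralizer_Ce_le w ha) hap haZ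
      rw [hj]
      exact ⟨fun h1 => hrv ((Nat.prime_dvd_prime_iff_eq hr hv').1 (hr.dvd_of_dvd_pow h1)),
        fun h1 => hv'u ((Nat.prime_dvd_prime_iff_eq hu hv').1 (hu.dvd_of_dvd_pow h1)).symm⟩
  obtain ⟨i, hi⟩ := hSG
  obtain ⟨v', hv', hv'u, hvv, hvk⟩ : ∃ v' : ℕ, v'.Prime ∧ v' ≠ u ∧ v' ≠ v0 ∧ v' ∣ k := by
    rcases hv0'.2 with e | e
    · exact ⟨q, hq, huq.symm, e ▸ hqs, hqk⟩
    · exact ⟨s, hs, hus.symm, e ▸ hqs.symm, hsk⟩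
  obtain ⟨j, hj, hj0⟩ := hrel v0 v' hv0 hv' hv0u hv'u hvv hvk a0 ha0 ha0p ha0Z
  have hd : (Ce w).relIndex (Nr (Ce w) ⊓ Ce a0) ∣ (Ce w).relIndex (Nr (Ce w)) := by
    have hle : Ce w ≤ Nr (Ce w) ⊓ Ce a0 := le_inf Subgroup.le_normalizer (hcen v0 hv0 hv0u a0 ha0 ha0p)
    exact ⟨_, (Subgroup.relIndex_mul_relIndex _ _ _ hle inf_le_left).symm⟩
  rw [hj, hi] at hd
  exact hv'u ((Nat.prime_dvd_prime_iff_eq hv' hu).1 (hv'.dvd_of_dvd_pow ((dvd_pow_self v' (hj0 ha0ne)).trans hd)))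

theorem Ito {m n : ℕ} (h : ∀ x : G, x ∉ Subgroup.center G → (Ce x).index = m ∨ (Ce x).index = n) : Group.IsSolvable G := by
  by_contra hns
  have key : ∀ m n : ℕ, IH m n G → ∀ x y : G, x ∉ Subgroup.center G → y ∉ Subgroup.center G → Ce x ≤ Ce y → Ce x ≠ Ce y →
      (Ce y).index = m → (Ce x).index = n → False := by
    intro m n hI x y hx hy hle hne hym hxn
    have hd : m ∣ n := hym ▸ hxn ▸ index_dvd_of_Ce_le hle
    have hmn : m < n := by
      refine lt_of_le_of_ne (Nat.le_of_dvd (Nat.pos_of_ne_zero (hxn ▸ index_ne_zero' _)) hd) fun e => ?_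
      exact hne (eq_of_le_index hle (by rw [hxn, hym, e]))
    by_cases hS : ∀ t : ℕ, t.Prime → SylZ t G
    · obtain ⟨k, rfl⟩ := hd
      refine caseII (m := m) (k := k) (G := G) ⟨hI, ?_, hS⟩
      by_contra hk
      have : k = 0 ∨ k = 1 := by omega
      rcases this with rfl | rfl <;> simp at hmn
    · push Not at hS
      obtain ⟨t, ht, hSt⟩ := hS
      exact caseI hI hd hmn hx hle hxn hy hym ht hSt
  have hI : IH m n G := ⟨h, hns⟩
  refine F_case hI fun x y hx hy hle => ?_
  by_contra hne
  have h1 : (Ce x).index ≠ (Ce y).index := fun e => hne (eq_of_le_index hle e.le)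
  rcases h x hx with e1 | e1 <;> rcases h y hy with e2 | e2
  · exact h1 (e1.trans e2.symm)
  · exact key n m hI.symm x y hx hy hle hne e2 e1
  · exact key m n hI x y hx hy hle hne e2 e1
  · exact h1 (e1.trans e2.symm)
end I
end CS

namespace CS
section X
variable {G : Type*} [Group G] [Finite G]

lemma relIndex_eq_of_coprime (A B : Subgroup G) (h : A.index.Coprime B.index) : A.relIndex B = A.index := by
  have e1 : (A ⊓ B).index = A.relIndex B * B.index := by
    rw [← Subgroup.inf_relIndex_right, Subgroup.relIndex_mul_index inf_le_right]
  have h1 : A.index ∣ A.relIndex B * B.index := e1 ▸ Subgroup.index_dvd_of_le inf_le_left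
  have h2 := h.dvd_of_dvd_mul_right h1
  have h3 := Subgroup.relIndex_dvd_index_of_le (le_refl A)
  have h4 : A.relIndex B * B.index ≤ A.index * B.index := e1 ▸ Subgroup.index_inf_le
  have h5 := Nat.le_of_mul_le_mul_right h4 (Nat.pos_of_ne_zero (index_ne_zero' B))
  exact le_antisymm h5 (Nat.le_of_dvd (Nat.pos_of_ne_zero (index_ne_zero' _)) h2)

lemma fact_of_coprime (A B : Subgroup G) (h : A.index.Coprime B.index) (g : G) : ∃ a ∈ A, ∃ b ∈ B, g = a * b := by
  have h1 := relIndex_eq_of_coprime A B h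
  let f : B ⧸ A.subgroupOf B → G ⧸ A := Quotient.map' Subtype.val (by
    intro a b hab
    rw [QuotientGroup.leftRel_apply] at hab ⊢
    exact hab)
  have hf : Function.Injective f := by
    intro a b
    induction a using Quotient.inductionOn'
    induction b using Quotient.inductionOn'
    intro hab
    have := Quotient.exact' hab
    apply Quotient.sound'
    rw [QuotientGroup.leftRel_apply] at this ⊢
    exact this
  have hb : Function.Bijective f := (Nat.bijective_iff_injective_and_card f).2 ⟨hf, h1⟩
  obtain ⟨b, hb⟩ := hb.2 ((g⁻¹ : G) : G ⧸ A)
  induction b using Quotient.inductionOn' with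
  | h b =>
    have := Quotient.exact' hb
    rw [QuotientGroup.leftRel_apply] at this
    refine ⟨((b : G)⁻¹ * g⁻¹)⁻¹, inv_mem this, (b : G)⁻¹, inv_mem b.2, by group⟩

lemma not_center_of_index {x : G} (h : (Ce x).index ≠ 1) : x ∉ Subgroup.center G := by
  intro h1
  rw [Ce_eq_top.2 h1, Subgroup.index_top] at h
  exact h rfl

lemma K0 {i j : ℕ} (hi : i.Prime) (hj : j.Prime) (hij : i < j) {x y : G} (hx : (Ce x).index = i) (hy : (Ce y).index = j)
    (hno : ∀ g : G, (Ce g).index ≠ i * j) : (Ce (x * y)).index = j := by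
  have hcop : (Ce x).index.Coprime (Ce y).index := by rw [hx, hy]; exact (Nat.coprime_primes hi hj).2 hij.ne
  have e1 : (Ce x ⊓ Ce y).index = i * j := by
    rw [inf_index, relIndex_eq_of_coprime _ _ hcop, hx, hy]
  have hle : Ce x ⊓ Ce y ≤ Ce (x * y) := by
    rintro g ⟨h1, h2⟩
    rw [mem_Ce_comm]
    exact mul_mem (mem_Ce_comm.1 h1) (mem_Ce_comm.1 h2)
  have hd : (Ce (x * y)).index ∣ i * j := e1 ▸ Subgroup.index_dvd_of_le hle
  have hle2 : Ce x ⊓ Ce (x * y) ≤ Ce x ⊓ Ce y := by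
    rintro g ⟨h1, h2⟩
    refine ⟨h1, ?_⟩
    have e : y = x⁻¹ * (x * y) := by group
    show g ∈ Ce y
    rw [mem_Ce_comm, e]
    exact mul_mem (inv_mem (mem_Ce_comm.1 h1)) (mem_Ce_comm.1 h2)
  have h3 : i * j ≤ i * (Ce (x * y)).index := by
    rw [← e1, ← hx]
    refine le_trans (Nat.le_of_dvd (Nat.pos_of_ne_zero (index_ne_zero' _)) (Subgroup.index_dvd_of_le hle2)) Subgroup.index_inf_le
  have h4 := Nat.le_of_mul_le_mul_left h3 hi.pos
  obtain ⟨c, d, hc, hd2, hcd⟩ := (Nat.dvd_mul).1 hd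
  rcases (Nat.dvd_prime hi).1 hc with rfl | rfl <;> rcases (Nat.dvd_prime hj).1 hd2 with rfl | rfl
  · rw [← hcd] at h4; have := hj.two_le; omega
  · rw [← hcd, one_mul]
  · rw [← hcd] at h4; omega
  · exact (hno _ hcd.symm).elim

structure KN (j : ℕ) (x : G) (N : Subgroup G) : Prop where
  nor : N.Normal
  card : Nat.card N = j
  com : ∀ g : G, x⁻¹ * (g * x * g⁻¹) ∈ N
  pe : ∀ n ∈ N, PE j n
  der : ∀ n ∈ N, ∀ g h : G, (h * g)⁻¹ * (g * h) ∈ Ce n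
  le : ∀ n ∈ N, n ≠ 1 → Ce n ≤ Ce x

open Pointwise in
lemma lemK {i j : ℕ} (hi : i.Prime) (hj : j.Prime) (hij : i < j) {x y : G} (hx : (Ce x).index = i) (hy : (Ce y).index = j)
    (hno : ∀ g : G, (Ce g).index ≠ i * j) : ∃ N : Subgroup G, KN j x N := by
  have hxy := K0 hi hj hij hx hy hno
  let B : Set G := {b | IsConj y b}
  let D : Set G := {b | IsConj (x * y) b}
  have hB : B.ncard = j := by rw [← hy, index_centralizer]; rfl
  have hD : D.ncard = j := by rw [← hxy, index_centralizer]; rfl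
  have hcop : (Ce x).index.Coprime (Ce y).index := by rw [hx, hy]; exact (Nat.coprime_primes hi hj).2 hij.ne
  have hBc : ∀ b g : G, b ∈ B → g * b * g⁻¹ ∈ B := by
    intro b g hb
    exact IsConj.trans hb (isConj_iff.2 ⟨g, rfl⟩)
  have hAB : ∀ g : G, (g * x * g⁻¹) • B = D := by
    intro g
    refine Set.eq_of_subset_of_ncard_le ?_ ?_ (Set.toFinite D)
    · rintro _ ⟨b, hb, rfl⟩
      obtain ⟨h, rfl⟩ := isConj_iff.1 hb
      obtain ⟨c, hc, d, hd, hcd⟩ := fact_of_coprime (Ce x) (Ce y) hcop (g⁻¹ * h)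
      refine isConj_iff.2 ⟨g * c, ?_⟩
      have hh : h = g * (c * d) := by rw [← hcd]; group
      have e1 : c * x * c⁻¹ = x := by rw [mem_Ce.1 hc]; group
      have e2 : d * y * d⁻¹ = y := by rw [mem_Ce.1 hd]; group
      show g * c * (x * y) * (g * c)⁻¹ = g * x * g⁻¹ * (h * y * h⁻¹)
      calc g * c * (x * y) * (g * c)⁻¹ = g * (c * x * c⁻¹) * (c * y * c⁻¹) * g⁻¹ := by group
        _ = g * x * (c * (d * y * d⁻¹) * c⁻¹) * g⁻¹ := by rw [e1, e2]
        _ = _ := by rw [hh]; group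
    · rw [Set.ncard_smul_set, hB, hD]
  let N : Subgroup G := MulAction.stabilizer G B
  have hN : ∀ n, n ∈ N ↔ n • B = B := fun n => Iff.rfl
  have hcomm : ∀ g : G, x⁻¹ * (g * x * g⁻¹) ∈ N := by
    intro g
    rw [hN, mul_smul, hAB g]
    have := hAB 1
    simp only [one_mul, inv_one, mul_one] at this
    rw [← this, inv_smul_smul]
  have hconj : ∀ g : G, ∀ n ∈ N, ∀ b ∈ B, g * n * g⁻¹ * b ∈ B := by
    intro g n hn b hb
    have h1 := hBc b g⁻¹ hb
    have h2 : n * (g⁻¹ * b * g⁻¹⁻¹) ∈ B := by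
      have := Set.smul_mem_smul_set (a := n) h1
      rwa [(hN n).1 hn] at this
    have h3 := hBc _ g h2
    convert h3 using 1
    group
  have hNn : N.Normal := by
    constructor
    intro n hn g
    rw [hN]
    refine Set.eq_of_subset_of_ncard_le ?_ ?_ (Set.toFinite _)
    · rintro _ ⟨b, hb, rfl⟩
      exact hconj g n hn b hb
    · rw [Set.ncard_smul_set]
  have hdvd : Nat.card N ∣ j := by
    have e1 : (QuotientGroup.mk ⁻¹' ((QuotientGroup.mk : G → G ⧸ N) '' B)) = B := by
      apply Set.Subset.antisymm
      · rintro g ⟨b, hb, hbg⟩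
        have h1 : b⁻¹ * g ∈ N := QuotientGroup.eq.1 hbg
        have h2 := hconj b _ h1 b hb
        convert h2 using 1
        group
      · exact Set.subset_preimage_image _ _
    have e2 := Nat.card_congr (QuotientGroup.preimageMkEquivSubgroupProdSet N ((QuotientGroup.mk : G → G ⧸ N) '' B))
    rw [e1, Nat.card_prod] at e2
    have e3 : Nat.card B = j := hB
    rw [e3] at e2
    exact ⟨_, e2⟩
  have hxZ : x ∉ Subgroup.center G := not_center_of_index (by rw [hx]; exact hi.one_lt.ne')
  have hcard : Nat.card N = j := by
    refine ((Nat.dvd_prime hj).1 hdvd).resolve_left fun h1 => ?_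
    rw [Subgroup.card_eq_one] at h1
    apply hxZ
    rw [Subgroup.mem_center_iff]
    intro g
    have h2 := hcomm g
    rw [h1, Subgroup.mem_bot, inv_mul_eq_one] at h2
    conv_rhs => rw [h2]
    group
  have hpow : ∀ n ∈ N, n ^ j = 1 := by
    intro n hn
    have := pow_card_eq_one' (x := (⟨n, hn⟩ : N))
    rw [hcard] at this
    exact congrArg Subtype.val this
  have hgen : ∀ n ∈ N, n ≠ 1 → ∀ a ∈ N, ∃ k : ℤ, n ^ k = a := by
    intro n hn hn1 a ha
    haveI := Fact.mk hj
    have := mem_zpowers_of_prime_card (g := (⟨n, hn⟩ : N)) (g' := ⟨a, ha⟩) hcard (fun h => hn1 (congrArg Subtype.val h))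
    obtain ⟨k, hk⟩ := Subgroup.mem_zpowers_iff.1 this
    exact ⟨k, congrArg Subtype.val hk⟩
  refine ⟨N, hNn, hcard, hcomm, fun n hn => ⟨1, by rw [pow_one]; exact hpow n hn⟩, ?_, ?_⟩
  · intro n hn g h
    by_cases hn1 : n = 1
    · rw [hn1, mem_Ce]; simp
    obtain ⟨a, ha⟩ := hgen n hn hn1 _ (hNn.conj_mem n hn g)
    obtain ⟨b, hb⟩ := hgen n hn hn1 _ (hNn.conj_mem n hn h)
    have e1 : g * h * n * (g * h)⁻¹ = n ^ (a * b) := by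
      calc g * h * n * (g * h)⁻¹ = g * (h * n * h⁻¹) * g⁻¹ := by group
        _ = (g * n * g⁻¹) ^ b := by rw [← hb, conj_zpow]
        _ = _ := by rw [← ha, zpow_mul]
    have e2 : h * g * n * (h * g)⁻¹ = n ^ (a * b) := by
      calc h * g * n * (h * g)⁻¹ = h * (g * n * g⁻¹) * h⁻¹ := by group
        _ = (h * n * h⁻¹) ^ a := by rw [← ha, conj_zpow]
        _ = _ := by rw [← hb, mul_comm a b, zpow_mul]
    rw [mem_Ce]
    have e3 := e1.trans e2.symm
    calc (h * g)⁻¹ * (g * h) * n = (h * g)⁻¹ * (g * h * n * (g * h)⁻¹) * (g * h) := by group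
      _ = _ := by rw [e3]; group
  · intro n hn hn1 g hg
    have hgN : ∀ a ∈ N, g * a = a * g := by
      intro a ha
      obtain ⟨k, rfl⟩ := hgen n hn hn1 a ha
      have : Commute g n := mem_Ce.1 hg
      exact this.zpow_right k
    set ν := x⁻¹ * (g * x * g⁻¹) with hν
    have hνN : ν ∈ N := hcomm g
    have hk : ∀ k : ℕ, g ^ k * x * (g ^ k)⁻¹ = x * ν ^ k := by
      intro k
      induction k with
      | zero => simp
      | succ k ih =>
        have e1 : g * x * g⁻¹ = x * ν := by rw [hν]; group
        have e2 : g * ν ^ k * g⁻¹ = ν ^ k := by rw [hgN _ (pow_mem hνN k)]; group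
        calc g ^ (k + 1) * x * (g ^ (k + 1))⁻¹ = g * (g ^ k * x * (g ^ k)⁻¹) * g⁻¹ := by rw [pow_succ']; group
          _ = (g * x * g⁻¹) * (g * ν ^ k * g⁻¹) := by rw [ih]; group
          _ = _ := by rw [e1, e2, pow_succ', mul_assoc]
    obtain ⟨k, hk0, hki, hkm⟩ := Subgroup.exists_pow_mem_of_index_ne_zero (index_ne_zero' (Ce x)) g
    rw [hx] at hki
    have e1 := hk k
    rw [mem_Ce.1 hkm, mul_inv_cancel_right] at e1
    have e2 : ν ^ k = 1 := (mul_eq_left.1 e1.symm)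
    have e3 := orderOf_dvd_of_pow_eq_one e2
    have e4 := orderOf_dvd_of_pow_eq_one (hpow ν hνN)
    have e5 : ν = 1 := by
      rcases (Nat.dvd_prime hj).1 e4 with h1 | h1
      · exact orderOf_eq_one_iff.1 h1
      · rw [h1] at e3
        exact absurd (Nat.le_of_dvd hk0 e3) (by omega)
    rw [hν, inv_mul_eq_one] at e5
    rw [mem_Ce]
    conv_rhs => rw [e5]
    group

lemma finish {j d a b : ℕ} (hj : j.Prime) {n : G} (hn : PE j n) (hnZ : n ∉ Subgroup.center G)
    (hder : ∀ g h : G, (h * g)⁻¹ * (g * h) ∈ Ce n) (hd : d ∣ (Ce n).index)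
    (hm : ∀ x : G, d ∣ (Ce x).index → (Ce x).index = a ∨ (Ce x).index = b) : Group.IsSolvable G := by
  wlog ha : (Ce n).index = a generalizing a b with H
  · exact H (fun x hx => (hm x hx).symm) ((hm n hd).resolve_left ha)
  have hL : LH j (b / a) (Ce n) := by
    intro x hx hxZ
    have hcop := hn.coprime hj (PP.coe.2 hx)
    have hc : n * (x : G) = x * n := (mem_Ce.1 x.2).symm
    have e1 := Ce_mul hc hcop
    rw [Ce_subgroup]
    change (Ce (x : G)).relIndex (Ce n) = b / a
    have e2 := inf_index (x : G) n
    rw [inf_comm, ← e1, ha] at e2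
    have ha0 : 0 < a := Nat.pos_of_ne_zero (ha ▸ index_ne_zero' _)
    have hdx : d ∣ (Ce (n * (x : G))).index := by rw [e2]; exact (ha ▸ hd).mul_left _
    rcases hm _ hdx with e | e
    · exfalso
      have h1 : Ce n ≤ Ce (x : G) := Ce_le_of_index hc hcop (by rw [e, ha])
      apply hxZ
      rw [Subgroup.mem_center_iff]
      intro g
      exact Subtype.ext (mem_Ce.1 (h1 g.2))
    · rw [← e, e2, Nat.mul_div_cancel _ ha0]
  have hs := thmL hj hL
  haveI hnor : (Ce n).Normal := by
    constructor
    intro c hc g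
    have h4 := hder c g⁻¹
    have e4 : (g⁻¹ * c)⁻¹ * (c * g⁻¹) = c⁻¹ * (g * c * g⁻¹) := by group
    rw [e4] at h4
    have := mul_mem hc h4
    convert this using 1
    group
  rw [Group.isSolvable_iff_subgroup_quotient (Ce n)]
  refine ⟨hs, ?_⟩
  apply Group.isSolvable_of_comm
  intro a b
  induction a using QuotientGroup.induction_on with
  | H a =>
    induction b using QuotientGroup.induction_on with
    | H b =>
      rw [← QuotientGroup.mk_mul, ← QuotientGroup.mk_mul]
      exact (QuotientGroup.eq.2 (hder a b)).symm
end X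
end CS

namespace CS
section X
variable {G : Type*} [Group G] [Finite G]

lemma KN.ne {j i : ℕ} (hj : j.Prime) {x : G} {N : Subgroup G} (h : KN j x N) : ∃ n ∈ N, n ≠ 1 := by
  by_contra hcon
  push Not at hcon
  have : N = ⊥ := (Subgroup.eq_bot_iff_forall N).2 hcon
  have h1 := h.card
  rw [this, Subgroup.card_bot] at h1
  exact hj.one_lt.ne h1

lemma KN.not_center {j : ℕ} {x : G} {N : Subgroup G} (h : KN j x N) (hx : x ∉ Subgroup.center G) {n : G} (hn : n ∈ N) (hn1 : n ≠ 1) :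
    n ∉ Subgroup.center G := by
  intro hz
  have h1 := h.le n hn hn1
  rw [Ce_eq_top.2 hz] at h1
  exact hx (Ce_eq_top.1 (top_le_iff.1 h1))

lemma KN.fin {i j a b : ℕ} (hi : i.Prime) (hj : j.Prime) {x : G} {N : Subgroup G} (h : KN j x N) (hx : (Ce x).index = i)
    (hm : ∀ x : G, i ∣ (Ce x).index → (Ce x).index = a ∨ (Ce x).index = b) : Group.IsSolvable G := by
  obtain ⟨n, hn, hn1⟩ := h.ne (i := i) hj
  have hxZ : x ∉ Subgroup.center G := not_center_of_index (by rw [hx]; exact hi.one_lt.ne')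
  exact finish hj (h.pe n hn) (h.not_center hxZ hn hn1) (h.der n hn) (hx ▸ index_dvd_of_Ce_le (h.le n hn hn1)) hm

lemma KN.disj {j j' : ℕ} (hj : j.Prime) (hj' : j'.Prime) (hne : j ≠ j') {x : G} {N N' : Subgroup G} (h : KN j x N) (h' : KN j' x N')
    (hx : x ∉ Subgroup.center G) : False := by
  apply hx
  rw [Subgroup.mem_center_iff]
  intro g
  have h1 := h.pe _ (h.com g)
  have h2 := (h'.pe _ (h'.com g)).pp hj' hj hne.symm
  have h3 := h1.eq_one hj h2
  rw [inv_mul_eq_one] at h3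
  conv_rhs => rw [h3]
  group

lemma KN.both {p q r a b : ℕ} (hp : p.Prime) (hq : q.Prime) (hr : r.Prime) (hpq : p ≠ q) {x y : G} {N M : Subgroup G} (hN : KN r x N)
    (hM : KN r y M) (hx : (Ce x).index = p) (hy : (Ce y).index = q)
    (hm : ∀ x : G, p * q ∣ (Ce x).index → (Ce x).index = a ∨ (Ce x).index = b) : Group.IsSolvable G := by
  have hxZ : x ∉ Subgroup.center G := not_center_of_index (by rw [hx]; exact hp.one_lt.ne')
  have hyZ : y ∉ Subgroup.center G := not_center_of_index (by rw [hy]; exact hq.one_lt.ne')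
  have hcop : p.Coprime q := (Nat.coprime_primes hp hq).2 hpq
  have hdv : ∀ n : G, Ce n ≤ Ce x → Ce n ≤ Ce y → p * q ∣ (Ce n).index := fun n h1 h2 =>
    hcop.mul_dvd_of_dvd_of_dvd (hx ▸ index_dvd_of_Ce_le h1) (hy ▸ index_dvd_of_Ce_le h2)
  by_cases hex : ∃ n ∈ N, n ∈ M ∧ n ≠ 1
  · obtain ⟨n, hn, hnM, hn1⟩ := hex
    exact finish hr (hN.pe n hn) (hN.not_center hxZ hn hn1) (hN.der n hn) (hdv n (hN.le n hn hn1) (hM.le n hnM hn1)) hm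
  · push Not at hex
    obtain ⟨n, hn, hn1⟩ := hN.ne (i := p) hr
    obtain ⟨l, hl, hl1⟩ := hM.ne (i := p) hr
    have hNn := hN.nor
    have hMn := hM.nor
    have hc : n * l = l * n := by
      have h1 : n * l * n⁻¹ * l⁻¹ ∈ N := by
        have := mul_mem hn (hNn.conj_mem _ (inv_mem hn) l)
        convert this using 1; group
      have h2 : n * l * n⁻¹ * l⁻¹ ∈ M := mul_mem (hMn.conj_mem _ hl n) (inv_mem hl)
      have h3 := hex _ h1 h2
      rw [mul_inv_eq_one, mul_inv_eq_iff_eq_mul] at h3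
      exact h3
    have hle : Ce (n * l) ≤ Ce n := by
      intro g hg
      have e0 : g * (n * l) * g⁻¹ = n * l := by rw [mem_Ce.1 hg]; group
      have e1 : n⁻¹ * (g * n * g⁻¹) = l * (g * l * g⁻¹)⁻¹ := by
        have : g * n * g⁻¹ * (g * l * g⁻¹) = n * l := by rw [← e0]; group
        rw [eq_mul_inv_iff_mul_eq, mul_assoc, this]; group
      have h1 : n⁻¹ * (g * n * g⁻¹) ∈ N := mul_mem (inv_mem hn) (hNn.conj_mem n hn g)
      have h2 : n⁻¹ * (g * n * g⁻¹) ∈ M := by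
        rw [e1]
        exact mul_mem hl (inv_mem (hMn.conj_mem l hl g))
      have h3 := hex _ h1 h2
      rw [inv_mul_eq_one] at h3
      rw [mem_Ce]
      conv_rhs => rw [h3]
      group
    have hle2 : Ce (n * l) ≤ Ce l := by
      intro g hg
      have h1 := hle hg
      rw [mem_Ce_comm] at h1 hg ⊢
      have e : l = n⁻¹ * (n * l) := by group
      rw [e]
      exact mul_mem (inv_mem h1) hg
    refine finish hr ((hN.pe n hn).mul (hM.pe l hl) hc) ?_ ?_ (hdv _ (hle.trans (hN.le n hn hn1)) (hle2.trans (hM.le l hl hl1))) hm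
    · intro hz
      rw [Ce_eq_top.2 hz, top_le_iff] at hle
      exact hN.not_center hxZ hn hn1 (Ce_eq_top.1 hle)
    · intro g h
      rw [mem_Ce_comm]
      exact mul_mem (mem_Ce_comm.1 (hN.der n hn g h)) (mem_Ce_comm.1 (hM.der l hl g h))

theorem six {p q r a b : ℕ} (hp : p.Prime) (hq : q.Prime) (hr : r.Prime) (hpq : p < q) (hqr : q < r)
    (h : ∀ x : G, (Ce x).index = 1 ∨ (Ce x).index = p ∨ (Ce x).index = q ∨ (Ce x).index = r ∨ (Ce x).index = a ∨ (Ce x).index = b)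
    (hxp : ∃ x : G, (Ce x).index = p) (hxq : ∃ x : G, (Ce x).index = q) (hxr : ∃ x : G, (Ce x).index = r) : Group.IsSolvable G := by
  obtain ⟨xp, hxp⟩ := hxp
  obtain ⟨xq, hxq⟩ := hxq
  obtain ⟨xr, hxr⟩ := hxr
  have npm : ∀ s t : ℕ, s.Prime → t.Prime → ¬ (s * t).Prime := fun s t hs ht => Nat.not_prime_mul hs.one_lt.ne' ht.one_lt.ne'
  -- an attained product of two primes is a or b
  have hab : ∀ s t : ℕ, s.Prime → t.Prime → (∃ x : G, (Ce x).index = s * t) → s * t = a ∨ s * t = b := by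
    intro s t hs ht ⟨x, hx⟩
    have h0 := npm s t hs ht
    have h1 : s * t ≠ 1 := fun h1 => hs.one_lt.ne' (Nat.eq_one_of_mul_eq_one_right h1)
    have h2 : s * t ≠ p := fun h1 => h0 (h1 ▸ hp)
    have h3 : s * t ≠ q := fun h1 => h0 (h1 ▸ hq)
    have h4 : s * t ≠ r := fun h1 => h0 (h1 ▸ hr)
    have := h x
    rw [hx] at this
    tauto
  have n1 : ∀ s : ℕ, s.Prime → ¬ s ∣ 1 := fun s hs h1 => hs.one_lt.ne' (Nat.dvd_one.1 h1)
  have dpq : ¬ p ∣ q := fun h1 => hpq.ne ((Nat.prime_dvd_prime_iff_eq hp hq).1 h1)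
  have dpr : ¬ p ∣ r := fun h1 => (hpq.trans hqr).ne ((Nat.prime_dvd_prime_iff_eq hp hr).1 h1)
  have dqp : ¬ q ∣ p := fun h1 => hpq.ne' ((Nat.prime_dvd_prime_iff_eq hq hp).1 h1)
  have dqr : ¬ q ∣ r := fun h1 => hqr.ne ((Nat.prime_dvd_prime_iff_eq hq hr).1 h1)
  have dpqr : ¬ p ∣ q * r := fun h1 => (hp.dvd_mul.1 h1).elim dpq dpr
  have dqpr : ¬ q ∣ p * r := fun h1 => (hq.dvd_mul.1 h1).elim dqp dqr
  -- multiples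
  have mulp : ∀ x : G, p ∣ (Ce x).index → (Ce x).index = p ∨ (Ce x).index = a ∨ (Ce x).index = b := by
    intro x hx
    rcases h x with e | e | e | e | e
    · exact (n1 p hp (e ▸ hx)).elim
    · exact Or.inl e
    · exact (dpq (e ▸ hx)).elim
    · exact (dpr (e ▸ hx)).elim
    · exact Or.inr e
  have mulq : ∀ x : G, q ∣ (Ce x).index → (Ce x).index = q ∨ (Ce x).index = a ∨ (Ce x).index = b := by
    intro x hx
    rcases h x with e | e | e | e | e
    · exact (n1 q hq (e ▸ hx)).elim
    · exact (dqp (e ▸ hx)).elim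
    · exact Or.inl e
    · exact (dqr (e ▸ hx)).elim
    · exact Or.inr e
  -- if one of a, b is not a multiple
  have mul2 : ∀ s c : ℕ, ¬ s ∣ c → (c = a ∨ c = b) → (∀ x : G, s ∣ (Ce x).index → (Ce x).index = s ∨ (Ce x).index = a ∨ (Ce x).index = b) →
      ∃ f : ℕ, ∀ x : G, s ∣ (Ce x).index → (Ce x).index = s ∨ (Ce x).index = f := by
    rintro s c hsc (rfl | rfl) hx
    · refine ⟨b, fun x hd => ?_⟩
      rcases hx x hd with e | e | e
      · exact Or.inl e
      · exact (hsc (e ▸ hd)).elim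
      · exact Or.inr e
    · refine ⟨a, fun x hd => ?_⟩
      rcases hx x hd with e | e | e
      · exact Or.inl e
      · exact Or.inr e
      · exact (hsc (e ▸ hd)).elim
  by_cases cqr : ∃ x : G, (Ce x).index = q * r
  · obtain ⟨f, hf⟩ := mul2 p _ dpqr (hab q r hq hr cqr) mulp
    by_cases cpq : ∃ x : G, (Ce x).index = p * q
    · by_cases cpr : ∃ x : G, (Ce x).index = p * r
      · exfalso
        have e1 := hab q r hq hr cqr
        have e2 := hab p q hp hq cpq
        have e3 := hab p r hp hr cpr
        have l1 : p * q < p * r := Nat.mul_lt_mul_of_pos_left hqr hp.pos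
        have l2 : p * r < q * r := Nat.mul_lt_mul_of_pos_right hpq hr.pos
        omega
      · push Not at cpr
        obtain ⟨N, hN⟩ := lemK hp hr (hpq.trans hqr) hxp hxr cpr
        exact hN.fin hp hr hxp hf
    · push Not at cpq
      obtain ⟨N, hN⟩ := lemK hp hq hpq hxp hxq cpq
      exact hN.fin hp hq hxp hf
  · push Not at cqr
    obtain ⟨M, hM⟩ := lemK hq hr hqr hxq hxr cqr
    by_cases cpr : ∃ x : G, (Ce x).index = p * r
    · obtain ⟨f, hf⟩ := mul2 q _ dqpr (hab p r hp hr cpr) mulq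
      exact hM.fin hq hr hxq hf
    · push Not at cpr
      obtain ⟨N, hN⟩ := lemK hp hr (hpq.trans hqr) hxp hxr cpr
      refine hN.both (a := a) (b := b) hp hq hr hpq.ne hM hxp hxq ?_
      intro x hx
      rcases mulp x ((dvd_mul_right p q).trans hx) with e | e
      · exact (dqp (e ▸ (dvd_mul_left q p).trans hx)).elim
      · exact e
end X
end CS

theorem stmt_4 (G : Type*) [Group G] [Finite G]
    (hcomp : {n ∈ csSet G | IsCompositeNat n}.ncard = 2)
    (hcard : (csSet G).ncard = 3 ∨ (csSet G).ncard = 6) :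
    IsSolvable G := by
  have hmem : ∀ x : G, (CS.Ce x).index ∈ csSet G := fun x => ⟨x, rfl⟩
  have h1 : 1 ∈ csSet G := ⟨1, by
    change 1 = (CS.Ce (1:G)).index
    rw [CS.Ce_eq_top.2 (Subgroup.one_mem _), Subgroup.index_top]⟩
  have hpos : ∀ n ∈ csSet G, n ≠ 0 := by
    rintro n ⟨g, rfl⟩
    exact CS.index_ne_zero' _
  have hfin : (csSet G).Finite := by
    apply Set.finite_of_ncard_ne_zero
    omega
  obtain ⟨a, b, hab, habs⟩ := Set.ncard_eq_two.1 hcomp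
  have hP : ({n ∈ csSet G | n.Prime}.ncard) + 3 = (csSet G).ncard := by
    have e1 : csSet G = {n ∈ csSet G | n.Prime} ∪ ({n ∈ csSet G | IsCompositeNat n} ∪ {1}) := by
      ext n
      simp only [Set.mem_union, Set.mem_setOf_eq, Set.mem_singleton_iff, IsCompositeNat]
      constructor
      · intro hn
        by_cases hp : n.Prime
        · exact Or.inl ⟨hn, hp⟩
        · have := hpos n hn
          by_cases hn1 : n = 1
          · exact Or.inr (Or.inr hn1)
          · exact Or.inr (Or.inl ⟨hn, by omega, hp⟩)
      · rintro (h | h | rfl)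
        · exact h.1
        · exact h.1
        · exact h1
    have e2 : ({n ∈ csSet G | IsCompositeNat n} ∪ {1}).ncard = 3 := by
      rw [Set.ncard_union_eq ?_ (hfin.subset (Set.sep_subset _ _)) (Set.finite_singleton 1), hcomp, Set.ncard_singleton]
      rw [Set.disjoint_singleton_right]
      rintro ⟨-, h2, -⟩
      omega
    conv_rhs => rw [e1]
    rw [Set.ncard_union_eq ?_ (hfin.subset (Set.sep_subset _ _))
      ((hfin.subset (Set.sep_subset _ _)).union (Set.finite_singleton 1)), e2]
    rw [Set.disjoint_left]
    rintro n ⟨-, hp⟩ (⟨-, -, h2⟩ | rfl)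
    · exact h2 hp
    · exact Nat.not_prime_one hp
  have hcl : ∀ x : G, (CS.Ce x).index = 1 ∨ (CS.Ce x).index ∈ {n ∈ csSet G | n.Prime} ∨ (CS.Ce x).index = a ∨ (CS.Ce x).index = b := by
    intro x
    by_cases hp : (CS.Ce x).index.Prime
    · exact Or.inr (Or.inl ⟨hmem x, hp⟩)
    · by_cases hx1 : (CS.Ce x).index = 1
      · exact Or.inl hx1
      · right; right
        have h2 : (CS.Ce x).index ∈ {n ∈ csSet G | IsCompositeNat n} := by
          have := hpos _ (hmem x)
          exact ⟨hmem x, by omega, hp⟩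
        rw [habs] at h2
        exact h2
  rcases hcard with hc | hc
  · rw [hc] at hP
    have hP0 : {n ∈ csSet G | n.Prime}.ncard = 0 := by omega
    rw [Set.ncard_eq_zero (hfin.subset (Set.sep_subset _ _))] at hP0
    refine CS.Ito (m := a) (n := b) ?_
    intro x hx
    rcases hcl x with h | h | h
    · exact (hx (CS.Ce_eq_top.1 (Subgroup.index_eq_one.1 h))).elim
    · rw [hP0] at h
      exact h.elim
    · exact h
  · rw [hc] at hP
    have hP3 : {n ∈ csSet G | n.Prime}.ncard = 3 := by omega
    obtain ⟨p, q, r, hpq, hpr, hqr, hS⟩ := Set.ncard_eq_three.1 hP3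
    have key : ∀ p q r : ℕ, {n ∈ csSet G | n.Prime} = {p, q, r} → p < q → q < r → Group.IsSolvable G := by
      intro p q r hS hpq hqr
      have hp : p ∈ {n ∈ csSet G | n.Prime} := by rw [hS]; simp
      have hq : q ∈ {n ∈ csSet G | n.Prime} := by rw [hS]; simp
      have hr : r ∈ {n ∈ csSet G | n.Prime} := by rw [hS]; simp
      refine CS.six (a := a) (b := b) hp.2 hq.2 hr.2 hpq hqr ?_ ?_ ?_ ?_
      · intro x
        have := hcl x
        rw [hS] at this
        simp only [Set.mem_insert_iff, Set.mem_singleton_iff] at this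
        tauto
      · obtain ⟨x, hx⟩ := hp.1; exact ⟨x, hx.symm⟩
      · obtain ⟨x, hx⟩ := hq.1; exact ⟨x, hx.symm⟩
      · obtain ⟨x, hx⟩ := hr.1; exact ⟨x, hx.symm⟩
    have s1 : ∀ x y z : ℕ, ({x, y, z} : Set ℕ) = {y, x, z} := fun x y z => Set.insert_comm x y {z}
    have s2 : ∀ x y z : ℕ, ({x, y, z} : Set ℕ) = {x, z, y} := fun x y z => by rw [Set.pair_comm y z]
    rcases lt_or_gt_of_ne hpq with h1 | h1 <;> rcases lt_or_gt_of_ne hqr with h2 | h2 <;> rcases lt_or_gt_of_ne hpr with h3 | h3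
    · exact key p q r hS h1 h2
    · omega
    · exact key p r q (hS.trans (s2 p q r)) h3 h2
    · exact key r p q (hS.trans ((s2 p q r).trans (s1 p r q))) h3 h1
    · exact key q p r (hS.trans (s1 p q r)) h1 h3
    · exact key q r p (hS.trans ((s1 p q r).trans (s2 q p r))) h2 h3
    · omega
    · exact key r q p (hS.trans ((s1 p q r).trans ((s2 q p r).trans (s1 q r p)))) h2 h1
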